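/- Let n ∈ ℕ, β ∈ (0,1), 0 < α < min{1/(1 + n(n+1)), β/2}, let g₀ ∈ ℝ^{n×n}_sym be positive definite, and let U ⊂ ℝⁿ be a smoothly bounded domain. Then there exist ε₀ > 0, C > 0 and r > 0 such that for all θ, μ, δ ∈ (0,∞) satisfying μ ≥ δ and δ^{β−2} μ^{−β} θ² ≤ ε₀ the following holds: if g ∈ C^{0,β}(Ū, ℝ^{n×n}_sym) satisfies ‖g − g₀‖₀ ≤ r and [g]_β ≤ θ², and if u ∈ C²(Ū, ℝ^{n+1}) satisfies ‖u*e − g‖₀ ≤ δ² and ‖∇²u‖₀ ≤ μ, then there exists an isometric immersion ū ∈ C^{1,α}(Ū, ℝ^{n+1}) of g (i.e. ū*e = g) with ‖∇ū − ∇u‖₀ ≤ Cδ and [∇ū − ∇u]_α ≤ C μ^α δ^{1−α}. -/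

import Mathlib

open MeasureTheory Matrix Topology

noncomputable section

/-- Frobenius norm of an `n × n` matrix. -/
def frobN {n : ℕ} (M : Matrix (Fin n) (Fin n) ℝ) : ℝ := Real.sqrt (∑ i, ∑ j, (M i j)^2)

/-- Euclidean norm on ℝⁿ. -/
def normE {n : ℕ} (y : Fin n → ℝ) : ℝ := Real.sqrt (∑ i, (y i)^2)

/-- Pullback metric `(u*e)ᵢⱼ = ∂ᵢu ⋅ ∂ⱼu` of a map `u : ℝⁿ → ℝⁿ⁺¹`. -/
def pullback {n : ℕ} (u : (Fin n → ℝ) → (Fin (n+1) → ℝ)) (x : Fin n → ℝ) :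
    Matrix (Fin n) (Fin n) ℝ :=
  Matrix.of fun i j => ∑ k, fderiv ℝ u x (Pi.single i 1) k * fderiv ℝ u x (Pi.single j 1) k

/-- `f ∈ C^k(Ū)`: `f` is `C^k` on an open neighbourhood of the closure of `U`. -/
def CkCl {n : ℕ} (k : ℕ∞) (U : Set (Fin n → ℝ)) {F : Type*} [NormedAddCommGroup F]
    [NormedSpace ℝ F] (f : (Fin n → ℝ) → F) : Prop :=
  ∃ V : Set (Fin n → ℝ), IsOpen V ∧ closure U ⊆ V ∧ ContDiffOn ℝ k f V

/-- `f ∈ C^{1,α}(Ū)`. -/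
def C1Holder {n : ℕ} (α : ℝ) (U : Set (Fin n → ℝ)) {F : Type*} [NormedAddCommGroup F]
    [NormedSpace ℝ F] (f : (Fin n → ℝ) → F) : Prop :=
  ContinuousOn f (closure U) ∧ DifferentiableOn ℝ f U ∧
    ∃ C : ℝ, ∀ x ∈ U, ∀ y ∈ U, ‖fderiv ℝ f x - fderiv ℝ f y‖ ≤ C * normE (x - y) ^ α

/-- `U` has smooth boundary. -/
def HasSmoothBoundary {n : ℕ} (U : Set (Fin n → ℝ)) : Prop :=
  ∃ ρ : (Fin n → ℝ) → ℝ, ContDiff ℝ (⊤ : ℕ∞) ρ ∧ U = ρ ⁻¹' Set.Iio 0 ∧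
    ∀ x ∈ frontier U, fderiv ℝ ρ x ≠ 0

namespace CI
open scoped ContDiff

/-- Symbol class: smooth on `D`, with `k`-th derivatives bounded by `C * lam ^ k` for `k ≤ N`. -/
def SC {E F : Type} [NormedAddCommGroup E] [NormedSpace ℝ E] [NormedAddCommGroup F]
    [NormedSpace ℝ F] (D : Set E) (C lam : ℝ) (N : ℕ) (f : E → F) : Prop :=
  ContDiffOn ℝ ∞ f D ∧ ∀ k ≤ N, ∀ x ∈ D, ‖iteratedFDerivWithin ℝ k f D x‖ ≤ C * lam ^ k

section SCsec
variable {E F G H : Type} [NormedAddCommGroup E] [NormedSpace ℝ E] [NormedAddCommGroup F]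
    [NormedSpace ℝ F] [NormedAddCommGroup G] [NormedSpace ℝ G] [NormedAddCommGroup H]
    [NormedSpace ℝ H]
variable {D D' : Set E} {C C' C₁ C₂ lam lam' : ℝ} {N N' : ℕ} {f g : E → F}

lemma SC.bound (h : SC D C lam N f) {x : E} (hx : x ∈ D) : ‖f x‖ ≤ C := by
  have := h.2 0 (Nat.zero_le _) x hx
  simpa using this

lemma SC.mono (h : SC D C lam N f) (hC0 : 0 ≤ C) (hl0 : 0 ≤ lam) (hC : C ≤ C') (hl : lam ≤ lam')
    (hN : N' ≤ N) : SC D C' lam' N' f := by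
  refine ⟨h.1, fun k hk x hx => (h.2 k (hk.trans hN) x hx).trans ?_⟩
  have : lam ^ k ≤ lam' ^ k := pow_le_pow_left₀ hl0 hl k
  have h2 : 0 ≤ lam ^ k := pow_nonneg hl0 k
  exact mul_le_mul hC this h2 (hC0.trans hC)

lemma SC.congr (h : SC D C lam N f) (hfg : Set.EqOn g f D) : SC D C lam N g := by
  refine ⟨h.1.congr hfg, fun k hk x hx => ?_⟩
  rw [iteratedFDerivWithin_congr hfg hx]
  exact h.2 k hk x hx

lemma SC.subset (h : SC D C lam N f) (hD : IsOpen D) (hD' : IsOpen D') (hs : D' ⊆ D) :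
    SC D' C lam N f := by
  refine ⟨h.1.mono hs, fun k hk x hx => ?_⟩
  rw [iteratedFDerivWithin_of_isOpen k hD' hx, ← iteratedFDerivWithin_of_isOpen k hD (hs hx)]
  exact h.2 k hk x (hs hx)

lemma SC.add (hD : IsOpen D) (hf : SC D C₁ lam N f) (hg : SC D C₂ lam N g) :
    SC D (C₁ + C₂) lam N (fun x => f x + g x) := by
  refine ⟨hf.1.add hg.1, fun k hk x hx => ?_⟩
  have : iteratedFDerivWithin ℝ k (fun x => f x + g x) D x = _ :=
    fun_iteratedFDerivWithin_add_apply (i := k) ((hf.1 x hx).of_le (mod_cast le_top))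
      ((hg.1 x hx).of_le (mod_cast le_top)) hD.uniqueDiffOn hx
  rw [this, add_mul]
  exact (norm_add_le _ _).trans (add_le_add (hf.2 k hk x hx) (hg.2 k hk x hx))

lemma SC.bilin (hD : IsOpen D) (B : F →L[ℝ] G →L[ℝ] H) {g : E → G} (hC1 : 0 ≤ C₁)
    (hl : 0 ≤ lam) (hf : SC D C₁ lam N f) (hg : SC D C₂ lam N g) :
    SC D (‖B‖ * 2 ^ N * C₁ * C₂) lam N (fun x => B (f x) (g x)) := by
  refine ⟨?_, fun k hk x hx => ?_⟩
  · exact (B.isBoundedBilinearMap.contDiff.comp_contDiffOn (hf.1.prodMk hg.1))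
  · have hC2 : 0 ≤ C₂ := (norm_nonneg _).trans (hg.bound hx)
    have h := B.norm_iteratedFDerivWithin_le_of_bilinear hf.1 hg.1 hD.uniqueDiffOn hx
      (n := k) (mod_cast le_top)
    refine h.trans ?_
    have h2 : ∑ i ∈ Finset.range (k + 1), (k.choose i : ℝ) * ‖iteratedFDerivWithin ℝ i f D x‖ *
        ‖iteratedFDerivWithin ℝ (k - i) g D x‖ ≤
        ∑ i ∈ Finset.range (k + 1), (k.choose i : ℝ) * (C₁ * C₂ * lam ^ k) := by
      refine Finset.sum_le_sum fun i hi => ?_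
      have hik : i ≤ k := Nat.lt_succ_iff.mp (Finset.mem_range.mp hi)
      rw [mul_assoc]
      refine mul_le_mul_of_nonneg_left ?_ (by positivity)
      have e : lam ^ k = lam ^ i * lam ^ (k - i) := by rw [← pow_add]; congr 1; omega
      calc _ ≤ (C₁ * lam ^ i) * (C₂ * lam ^ (k - i)) :=
            mul_le_mul (hf.2 i (hik.trans hk) x hx) (hg.2 (k-i) (by omega) x hx) (norm_nonneg _)
              (by positivity)
        _ = _ := by rw [e]; ring
    rw [← Finset.sum_mul, ← Nat.cast_sum, Nat.sum_range_choose] at h2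
    calc _ ≤ ‖B‖ * (((2 ^ k : ℕ) : ℝ) * (C₁ * C₂ * lam ^ k)) := by gcongr
      _ ≤ ‖B‖ * ((2 : ℝ) ^ N * (C₁ * C₂ * lam ^ k)) := by
        push_cast
        gcongr
        norm_num
      _ = _ := by ring

lemma SC.clm (hD : IsOpen D) (L : F →L[ℝ] G) (hf : SC D C lam N f) :
    SC D (‖L‖ * C) lam N (fun x => L (f x)) := by
  refine ⟨L.contDiff.comp_contDiffOn hf.1, fun k hk x hx => ?_⟩
  have := L.norm_iteratedFDerivWithin_comp_left (hf.1 x hx) hD.uniqueDiffOn hx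
    (n := k) (mod_cast le_top)
  refine this.trans ?_
  rw [mul_assoc]
  exact mul_le_mul_of_nonneg_left (hf.2 k hk x hx) (norm_nonneg _)

lemma SC.const (hC : 0 ≤ C) (hl : 0 ≤ lam) (c : F) (hc : ‖c‖ ≤ C) :
    SC D C lam N (fun _ => c) := by
  refine ⟨contDiffOn_const, fun k hk x hx => ?_⟩
  rcases Nat.eq_zero_or_pos k with rfl | h
  · simpa using hc
  · rw [iteratedFDerivWithin_const_of_ne (by omega)]
    simp; positivity

lemma SC.fderiv (hD : IsOpen D) (hf : SC D C lam (N + 1) f) :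
    SC D (C * lam) lam N (_root_.fderiv ℝ f) := by
  refine ⟨hf.1.fderiv_of_isOpen hD (by simp), fun k hk x hx => ?_⟩
  have e : Set.EqOn (_root_.fderiv ℝ f) (fderivWithin ℝ f D) D := fun y hy =>
    (fderivWithin_of_isOpen hD hy).symm
  rw [iteratedFDerivWithin_congr e hx, norm_iteratedFDerivWithin_fderivWithin hD.uniqueDiffOn hx]
  refine (hf.2 (k+1) (by omega) x hx).trans (le_of_eq (by ring))

lemma SC.norm_fderiv (hD : IsOpen D) (hf : SC D C lam (N + 1) f) {x : E} (hx : x ∈ D) :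
    ‖_root_.fderiv ℝ f x‖ ≤ C * lam := (hf.fderiv hD).bound hx

/-- composition, core version -/
lemma SC.comp_core (hD : IsOpen D) {Ω : Set F} (hΩ : IsOpen Ω) {φ : F → G} {B A : ℝ}
    (hφ : ContDiffOn ℝ ∞ φ Ω) (hfΩ : Set.MapsTo f D Ω) (hf : ContDiffOn ℝ ∞ f D)
    (hA : 1 ≤ A) (hl : 0 ≤ lam)
    (hB : ∀ i ≤ N, ∀ x ∈ D, ‖iteratedFDerivWithin ℝ i φ Ω (f x)‖ ≤ B)
    (hfb : ∀ i, 1 ≤ i → i ≤ N → ∀ x ∈ D, ‖iteratedFDerivWithin ℝ i f D x‖ ≤ (A * lam) ^ i) :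
    SC D ((N.factorial : ℝ) * B * A ^ N) lam N (fun x => φ (f x)) := by
  refine ⟨hφ.comp hf hfΩ, fun k hk x hx => ?_⟩
  have hB0 : 0 ≤ B := (norm_nonneg _).trans (hB 0 (Nat.zero_le _) x hx)
  have := norm_iteratedFDerivWithin_comp_le (n := k) hφ hf (mod_cast le_top) hΩ.uniqueDiffOn
    hD.uniqueDiffOn hfΩ hx (fun i hi => hB i (hi.trans hk) x hx)
    (fun i h1 hi => hfb i h1 (hi.trans hk) x hx)
  refine this.trans ?_
  rw [mul_pow, ← mul_assoc]
  have h1 : ((k.factorial : ℕ) : ℝ) ≤ (N.factorial : ℝ) := mod_cast Nat.factorial_le hk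
  have h2 : A ^ k ≤ A ^ N := pow_le_pow_right₀ hA hk
  gcongr

/-- composition with a function smooth near a compact set -/
lemma SC.comp_compact {Ω : Set F} (hΩ : IsOpen Ω) {φ : F → G} (hφ : ContDiffOn ℝ ∞ φ Ω)
    {S : Set F} (hS : IsCompact S) (hSΩ : S ⊆ Ω) (N : ℕ) (C : ℝ) :
    ∃ C' > 0, ∀ (D : Set E) (lam : ℝ) (f : E → F), IsOpen D → 0 ≤ lam → Set.MapsTo f D S →
      SC D C lam N f → SC D C' lam N (fun x => φ (f x)) := by
  have hb : ∀ i : ℕ, ∃ B, ∀ y ∈ S, ‖iteratedFDerivWithin ℝ i φ Ω y‖ ≤ B := fun i => by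
    have hc : ContinuousOn (iteratedFDerivWithin ℝ i φ Ω) S :=
      (hφ.continuousOn_iteratedFDerivWithin (mod_cast le_top) hΩ.uniqueDiffOn).mono hSΩ
    exact hS.exists_bound_of_continuousOn hc
  choose B hB using hb
  set BB := ∑ i ∈ Finset.range (N+1), |B i| + 1
  have hBB : 0 < BB := by positivity
  have hBle : ∀ i ≤ N, B i ≤ BB := fun i hi => by
    have : |B i| ≤ ∑ i ∈ Finset.range (N+1), |B i| :=
      Finset.single_le_sum (f := fun i => |B i|) (fun _ _ => abs_nonneg _)
        (Finset.mem_range.mpr (by omega))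
    have := le_abs_self (B i)
    simp only [BB]; linarith
  set A := max C 1
  have hA : 1 ≤ A := le_max_right _ _
  refine ⟨(N.factorial : ℝ) * BB * A ^ N, by positivity, fun D lam f hD hl hm hf => ?_⟩
  refine SC.comp_core hD hΩ hφ (fun x hx => hSΩ (hm hx)) hf.1 hA hl
    (fun i hi x hx => (hB i _ (hm hx)).trans (hBle i hi)) (fun i h1 hi x hx => ?_)
  refine (hf.2 i hi x hx).trans ?_
  rw [mul_pow]
  have : C ≤ A ^ i := (le_max_left _ _).trans (le_self_pow₀ hA (by omega))
  gcongr

/-- oscillating factor -/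
lemma SC.sin_lin (D : Set E) (hD : IsOpen D) (ν : E →L[ℝ] ℝ) (N : ℕ) (hl : 0 ≤ lam) :
    SC D ((N.factorial : ℝ) * 1 * (max ‖ν‖ 1) ^ N) lam N (fun x => Real.sin (lam * ν x)) := by
  have h1 : (fun x => Real.sin (lam * ν x)) = fun x => Real.sin ((lam • ν) x) := by
    funext x; simp
  rw [h1]
  refine SC.comp_core hD isOpen_univ (φ := Real.sin) (Real.contDiff_sin.contDiffOn)
    (Set.mapsTo_univ _ _) (lam • ν).contDiff.contDiffOn (le_max_right _ _) hl ?_ ?_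
  · intro i hi x hx
    rw [iteratedFDerivWithin_univ, norm_iteratedFDeriv_eq_norm_iteratedDeriv]
    exact Real.abs_iteratedDeriv_sin_le_one _ _
  · intro i h1 hi x hx
    rw [iteratedFDerivWithin_of_isOpen i hD hx]
    obtain ⟨j, rfl⟩ : ∃ j, i = j + 1 := ⟨i - 1, by omega⟩
    rw [← norm_iteratedFDeriv_fderiv]
    have e : _root_.fderiv ℝ (fun x => (lam • ν) x) = fun _ => lam • ν := by
      funext y; exact (lam • ν).fderiv
    have hle : lam * ‖ν‖ ≤ max ‖ν‖ 1 * lam := by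
      rw [mul_comm]; exact mul_le_mul_of_nonneg_right (le_max_left _ _) hl
    rw [e]
    rcases Nat.eq_zero_or_pos j with rfl | h
    · rw [norm_iteratedFDeriv_zero, norm_smul, Real.norm_of_nonneg hl]
      simpa using hle
    · rw [iteratedFDeriv_const_of_ne (by omega)]
      simp; positivity

lemma SC.smul (hD : IsOpen D) {a : E → ℝ} (hC1 : 0 ≤ C₁) (hC2 : 0 ≤ C₂)
    (hl : 0 ≤ lam) (ha : SC D C₁ lam N a) (hf : SC D C₂ lam N f) :
    SC D (2 ^ N * C₁ * C₂) lam N (fun x => a x • f x) := by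
  have h := SC.bilin hD (ContinuousLinearMap.lsmul ℝ ℝ (E := F)) hC1 hl ha hf
  refine SC.mono h (by positivity) hl ?_ le_rfl le_rfl
  have : ‖ContinuousLinearMap.lsmul ℝ ℝ (E := F)‖ ≤ 1 := ContinuousLinearMap.opNorm_lsmul_le
  have h0 : 0 ≤ 2 ^ N * C₁ * C₂ := by positivity
  calc _ = ‖ContinuousLinearMap.lsmul ℝ ℝ (E := F)‖ * (2 ^ N * C₁ * C₂) := by ring
    _ ≤ 1 * (2 ^ N * C₁ * C₂) := by gcongr
    _ = _ := one_mul _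

lemma SC.mul (hD : IsOpen D) {a b : E → ℝ} (hC1 : 0 ≤ C₁) (hC2 : 0 ≤ C₂)
    (hl : 0 ≤ lam) (ha : SC D C₁ lam N a) (hb : SC D C₂ lam N b) :
    SC D (2 ^ N * C₁ * C₂) lam N (fun x => a x * b x) := SC.smul hD hC1 hC2 hl ha hb

lemma SC.const_smul (hD : IsOpen D) (c : ℝ) (hf : SC D C lam N f) :
    SC D (|c| * C) lam N (fun x => c • f x) := by
  refine ⟨hf.1.const_smul c, fun k hk x hx => ?_⟩
  have : iteratedFDerivWithin ℝ k (fun x => c • f x) D x = _ :=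
    iteratedFDerivWithin_const_smul_apply ((hf.1 x hx).of_le (mod_cast le_top)) hD.uniqueDiffOn hx
  rw [this, norm_smul, mul_assoc, Real.norm_eq_abs]
  exact mul_le_mul_of_nonneg_left (hf.2 k hk x hx) (abs_nonneg _)

lemma SC.sub (hD : IsOpen D) (hf : SC D C₁ lam N f) (hg : SC D C₂ lam N g) :
    SC D (C₁ + C₂) lam N (fun x => f x - g x) := by
  have h := SC.add hD hf (SC.const_smul hD (-1) hg)
  simpa [sub_eq_add_neg] using h

lemma SC.sum (hD : IsOpen D) {ι : Type} (s : Finset ι) {Cs : ι → ℝ} {fs : ι → E → F}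
    (hl : 0 ≤ lam)
    (h : ∀ i ∈ s, SC D (Cs i) lam N (fs i)) :
    SC D (∑ i ∈ s, Cs i) lam N (fun x => ∑ i ∈ s, fs i x) := by
  classical
  induction s using Finset.induction_on with
  | empty => simpa using SC.const (D := D) (N := N) (F := F) le_rfl hl 0 (by simp)
  | insert a s ha ih =>
    simp only [Finset.sum_insert ha]
    exact SC.add hD (h a (by simp)) (ih fun i hi => h i (by simp [hi]))

end SCsec
end CI

namespace CI
open scoped ContDiff Convolution

section moll
variable {n : ℕ}

lemma conv_deriv_bound (k : ℕ) : ∀ {X Y W : Type} [NormedAddCommGroup X] [NormedSpace ℝ X]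
    [NormedAddCommGroup Y] [NormedSpace ℝ Y] [NormedAddCommGroup W] [NormedSpace ℝ W]
    (φ : (Fin n → ℝ) → X) (L : X →L[ℝ] Y →L[ℝ] W) (g : (Fin n → ℝ) → Y) (M : ℝ) (y : Fin n → ℝ),
    HasCompactSupport φ → ContDiff ℝ ∞ φ → tsupport φ ⊆ Metric.closedBall 0 1 →
    LocallyIntegrable g → (∀ z ∈ Metric.closedBall y 1, ‖g z‖ ≤ M) →
    ‖iteratedFDeriv ℝ k (φ ⋆[L, volume] g) y‖ ≤ ‖L‖ * (∫ t, ‖iteratedFDeriv ℝ k φ t‖) * M := by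
  induction k with
  | zero =>
    intro X Y W _ _ _ _ _ _ φ L g M y hc hs ht hg hM
    simp only [norm_iteratedFDeriv_zero]
    unfold convolution
    have hi : Integrable (fun t => ‖φ t‖) :=
      (hs.continuous.integrable_of_hasCompactSupport hc).norm
    have : ‖∫ t, L (φ t) (g (y - t))‖ ≤ ∫ t, ‖L‖ * ‖φ t‖ * M := by
      refine norm_integral_le_of_norm_le ((hi.const_mul _).mul_const _) (Filter.Eventually.of_forall ?_)
      intro t
      by_cases h : t ∈ Metric.closedBall (0 : Fin n → ℝ) 1
      · have h2 : y - t ∈ Metric.closedBall y 1 := by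
          simpa [Metric.mem_closedBall, dist_eq_norm] using h
        exact (L.le_opNorm₂ _ _).trans (mul_le_mul_of_nonneg_left (hM _ h2) (by positivity))
      · have : φ t = 0 := by
          by_contra h'
          exact h (ht (subset_tsupport _ h'))
        simp [this]
    rw [integral_mul_const, integral_const_mul] at this
    exact this
  | succ k ih =>
    intro X Y W _ _ _ _ _ _ φ L g M y hc hs ht hg hM
    rw [← norm_iteratedFDeriv_fderiv]
    have e : fderiv ℝ (φ ⋆[L, volume] g) = (fderiv ℝ φ ⋆[L.precompL (Fin n → ℝ), volume] g) := by
      funext x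
      exact (hc.hasFDerivAt_convolution_left L (hs.of_le (mod_cast le_top)) hg x).fderiv
    rw [e]
    have hM0 : 0 ≤ M := (norm_nonneg _).trans (hM y (by simp))
    refine (ih (fderiv ℝ φ) (L.precompL (Fin n → ℝ)) g M y (hc.fderiv (𝕜 := ℝ))
      (hs.fderiv_right (by simp)) ((tsupport_fderiv_subset ℝ).trans ht) hg hM).trans ?_
    simp only [norm_iteratedFDeriv_fderiv]
    have := ContinuousLinearMap.norm_precompL_le (Fin n → ℝ) L
    have h0 : 0 ≤ ∫ t, ‖iteratedFDeriv ℝ (k+1) φ t‖ := integral_nonneg fun _ => norm_nonneg _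
    gcongr

/-- a fixed smooth bump -/
def bmp (n : ℕ) : ContDiffBump (0 : Fin n → ℝ) := ⟨1/2, 1, by norm_num, by norm_num⟩
/-- the normalized kernel -/
def ker (n : ℕ) : (Fin n → ℝ) → ℝ := (bmp n).normed volume

lemma ker_smooth : ContDiff ℝ ∞ (ker n) := (bmp n).contDiff_normed (n := ⊤)
lemma ker_cpt : HasCompactSupport (ker n) := (bmp n).hasCompactSupport_normed
lemma ker_int : ∫ t, ker n t = 1 := (bmp n).integral_normed
lemma ker_nonneg (t : Fin n → ℝ) : 0 ≤ ker n t := (bmp n).nonneg_normed t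
lemma ker_tsupp : tsupport (ker n) ⊆ Metric.closedBall 0 1 := by
  unfold ker
  rw [ContDiffBump.tsupport_normed_eq]; rfl
lemma ker_integrable : Integrable (ker n) := ker_smooth.continuous.integrable_of_hasCompactSupport ker_cpt
lemma ker_zero {t : Fin n → ℝ} (h : t ∉ Metric.closedBall (0 : Fin n → ℝ) 1) : ker n t = 0 := by
  by_contra h'
  exact h (ker_tsupp (subset_tsupport _ h'))

variable {F : Type} [NormedAddCommGroup F] [NormedSpace ℝ F]

/-- mollification at scale `l` of `f` restricted to `D` -/
def moll (D : Set (Fin n → ℝ)) (l : ℝ) (f : (Fin n → ℝ) → F) (x : Fin n → ℝ) : F :=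
  ∫ t, ker n t • D.indicator f (x - l • t)

lemma locInt {D : Set (Fin n → ℝ)} (hD : IsOpen D) {f : (Fin n → ℝ) → F} {B : ℝ}
    (hf : ContinuousOn f D) (hB : ∀ x ∈ D, ‖f x‖ ≤ B) : LocallyIntegrable (D.indicator f) := by
  have hm : AEStronglyMeasurable (D.indicator f) volume := by
    rw [aestronglyMeasurable_indicator_iff hD.measurableSet]
    exact hf.aestronglyMeasurable hD.measurableSet
  have : LocallyIntegrable (fun _ : Fin n → ℝ => |B|) := locallyIntegrable_const _
  refine this.mono hm (Filter.Eventually.of_forall fun x => ?_)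
  by_cases hx : x ∈ D
  · simp only [Set.indicator_of_mem hx, Real.norm_eq_abs, abs_abs]
    exact (hB x hx).trans (le_abs_self _)
  · simp [Set.indicator_of_notMem hx]

lemma moll_eq_conv {D : Set (Fin n → ℝ)} {l : ℝ} (hl : 0 < l) (f : (Fin n → ℝ) → F) :
    moll D l f = fun x => (ker n ⋆[ContinuousLinearMap.lsmul ℝ ℝ, volume]
      (((fun y => l • y) ⁻¹' D).indicator (fun y => f (l • y)))) (l⁻¹ • x) := by
  funext x
  unfold moll convolution
  congr 1
  funext t
  have : l • (l⁻¹ • x - t) = x - l • t := by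
    rw [smul_sub, smul_smul, mul_inv_cancel₀ hl.ne', one_smul]
  simp only [ContinuousLinearMap.lsmul_apply]
  congr 1
  change _ = D.indicator f (l • (l⁻¹ • x - t))
  rw [this]

lemma locInt' {D : Set (Fin n → ℝ)} (hD : IsOpen D) {f : (Fin n → ℝ) → F} {B : ℝ} (l : ℝ)
    (hf : ContinuousOn f D) (hB : ∀ x ∈ D, ‖f x‖ ≤ B) :
    LocallyIntegrable (((fun y => l • y) ⁻¹' D).indicator (fun y : Fin n → ℝ => f (l • y))) := by
  have hc : Continuous (fun y : Fin n → ℝ => l • y) := by fun_prop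
  exact locInt (hD.preimage hc) (hf.comp hc.continuousOn (fun x hx => hx)) (fun x hx => hB _ hx)

lemma moll_smooth {D : Set (Fin n → ℝ)} (hD : IsOpen D) {f : (Fin n → ℝ) → F} {B : ℝ} {l : ℝ}
    (hl : 0 < l) (hf : ContinuousOn f D) (hB : ∀ x ∈ D, ‖f x‖ ≤ B) : ContDiff ℝ ∞ (moll D l f) := by
  rw [moll_eq_conv hl]
  have := ker_cpt.contDiff_convolution_left (n := ⊤) (ContinuousLinearMap.lsmul ℝ ℝ)
    (ker_smooth (n := n)) (locInt' hD l hf hB)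
  have h2 : ContDiff ℝ ∞ (fun x : Fin n → ℝ => l⁻¹ • x) := contDiff_id.const_smul l⁻¹
  have h3 := this.comp h2
  exact h3

/-- derivative constants -/
def kc (n k : ℕ) : ℝ := ∫ t, ‖iteratedFDeriv ℝ k (ker n) t‖
lemma kc_nonneg (k : ℕ) : 0 ≤ kc n k := integral_nonneg fun _ => norm_nonneg _
lemma kc_zero : kc n 0 = 1 := by
  unfold kc
  simp only [norm_iteratedFDeriv_zero]
  rw [← ker_int (n := n)]
  congr 1; funext t
  exact Real.norm_of_nonneg (ker_nonneg t)

lemma moll_deriv0 {D : Set (Fin n → ℝ)} (hD : IsOpen D) {f : (Fin n → ℝ) → F} {B : ℝ} {l : ℝ}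
    (hl : 0 < l) (hf : ContinuousOn f D) (hB : ∀ x ∈ D, ‖f x‖ ≤ B) (k : ℕ) (x : Fin n → ℝ) (M : ℝ)
    (hM0 : 0 ≤ M)
    (hM : ∀ z ∈ Metric.closedBall x l, z ∈ D → ‖f z‖ ≤ M) :
    ‖iteratedFDeriv ℝ k (moll D l f) x‖ ≤ kc n k * M * (l⁻¹) ^ k := by
  rw [moll_eq_conv hl]
  have hsm := ker_cpt.contDiff_convolution_left (n := ⊤) (ContinuousLinearMap.lsmul ℝ ℝ)
    (ker_smooth (n := n)) (locInt' hD l hf hB)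
  rw [iteratedFDeriv_comp_const_smul l⁻¹ (hsm.of_le (mod_cast le_top)), norm_smul, norm_pow,
    Real.norm_of_nonneg (inv_nonneg.mpr hl.le), mul_comm]
  refine mul_le_mul_of_nonneg_right ?_ (by positivity)
  refine (conv_deriv_bound k (ker n) (ContinuousLinearMap.lsmul ℝ ℝ (E := F)) _ M (l⁻¹ • x) ker_cpt ker_smooth
    ker_tsupp (locInt' hD l hf hB) ?_).trans ?_
  · intro z hz
    by_cases h : l • z ∈ D
    · rw [Set.indicator_of_mem (by exact h)]
      refine hM _ ?_ h
      rw [Metric.mem_closedBall, dist_eq_norm] at hz ⊢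
      have : l • z - x = l • (z - l⁻¹ • x) := by
        rw [smul_sub, smul_smul, mul_inv_cancel₀ hl.ne', one_smul]
      rw [this, norm_smul, Real.norm_of_nonneg hl.le]
      nlinarith
    · rw [Set.indicator_of_notMem (by exact h)]; simpa using hM0
  · have : ‖ContinuousLinearMap.lsmul ℝ ℝ (E := F)‖ ≤ 1 := ContinuousLinearMap.opNorm_lsmul_le
    have h0 := kc_nonneg (n := n) k
    change _ * kc n k * M ≤ _
    calc _ = ‖ContinuousLinearMap.lsmul ℝ ℝ (E := F)‖ * (kc n k * M) := by ring
      _ ≤ 1 * (kc n k * M) := by gcongr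
      _ = _ := one_mul _

lemma moll_integrable {D : Set (Fin n → ℝ)} (hD : IsOpen D) {f : (Fin n → ℝ) → F} {B : ℝ} (l : ℝ)
    (hf : ContinuousOn f D) (hB : ∀ x ∈ D, ‖f x‖ ≤ B) (x : Fin n → ℝ) :
    Integrable (fun t => ker n t • D.indicator f (x - l • t)) := by
  have hc : Continuous (fun t : Fin n → ℝ => x - l • t) := by fun_prop
  have e : (fun t => D.indicator f (x - l • t)) =
      ((fun t => x - l • t) ⁻¹' D).indicator (fun t => f (x - l • t)) := by
    funext t
    rfl
  have h1 : LocallyIntegrable (fun t => D.indicator f (x - l • t)) := by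
    rw [e]
    exact locInt (hD.preimage hc) (hf.comp hc.continuousOn (fun x hx => hx)) (fun x hx => hB _ hx)
  exact h1.integrable_smul_left_of_hasCompactSupport ker_smooth.continuous ker_cpt

lemma moll_sub_const {D : Set (Fin n → ℝ)} (hD : IsOpen D) {f : (Fin n → ℝ) → F} {B : ℝ} {l : ℝ}
    (hl : 0 < l) (hf : ContinuousOn f D) (hB : ∀ x ∈ D, ‖f x‖ ≤ B) {x : Fin n → ℝ}
    (hx : Metric.closedBall x l ⊆ D) (c : F) [CompleteSpace F] :
    moll D l (fun y => f y - c) x = moll D l f x - c := by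
  have h2 : c = ∫ t, ker n t • c := by
    rw [integral_smul_const, ker_int, one_smul]
  have h3 : moll D l (fun y => f y - c) x = ∫ t, (ker n t • D.indicator f (x - l • t) - ker n t • c) := by
    unfold moll
    congr 1; funext t
    by_cases h : t ∈ Metric.closedBall (0 : Fin n → ℝ) 1
    · have h2 : x - l • t ∈ D := by
        apply hx
        rw [mem_closedBall_zero_iff] at h
        rw [Metric.mem_closedBall, dist_eq_norm]
        simp only [sub_sub_cancel_left, norm_neg, norm_smul, Real.norm_of_nonneg hl.le]
        nlinarith
      rw [Set.indicator_of_mem h2, Set.indicator_of_mem h2, smul_sub]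
    · simp [ker_zero h]
  rw [h3, integral_sub (moll_integrable hD l hf hB x) (ker_integrable.smul_const c), ← h2]
  rfl

/-- The main derivative bound for mollifications. -/
lemma moll_deriv {D D' : Set (Fin n → ℝ)} (hD : IsOpen D) (hD' : IsOpen D')
    {f : (Fin n → ℝ) → F} {B : ℝ} {l : ℝ} [CompleteSpace F]
    (hl : 0 < l) (hf : ContinuousOn f D) (hB : ∀ x ∈ D, ‖f x‖ ≤ B)
    (hDD : ∀ x ∈ D', Metric.closedBall x l ⊆ D) (k : ℕ) {x : Fin n → ℝ} (hx : x ∈ D') (M : ℝ) (c : F)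
    (hM : ∀ z ∈ Metric.closedBall x l, ‖f z - c‖ ≤ M) :
    ‖iteratedFDerivWithin ℝ k (fun y => moll D l f y - c) D' x‖ ≤ kc n k * M * (l⁻¹) ^ k := by
  have e : Set.EqOn (fun y => moll D l f y - c) (moll D l (fun y => f y - c)) D' := fun y hy =>
    (moll_sub_const hD hl hf hB (hDD y hy) c).symm
  rw [iteratedFDerivWithin_congr e hx, iteratedFDerivWithin_of_isOpen k hD' hx]
  have hM0 : 0 ≤ M := (norm_nonneg _).trans (hM x (by simp [hl.le]))
  refine moll_deriv0 hD hl (hf.sub continuousOn_const) (B := B + ‖c‖) ?_ k x M hM0 (fun z hz _ => hM z hz)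
  exact fun y hy => (norm_sub_le _ _).trans (by gcongr; exact hB y hy)

lemma moll_close {D : Set (Fin n → ℝ)} (hD : IsOpen D)
    {f : (Fin n → ℝ) → F} {B : ℝ} {l : ℝ} [CompleteSpace F]
    (hl : 0 < l) (hf : ContinuousOn f D) (hB : ∀ x ∈ D, ‖f x‖ ≤ B) {x : Fin n → ℝ}
    (hx : Metric.closedBall x l ⊆ D) (M : ℝ) (c : F)
    (hM : ∀ z ∈ Metric.closedBall x l, ‖f z - c‖ ≤ M) : ‖moll D l f x - c‖ ≤ M := by
  have hM0 : 0 ≤ M := (norm_nonneg _).trans (hM x (by simp [hl.le]))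
  rw [← moll_sub_const hD hl hf hB hx c]
  have hf2 : ContinuousOn (fun y => f y - c) D := hf.sub continuousOn_const
  have := moll_deriv0 hD hl hf2 (B := B + ‖c‖)
    (fun y hy => (norm_sub_le _ _).trans (by gcongr; exact hB y hy)) 0 x M hM0 (fun z hz _ => hM z hz)
  simpa [kc_zero] using this

lemma moll_fderiv {D D' : Set (Fin n → ℝ)} (hD : IsOpen D) (hD' : IsOpen D')
    {f : (Fin n → ℝ) → F} {B : ℝ} {l : ℝ} (hl : 0 < l) (hf : ContDiffOn ℝ 1 f D)
    (hB0 : ∀ x ∈ D, ‖f x‖ ≤ B) (hB : ∀ x ∈ D, ‖fderiv ℝ f x‖ ≤ B)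
    (hDD : ∀ x ∈ D', Metric.closedBall x l ⊆ D) {x : Fin n → ℝ} (hx : x ∈ D') :
    HasFDerivAt (moll D l f) (moll D l (fderiv ℝ f) x) x := by
  unfold moll
  have hcf' : ContinuousOn (fderiv ℝ f) D := hf.continuousOn_fderiv_of_isOpen hD le_rfl
  have hmem : ∀ t ∈ Metric.closedBall (0 : Fin n → ℝ) 1, ∀ y ∈ D', y - l • t ∈ D := by
    intro t h y hy
    apply hDD y hy
    rw [mem_closedBall_zero_iff] at h
    rw [Metric.mem_closedBall, dist_eq_norm]
    simp only [sub_sub_cancel_left, norm_neg, norm_smul, Real.norm_of_nonneg hl.le]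
    nlinarith
  have hBn : 0 ≤ B := (norm_nonneg _).trans (hB0 x (hDD x hx (by simp [hl.le])))
  refine hasFDerivAt_integral_of_dominated_of_fderiv_le (s := D') (bound := fun t => ker n t * B)
    (F := fun x t => ker n t • D.indicator f (x - l • t))
    (F' := fun x t => ker n t • D.indicator (fderiv ℝ f) (x - l • t))
    (hD'.mem_nhds hx) ?_ (moll_integrable hD l hf.continuousOn hB0 x)
    (moll_integrable hD l hcf' hB x).aestronglyMeasurable ?_ (ker_integrable.mul_const B) ?_
  · exact Filter.Eventually.of_forall fun y =>
      (moll_integrable hD l hf.continuousOn hB0 y).aestronglyMeasurable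
  · refine Filter.Eventually.of_forall fun t y hy => ?_
    rw [norm_smul, Real.norm_of_nonneg (ker_nonneg t)]
    refine mul_le_mul_of_nonneg_left ?_ (ker_nonneg t)
    by_cases h : y - l • t ∈ D
    · rw [Set.indicator_of_mem h]; exact hB _ h
    · rw [Set.indicator_of_notMem h]; simpa using hBn
  · refine Filter.Eventually.of_forall fun t y hy => ?_
    by_cases h : t ∈ Metric.closedBall (0 : Fin n → ℝ) 1
    · have hm := hmem t h y hy
      rw [Set.indicator_of_mem hm]
      have hd : HasFDerivAt f (fderiv ℝ f (y - l • t)) (y - l • t) :=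
        ((hf.contDiffAt (hD.mem_nhds hm)).differentiableAt (by simp)).hasFDerivAt
      have h1 : HasFDerivAt (fun y => f (y - l • t)) (fderiv ℝ f (y - l • t)) y := by
        exact HasFDerivAt.comp y hd ((hasFDerivAt_id y).sub_const _)
      have h2 : (fun x => ker n t • D.indicator f (x - l • t)) =ᶠ[𝓝 y]
          fun x => ker n t • f (x - l • t) := by
        filter_upwards [hD'.mem_nhds hy] with z hz
        rw [Set.indicator_of_mem (hmem t h z hz)]
      exact (h1.const_smul (ker n t)).congr_of_eventuallyEq h2
    · simp only [ker_zero h, zero_smul]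
      exact hasFDerivAt_const _ _

end moll
end CI

namespace CI
open scoped ContDiff

section decomp

lemma posdef_factor {n : ℕ} {A : Matrix (Fin n) (Fin n) ℝ} (hA : A.PosDef) :
    ∃ B : Matrix (Fin n) (Fin n) ℝ, Bᵀ * B = A ∧ IsUnit B.det := by
  open scoped MatrixOrder in
  have h1 : 0 ≤ A := hA.posSemidef.nonneg
  have h2 : CFC.sqrt A * CFC.sqrt A = A := CFC.sqrt_mul_sqrt_self A h1
  have h3 : (CFC.sqrt A).IsHermitian := by
    have : 0 ≤ CFC.sqrt A := CFC.sqrt_nonneg A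
    exact (nonneg_iff_posSemidef.mp this).isHermitian
  have h4 : (CFC.sqrt A)ᵀ = CFC.sqrt A := by
    have := h3.eq
    rwa [conjTranspose_eq_transpose_of_trivial] at this
  refine ⟨CFC.sqrt A, by rw [h4, h2], ?_⟩
  have : (CFC.sqrt A).det * (CFC.sqrt A).det = A.det := by rw [← det_mul, h2]
  have hd := hA.det_pos
  rw [isUnit_iff_ne_zero]
  intro h0
  rw [h0] at this
  simp at this
  linarith

lemma sum_lt_half {n : ℕ} (S : Fin n → Fin n → ℝ) (hS : ∀ i j, S i j = S j i) :
    ∑ i, ∑ j, (if i < j then S i j else 0) = (1/2) * ∑ i, ∑ j, (if i ≠ j then S i j else 0) := by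
  have h1 : ∑ i, ∑ j, (if i < j then S i j else 0) = ∑ i, ∑ j, (if j < i then S i j else 0) := by
    rw [Finset.sum_comm]
    simp only [hS]
  have h2 : ∑ i, ∑ j, (if i ≠ j then S i j else 0) =
      ∑ i, ∑ j, (if i < j then S i j else 0) + ∑ i, ∑ j, (if j < i then S i j else 0) := by
    simp only [← Finset.sum_add_distrib]
    refine Finset.sum_congr rfl fun i _ => Finset.sum_congr rfl fun j _ => ?_
    rcases lt_trichotomy i j with h | h | h
    · simp [h, h.ne, h.not_gt]
    · simp [h]
    · simp [h, h.ne', h.not_gt]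
  linarith

/-- base coefficient functional -/
def cf0 {n : ℕ} (H : Matrix (Fin n) (Fin n) ℝ) (i j : Fin n) : ℝ :=
  if i = j then H i i - ∑ k, (if i ≠ k then H i k else 0) else H i j
/-- base vectors -/
def nu0 {n : ℕ} (i j : Fin n) : Fin n → ℝ := fun a =>
  if i = j then (if a = i then 1 else 0) else (if a = i then 1 else 0) + (if a = j then 1 else 0)

lemma decomp0 {n : ℕ} (H : Matrix (Fin n) (Fin n) ℝ) (hH : ∀ i j, H i j = H j i) (a b : Fin n) :
    H a b = ∑ p : {p : Fin n × Fin n // p.1 ≤ p.2}, cf0 H p.1.1 p.1.2 * nu0 p.1.1 p.1.2 a * nu0 p.1.1 p.1.2 b := by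
  have e1 : ∑ p : {p : Fin n × Fin n // p.1 ≤ p.2}, cf0 H p.1.1 p.1.2 * nu0 p.1.1 p.1.2 a * nu0 p.1.1 p.1.2 b
      = ∑ i, ∑ j, if i ≤ j then cf0 H i j * nu0 i j a * nu0 i j b else 0 := by
    rw [← Finset.sum_product', ← Finset.sum_filter]
    symm
    refine Finset.sum_subtype _ (fun x => ?_) (fun p : Fin n × Fin n => cf0 H p.1 p.2 * nu0 p.1 p.2 a * nu0 p.1 p.2 b)
    simp
  have e2 : ∀ i j, (if i ≤ j then cf0 H i j * nu0 i j a * nu0 i j b else 0) =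
      (if i = j then cf0 H i i * (if a = i then 1 else 0) * (if b = i then 1 else 0) else 0) +
      (if i < j then H i j * ((if a = i then 1 else 0) + (if a = j then 1 else 0)) *
         ((if b = i then 1 else 0) + (if b = j then 1 else 0)) else 0) := by
    intro i j
    rcases lt_trichotomy i j with h | h | h
    · simp [h, h.ne, h.le, cf0, nu0]
    · subst h; simp [nu0]
    · simp [h.ne', h.not_gt, h.not_ge]
  rw [e1]
  simp only [e2, Finset.sum_add_distrib]
  rw [sum_lt_half (fun i j => H i j * ((if a = i then 1 else 0) + (if a = j then 1 else 0)) *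
         ((if b = i then 1 else 0) + (if b = j then 1 else 0))) (fun i j => by rw [hH i j]; ring)]
  have e3 : ∀ i j, (if i ≠ j then H i j * ((if a = i then 1 else 0) + (if a = j then 1 else 0)) *
         ((if b = i then 1 else 0) + (if b = j then 1 else 0)) else 0) =
     (if a = i then (if b = i then (if i ≠ j then H i j else 0) else 0) else 0) +
     (if a = i then (if b = j then (if i ≠ j then H i j else 0) else 0) else 0) +
     (if b = i then (if a = j then (if i ≠ j then H i j else 0) else 0) else 0) +
     (if a = j then (if b = j then (if j ≠ i then H j i else 0) else 0) else 0) := by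
    intro i j
    rw [hH j i]
    by_cases h : i = j
    · simp [h]
    · have h' : ¬ j = i := fun h2 => h h2.symm
      simp only [ne_eq, h, h', not_false_eq_true, if_true]
      split_ifs <;> ring
  simp only [e3, Finset.sum_add_distrib]
  rw [Finset.sum_comm (f := fun i j => (if a = j then (if b = j then (if j ≠ i then H j i else 0) else 0) else 0))]
  by_cases hab : a = b
  · subst hab
    simp [cf0, Finset.sum_ite_irrel]
    ring
  · have : ¬ b = a := fun h => hab h.symm
    simp [hab, this, Finset.sum_ite_irrel, hH b a]
    ring

lemma lin_rep {n : ℕ} (c : Matrix (Fin n) (Fin n) ℝ →ₗ[ℝ] ℝ) (H : Matrix (Fin n) (Fin n) ℝ) :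
    c H = ∑ a, ∑ b, c (Matrix.single a b 1) * H a b := by
  conv_lhs => rw [Matrix.matrix_eq_sum_single H]
  simp only [map_sum]
  refine Finset.sum_congr rfl fun a _ => Finset.sum_congr rfl fun b _ => ?_
  have : Matrix.single a b (H a b) = H a b • Matrix.single a b (1:ℝ) := by simp
  rw [this, map_smul, smul_eq_mul, mul_comm]

/-- base coefficient functional as linear map -/
def cfl {n : ℕ} (i j : Fin n) : Matrix (Fin n) (Fin n) ℝ →ₗ[ℝ] ℝ where
  toFun H := cf0 H i j
  map_add' H H' := by
    unfold cf0
    by_cases h : i = j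
    · simp only [h, if_true, Matrix.add_apply]
      have : ∀ k, (if j ≠ k then H j k + H' j k else 0) = (if j ≠ k then H j k else 0) + (if j ≠ k then H' j k else 0) := by
        intro k; split_ifs <;> simp
      simp only [this, Finset.sum_add_distrib]; ring
    · simp [h]
  map_smul' c H := by
    unfold cf0
    by_cases h : i = j
    · simp only [h, if_true, Matrix.smul_apply, smul_eq_mul, RingHom.id_apply, mul_sub, Finset.mul_sum, mul_ite, mul_zero]
    · simp [h]

lemma card_pairs (n : ℕ) : 2 * Fintype.card {p : Fin n × Fin n // p.1 ≤ p.2} = n * (n+1) := by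
  have h := (Finset.card_sym2 (Finset.univ : Finset (Fin n)))
  have h1 : Fintype.card {p : Fin n × Fin n // p.1 ≤ p.2} = Fintype.card (Sym2 (Fin n)) :=
    Fintype.card_congr Sym2.sortEquiv.symm
  rw [h1, Sym2.card, Fintype.card_fin, Nat.choose_two_right, mul_comm n]
  exact Nat.mul_div_cancel' (by simpa using Nat.even_mul_pred_self (n+1) |>.two_dvd)

lemma decomp {n : ℕ} {g₀ : Matrix (Fin n) (Fin n) ℝ} (hg : g₀.PosDef) :
    ∃ (m : ℕ) (ν : Fin m → Fin n → ℝ) (l : Fin m → Matrix (Fin n) (Fin n) ℝ), 2 * m = n * (n+1) ∧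
      (∀ H : Matrix (Fin n) (Fin n) ℝ, (∀ i j, H i j = H j i) → ∀ i j,
        H i j = ∑ k, (∑ a, ∑ b, l k a b * H a b) * ν k i * ν k j) ∧
      ∀ k, 0 < ∑ a, ∑ b, l k a b * g₀ a b := by
  let H0 : Matrix (Fin n) (Fin n) ℝ := of fun i j => if i = j then (n:ℝ) else 1
  have hH0s : ∀ i j, H0 i j = H0 j i := by
    intro i j; simp only [H0, of_apply, eq_comm]
  have hc : ∀ i j, cf0 H0 i j = 1 := by
    intro i j
    unfold cf0
    by_cases h : i = j
    · subst h
      have : ∀ k, (if i ≠ k then H0 i k else 0) = 1 - if i = k then 1 else 0 := by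
        intro k; by_cases h : i = k <;> simp [h, H0]
      simp only [this, if_true, Finset.sum_sub_distrib]
      simp [H0]
    · simp [h, H0]
  have hpos : H0.PosDef := by
    refine PosDef.of_dotProduct_mulVec_pos ?_ ?_
    · ext i j; simp [conjTranspose_apply, hH0s i j]
    · intro x hx
      have e : star x ⬝ᵥ (H0 *ᵥ x) = ∑ p : {p : Fin n × Fin n // p.1 ≤ p.2}, (∑ a, nu0 p.1.1 p.1.2 a * x a)^2 := by
        simp only [dotProduct, mulVec, Pi.star_apply, star_trivial]
        have := decomp0 H0 hH0s
        simp only [this, hc, one_mul, sq, Finset.sum_mul_sum]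
        rw [Finset.sum_comm]
        refine Finset.sum_congr rfl fun a _ => ?_
        rw [Finset.sum_comm, Finset.mul_sum]
        refine Finset.sum_congr rfl fun b _ => ?_
        rw [Finset.sum_mul, Finset.mul_sum]
        exact Finset.sum_congr rfl fun p _ => by ring
      rw [e]
      obtain ⟨i, hi⟩ : ∃ i, x i ≠ 0 := by
        by_contra h; push Not at h; exact hx (funext h)
      refine Finset.sum_pos' (fun _ _ => sq_nonneg _) ⟨⟨(i,i), le_rfl⟩, Finset.mem_univ _, ?_⟩
      simp only [nu0, if_true, ite_mul, one_mul, zero_mul, Finset.sum_ite_eq', Finset.mem_univ]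
      positivity
  obtain ⟨B, hB, hBu⟩ := posdef_factor hg
  obtain ⟨D, hD, hDu⟩ := posdef_factor hpos
  let T := D⁻¹ * B
  let Ti := B⁻¹ * D
  have hTi : Ti * T = 1 := by
    simp only [T, Ti]
    rw [Matrix.mul_assoc, Matrix.mul_nonsing_inv_cancel_left _ _ hDu, Matrix.nonsing_inv_mul _ hBu]
  have hTi' : T * Ti = 1 := mul_eq_one_comm.mp hTi
  have hBT : D * T = B := by
    simp only [T]; rw [Matrix.mul_nonsing_inv_cancel_left _ _ hDu]
  have hgT : g₀ = Tᵀ * H0 * T := by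
    rw [← hB, ← hD, ← hBT, Matrix.transpose_mul]
    simp only [Matrix.mul_assoc]
  let e := (Fintype.equivFin {p : Fin n × Fin n // p.1 ≤ p.2}).symm
  let cc : {p : Fin n × Fin n // p.1 ≤ p.2} → Matrix (Fin n) (Fin n) ℝ →ₗ[ℝ] ℝ := fun p =>
    (cfl p.1.1 p.1.2).comp ((LinearMap.mulLeft ℝ Tiᵀ).comp (LinearMap.mulRight ℝ Ti))
  have hcc : ∀ p H, cc p H = cf0 (Tiᵀ * (H * Ti)) p.1.1 p.1.2 := fun p H => rfl
  refine ⟨Fintype.card {p : Fin n × Fin n // p.1 ≤ p.2}, fun k j => ∑ a, nu0 (e k).1.1 (e k).1.2 a * T a j,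
    fun k => of fun a b => cc (e k) (Matrix.single a b 1), card_pairs n, ?_, ?_⟩
  · intro H hH i j
    simp only [of_apply, ← lin_rep]
    rw [e.sum_comp (fun p => cc p H * (∑ a, nu0 p.1.1 p.1.2 a * T a i) * (∑ a, nu0 p.1.1 p.1.2 a * T a j))]
    set H' := Tiᵀ * (H * Ti) with hH'
    have hs : ∀ i j, H' i j = H' j i := by
      have h1 : Hᵀ = H := by ext i j; rw [transpose_apply, hH]
      have h2 : H'ᵀ = H' := by
        rw [hH', Matrix.transpose_mul, Matrix.transpose_mul, h1, Matrix.transpose_transpose, Matrix.mul_assoc]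
      intro i j
      conv_lhs => rw [← h2]
      rfl
    have hHH : H = Tᵀ * (H' * T) := by
      rw [hH']
      have h3 : Tᵀ * Tiᵀ = 1 := by rw [← Matrix.transpose_mul, hTi, Matrix.transpose_one]
      rw [Matrix.mul_assoc, Matrix.mul_assoc, hTi, Matrix.mul_one, ← Matrix.mul_assoc, h3, Matrix.one_mul]
    conv_lhs => rw [hHH]
    simp only [hcc, ← hH']
    have hd := decomp0 H' hs
    have : ∀ a b, T a i * (H' a b * T b j) = ∑ p : {p : Fin n × Fin n // p.1 ≤ p.2}, cf0 H' p.1.1 p.1.2 *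
        (nu0 p.1.1 p.1.2 a * T a i) * (nu0 p.1.1 p.1.2 b * T b j) := by
      intro a b
      rw [hd a b, Finset.sum_mul, Finset.mul_sum]
      exact Finset.sum_congr rfl fun p _ => by ring
    have h5 : (Tᵀ * (H' * T)) i j = ∑ a, ∑ b, T a i * (H' a b * T b j) := by
      rw [Matrix.mul_apply]
      refine Finset.sum_congr rfl fun a _ => ?_
      rw [Matrix.mul_apply, Finset.mul_sum]
      rfl
    rw [h5]
    simp only [this]
    have h6 : ∀ p : {p : Fin n × Fin n // p.1 ≤ p.2}, cf0 H' p.1.1 p.1.2 * (∑ a, nu0 p.1.1 p.1.2 a * T a i) *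
        (∑ a, nu0 p.1.1 p.1.2 a * T a j) = ∑ a, ∑ b, cf0 H' p.1.1 p.1.2 *
        (nu0 p.1.1 p.1.2 a * T a i) * (nu0 p.1.1 p.1.2 b * T b j) := by
      intro p
      rw [mul_assoc, Finset.sum_mul_sum, Finset.mul_sum]
      refine Finset.sum_congr rfl fun a _ => ?_
      rw [Finset.mul_sum]
      exact Finset.sum_congr rfl fun b _ => by ring
    simp only [h6]
    symm
    rw [Finset.sum_comm]
    exact Finset.sum_congr rfl fun a _ => Finset.sum_comm
  · intro k
    simp only [of_apply, ← lin_rep]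
    rw [hcc, hgT]
    have h3 : Tiᵀ * Tᵀ = 1 := by rw [← Matrix.transpose_mul, hTi', Matrix.transpose_one]
    have : Tiᵀ * (Tᵀ * H0 * T * Ti) = H0 := by
      rw [Matrix.mul_assoc, hTi', Matrix.mul_one, ← Matrix.mul_assoc, h3, Matrix.one_mul]
    rw [this, hc]
    exact one_pos

end decomp
end CI

namespace CI
open scoped ContDiff

section frame
variable {n : ℕ}

/-- linear maps -/
abbrev Hm (n : ℕ) := (Fin n → ℝ) →L[ℝ] (Fin (n+1) → ℝ)

/-- Gram matrix of a linear map -/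
def pb (L : Hm n) : Matrix (Fin n) (Fin n) ℝ :=
  of fun i j => ∑ k, L (Pi.single i 1) k * L (Pi.single j 1) k

lemma pb_eq_dot (L : Hm n) (i j : Fin n) : pb L i j = L (Pi.single i 1) ⬝ᵥ L (Pi.single j 1) := rfl
lemma pb_symm (L : Hm n) (i j : Fin n) : pb L i j = pb L j i := by
  rw [pb_eq_dot, pb_eq_dot, dotProduct_comm]

/-- rows matrix -/
def rws (w : Fin (n+1) → ℝ) (L : Hm n) : Matrix (Fin (n+1)) (Fin (n+1)) ℝ :=
  of (Fin.cons w (fun i => L (Pi.single i 1)))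

/-- cofactor normal -/
def Nrm (L : Hm n) : Fin (n+1) → ℝ := fun k =>
  (-1)^(k:ℕ) * det (of fun i j : Fin n => L (Pi.single i 1) (k.succAbove j))

lemma det_rws (w : Fin (n+1) → ℝ) (L : Hm n) : (rws w L).det = w ⬝ᵥ Nrm L := by
  rw [det_succ_row_zero]
  refine Finset.sum_congr rfl fun k _ => ?_
  unfold Nrm
  rw [show (rws w L) 0 k = w k from rfl]
  rw [show (rws w L).submatrix Fin.succ k.succAbove = of fun i j : Fin n => L (Pi.single i 1) (k.succAbove j) from rfl]
  ring

lemma Nrm_orth (L : Hm n) (i : Fin n) : L (Pi.single i 1) ⬝ᵥ Nrm L = 0 := by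
  rw [← det_rws]
  refine det_zero_of_row_eq (i := 0) (j := i.succ) (Fin.succ_ne_zero i).symm ?_
  rfl

lemma Nrm_ne (L : Hm n) (hL : (pb L).det ≠ 0) : Nrm L ⬝ᵥ Nrm L ≠ 0 := by
  have h0 : (rws 0 L).det = 0 := by rw [det_rws, zero_dotProduct]
  obtain ⟨w, hw, hw2⟩ := exists_mulVec_eq_zero_iff.mpr h0
  have hwi : ∀ i, L (Pi.single i 1) ⬝ᵥ w = 0 := fun i => by
    have := congrFun hw2 i.succ
    exact this
  have h1 : (rws w L).det ≠ 0 := by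
    intro h
    obtain ⟨v, hv, hv2⟩ := exists_vecMul_eq_zero_iff.mpr h
    have hs : ∀ k, v 0 * w k + ∑ i : Fin n, v i.succ * L (Pi.single i 1) k = 0 := by
      intro k
      have := congrFun hv2 k
      rw [vecMul, dotProduct, Fin.sum_univ_succ] at this
      exact this
    have hdot : ∀ z : Fin (n+1) → ℝ, v 0 * (w ⬝ᵥ z) + ∑ i : Fin n, v i.succ * (L (Pi.single i 1) ⬝ᵥ z) = 0 := by
      intro z
      have : ∑ k, (v 0 * w k + ∑ i : Fin n, v i.succ * L (Pi.single i 1) k) * z k = 0 := by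
        simp [hs]
      rw [← this]
      simp only [dotProduct, add_mul, Finset.sum_add_distrib, Finset.mul_sum, Finset.sum_mul]
      congr 1
      · exact Finset.sum_congr rfl fun k _ => by ring
      · rw [Finset.sum_comm]
        exact Finset.sum_congr rfl fun k _ => Finset.sum_congr rfl fun i _ => by ring
    have hv0 : v 0 = 0 := by
      have := hdot w
      simp only [hwi, mul_zero, Finset.sum_const_zero, add_zero] at this
      rcases mul_eq_zero.mp this with h | h
      · exact h
      · exact absurd (dotProduct_self_eq_zero.mp h) hw
    have hvs : pb L *ᵥ (fun i => v i.succ) = 0 := by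
      funext j
      have := hdot (L (Pi.single j 1))
      rw [hv0, zero_mul, zero_add] at this
      rw [Pi.zero_apply, ← this, mulVec, dotProduct]
      exact Finset.sum_congr rfl fun i _ => by rw [mul_comm, pb_symm]; rfl
    have := exists_mulVec_eq_zero_iff.not.mpr hL
    push Not at this
    refine hv (funext fun k => ?_)
    by_cases hz : (fun i : Fin n => v i.succ) = 0
    · refine Fin.cases hv0 (fun i => congrFun hz i) k
    · exact absurd hvs (this _ hz)
  rw [det_rws] at h1
  intro h
  rw [dotProduct_self_eq_zero.mp h, dotProduct_zero] at h1
  exact h1 rfl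

/-- unit normal -/
def Zf (L : Hm n) : Fin (n+1) → ℝ := (Real.sqrt (Nrm L ⬝ᵥ Nrm L))⁻¹ • Nrm L
/-- tangential dual vector -/
def Xf (ν : Fin n → ℝ) (L : Hm n) : Fin (n+1) → ℝ := ∑ i, ((pb L)⁻¹ *ᵥ ν) i • L (Pi.single i 1)

lemma Zf_orth (L : Hm n) (i : Fin n) : L (Pi.single i 1) ⬝ᵥ Zf L = 0 := by
  unfold Zf; rw [dotProduct_smul, Nrm_orth, smul_zero]
lemma Zf_unit (L : Hm n) (hL : (pb L).det ≠ 0) : Zf L ⬝ᵥ Zf L = 1 := by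
  have h : 0 < Nrm L ⬝ᵥ Nrm L :=
    lt_of_le_of_ne (Finset.sum_nonneg fun i _ => mul_self_nonneg _) (Nrm_ne L hL).symm
  unfold Zf; rw [dotProduct_smul, smul_dotProduct, smul_eq_mul, smul_eq_mul, ← mul_assoc, ← mul_inv,
    Real.mul_self_sqrt h.le, inv_mul_cancel₀ h.ne']
lemma Xf_dot (ν : Fin n → ℝ) (L : Hm n) (hL : (pb L).det ≠ 0) (j : Fin n) :
    L (Pi.single j 1) ⬝ᵥ Xf ν L = ν j := by
  unfold Xf
  rw [dotProduct_sum]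
  have h1 : (pb L *ᵥ ((pb L)⁻¹ *ᵥ ν)) j = ν j := by
    rw [mulVec_mulVec, Matrix.mul_nonsing_inv _ (isUnit_iff_ne_zero.mpr hL), one_mulVec]
  rw [← h1]
  conv_rhs => rw [mulVec, dotProduct]
  refine Finset.sum_congr rfl fun i _ => ?_
  rw [dotProduct_smul, smul_eq_mul, mul_comm]; rfl
lemma Xf_Zf (ν : Fin n → ℝ) (L : Hm n) : Xf ν L ⬝ᵥ Zf L = 0 := by
  unfold Xf
  rw [sum_dotProduct]
  exact Finset.sum_eq_zero fun i _ => by rw [smul_dotProduct, Zf_orth, smul_zero]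

lemma det_smooth {m : ℕ} {G : Type} [NormedAddCommGroup G] [NormedSpace ℝ G] {A : G → Matrix (Fin m) (Fin m) ℝ}
    (hA : ∀ i j, ContDiff ℝ ∞ (fun x => A x i j)) : ContDiff ℝ ∞ (fun x => (A x).det) := by
  simp only [det_apply]
  refine ContDiff.sum fun σ _ => ContDiff.const_smul _ (contDiff_prod fun i _ => hA _ _)

lemma ev_smooth0 (v : Fin n → ℝ) : ContDiff ℝ ∞ (fun L : Hm n => L v) :=
  (ContinuousLinearMap.apply ℝ (Fin (n+1) → ℝ) v).contDiff

lemma ev_smooth (v : Fin n → ℝ) (k : Fin (n+1)) : ContDiff ℝ ∞ (fun L : Hm n => L v k) := by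
  have h : ContDiff ℝ ∞ (fun L : Hm n => L v) := (ContinuousLinearMap.apply ℝ (Fin (n+1) → ℝ) v).contDiff
  exact (contDiff_apply ℝ ℝ k).comp h

lemma pb_smooth (i j : Fin n) : ContDiff ℝ ∞ (fun L : Hm n => pb L i j) := by
  unfold pb
  simp only [of_apply]
  exact ContDiff.sum fun k _ => (ev_smooth _ k).mul (ev_smooth _ k)

lemma Nrm_smooth : ContDiff ℝ ∞ (Nrm : Hm n → _) := by
  rw [contDiff_pi]
  intro k
  unfold Nrm
  refine contDiff_const.mul (det_smooth fun i j => ?_)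
  simp only [of_apply]
  exact ev_smooth _ _

/-- nondegenerate maps -/
def Om (n : ℕ) : Set (Hm n) := {L | (pb L).det ≠ 0}
lemma Om_open : IsOpen (Om n) := by
  have : Continuous (fun L : Hm n => (pb L).det) := (det_smooth pb_smooth).continuous
  exact isOpen_ne.preimage this

lemma Zf_smooth : ContDiffOn ℝ ∞ (Zf : Hm n → _) (Om n) := by
  unfold Zf
  have hd : ContDiff ℝ ∞ (fun L : Hm n => Nrm L ⬝ᵥ Nrm L) := by
    unfold dotProduct
    exact ContDiff.sum fun k _ => ((contDiff_pi.mp Nrm_smooth k).mul (contDiff_pi.mp Nrm_smooth k))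
  have hp : ∀ L ∈ Om n, 0 < Nrm L ⬝ᵥ Nrm L := fun L hL =>
    lt_of_le_of_ne (Finset.sum_nonneg fun i _ => mul_self_nonneg _) (Nrm_ne L hL).symm
  refine ContDiffOn.smul (ContDiffOn.inv (ContDiffOn.sqrt hd.contDiffOn fun L hL => (hp L hL).ne') ?_) Nrm_smooth.contDiffOn
  intro L hL
  exact (Real.sqrt_pos.mpr (hp L hL)).ne'

lemma Xf_smooth (ν : Fin n → ℝ) : ContDiffOn ℝ ∞ (Xf ν : Hm n → _) (Om n) := by
  unfold Xf
  refine ContDiffOn.sum fun i _ => ?_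
  have hev0 : ContDiff ℝ ∞ (fun L : Hm n => L (Pi.single i (1:ℝ))) := ev_smooth0 _
  have hev := hev0.contDiffOn (s := Om n)
  refine ContDiffOn.fun_smul ?_ hev
  unfold mulVec dotProduct
  refine ContDiffOn.sum fun j _ => ContDiffOn.mul ?_ contDiffOn_const
  have : ∀ L : Hm n, (pb L)⁻¹ i j = ((pb L).det)⁻¹ * (pb L).adjugate i j := by
    intro L
    rw [Matrix.inv_def, Ring.inverse_eq_inv', Matrix.smul_apply, smul_eq_mul]
  simp only [this]
  refine ContDiffOn.mul (ContDiffOn.inv (det_smooth pb_smooth).contDiffOn fun L hL => hL) ?_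
  simp only [adjugate_apply]
  refine ContDiff.contDiffOn (det_smooth fun a b => ?_)
  simp only [updateRow_apply]
  by_cases h : a = j
  · simp only [h, if_true]; exact contDiff_const
  · simp only [h, if_false]; exact pb_smooth a b

/-- compact set of almost isometries -/
def Kc (g₀ : Matrix (Fin n) (Fin n) ℝ) (r : ℝ) : Set (Hm n) := {L | ∀ i j, |pb L i j - g₀ i j| ≤ r}

lemma Kc_mono (g₀ : Matrix (Fin n) (Fin n) ℝ) {r r' : ℝ} (h : r ≤ r') : Kc g₀ r ⊆ Kc g₀ r' :=
  fun _ hL i j => (hL i j).trans h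

lemma hm_norm_le (L : Hm n) (B : ℝ) (hB : 0 ≤ B) (h : ∀ i k, |L (Pi.single i 1) k| ≤ B) : ‖L‖ ≤ n * B := by
  refine ContinuousLinearMap.opNorm_le_bound _ (by positivity) fun x => ?_
  have hx : L x = ∑ i, x i • L (Pi.single i 1) := by
    conv_lhs => rw [← Finset.univ_sum_single x]
    rw [map_sum]
    refine Finset.sum_congr rfl fun i _ => ?_
    rw [← map_smul, ← Pi.single_smul, smul_eq_mul, mul_one]
  rw [hx]
  calc ‖∑ i, x i • L (Pi.single i 1)‖ ≤ ∑ i : Fin n, ‖x‖ * B := by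
        refine norm_sum_le_of_le _ fun i _ => ?_
        rw [norm_smul]
        refine mul_le_mul (norm_le_pi_norm x i) ?_ (norm_nonneg _) (norm_nonneg _)
        exact (pi_norm_le_iff_of_nonneg hB).mpr (fun k => h i k)
    _ = n * B * ‖x‖ := by simp; ring

lemma Kc_bound (g₀ : Matrix (Fin n) (Fin n) ℝ) (r : ℝ) : ∃ B, ∀ L ∈ Kc g₀ r, ‖L‖ ≤ B := by
  let b := ∑ i, |g₀ i i| + |r|
  have hb : 0 ≤ b := by positivity
  refine ⟨n * Real.sqrt b, fun L hL => hm_norm_le L _ (Real.sqrt_nonneg _) fun i k => ?_⟩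
  refine Real.abs_le_sqrt ?_
  have h1 : L (Pi.single i 1) k ^ 2 ≤ pb L i i := by
    have : pb L i i = ∑ k, L (Pi.single i 1) k ^ 2 := by
      unfold pb; simp only [of_apply, sq]
    rw [this]
    exact Finset.single_le_sum (f := fun k => L (Pi.single i 1) k ^ 2) (fun _ _ => sq_nonneg _) (Finset.mem_univ k)
  have h2 := (abs_le.mp (hL i i)).2
  have h3 : |g₀ i i| ≤ ∑ i, |g₀ i i| :=
    Finset.single_le_sum (f := fun i => |g₀ i i|) (fun _ _ => abs_nonneg _) (Finset.mem_univ i)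
  have h4 := le_abs_self (g₀ i i)
  have h5 := le_abs_self r
  simp only [b]
  linarith

lemma Kc_compact (g₀ : Matrix (Fin n) (Fin n) ℝ) (r : ℝ) : IsCompact (Kc g₀ r) := by
  have : ProperSpace (Hm n) := FiniteDimensional.proper ℝ _
  refine Metric.isCompact_of_isClosed_isBounded ?_ ?_
  · have : Kc g₀ r = ⋂ i, ⋂ j, {L | |pb L i j - g₀ i j| ≤ r} := by
      ext L; simp [Kc]
    rw [this]
    refine isClosed_iInter fun i => isClosed_iInter fun j => isClosed_le ?_ continuous_const
    exact ((pb_smooth i j).continuous.sub continuous_const).abs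
  · obtain ⟨B, hB⟩ := Kc_bound g₀ r
    exact isBounded_iff_forall_norm_le.mpr ⟨B, hB⟩

lemma exists_r0 {g₀ : Matrix (Fin n) (Fin n) ℝ} (hg : g₀.PosDef) : ∃ r > 0, Kc g₀ r ⊆ Om n := by
  have ho : IsOpen {A : Fin n → Fin n → ℝ | (of A).det ≠ 0} := by
    have : Continuous (fun A : Fin n → Fin n → ℝ => (of A).det) := by
      refine Continuous.matrix_det ?_
      exact continuous_id
    exact isOpen_ne.preimage this
  obtain ⟨ε, hε, hb⟩ := Metric.isOpen_iff.mp ho (fun i j => g₀ i j) (by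
    exact hg.det_pos.ne')
  refine ⟨ε/2, by positivity, fun L hL => ?_⟩
  have : (fun i j => pb L i j) ∈ Metric.ball (fun i j => g₀ i j) ε := by
    rw [Metric.mem_ball, dist_eq_norm]
    refine lt_of_le_of_lt ?_ (half_lt_self hε)
    refine (pi_norm_le_iff_of_nonneg (by positivity)).mpr fun i => ?_
    refine (pi_norm_le_iff_of_nonneg (by positivity)).mpr fun j => ?_
    exact hL i j
  exact hb this

end frame
end CI

namespace CI
open scoped ContDiff

section step
variable {n : ℕ}

lemma abs_dot_le {m : ℕ} (v w : Fin m → ℝ) : |v ⬝ᵥ w| ≤ m * ‖v‖ * ‖w‖ := by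
  unfold dotProduct
  refine (Finset.abs_sum_le_sum_abs _ _).trans ?_
  calc ∑ i, |v i * w i| ≤ ∑ i : Fin m, ‖v‖ * ‖w‖ := by
        refine Finset.sum_le_sum fun i _ => ?_
        rw [abs_mul]
        exact mul_le_mul (norm_le_pi_norm v i) (norm_le_pi_norm w i) (abs_nonneg _) (norm_nonneg _)
    _ = _ := by simp; ring

/-- bilinear dot product -/
def dotL (m : ℕ) : (Fin m → ℝ) →L[ℝ] (Fin m → ℝ) →L[ℝ] ℝ :=
  ∑ k, (ContinuousLinearMap.proj (R := ℝ) (φ := fun _ : Fin m => ℝ) k).smulRight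
    (ContinuousLinearMap.proj (R := ℝ) (φ := fun _ : Fin m => ℝ) k)
lemma dotL_apply {m : ℕ} (v w : Fin m → ℝ) : dotL m v w = v ⬝ᵥ w := by
  unfold dotL dotProduct
  simp

/-- linear functional of a vector -/
def nuL (ν : Fin n → ℝ) : (Fin n → ℝ) →L[ℝ] ℝ := dotL n ν
lemma nuL_single (ν : Fin n → ℝ) (i : Fin n) : nuL ν (Pi.single i 1) = ν i := by
  unfold nuL; rw [dotL_apply]; simp

lemma norm_single_le (i : Fin n) : ‖(Pi.single i 1 : Fin n → ℝ)‖ ≤ 1 := by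
  refine (pi_norm_le_iff_of_nonneg zero_le_one).mpr fun j => ?_
  by_cases h : j = i
  · subst h; simp
  · simp [h]

lemma clm_single_le {G : Type} [NormedAddCommGroup G] [NormedSpace ℝ G] (L : (Fin n → ℝ) →L[ℝ] G) (i : Fin n) :
    ‖L (Pi.single i 1)‖ ≤ ‖L‖ := by
  have := L.le_opNorm (Pi.single i 1)
  have h2 := norm_single_le i
  nlinarith [norm_nonneg L]

/-- pb of a perturbation -/
lemma pb_add (L M : Hm n) (i j : Fin n) : pb (L + M) i j = pb L i j +
    L (Pi.single i 1) ⬝ᵥ M (Pi.single j 1) + L (Pi.single j 1) ⬝ᵥ M (Pi.single i 1) + pb M i j := by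
  simp only [pb_eq_dot, _root_.add_apply, add_dotProduct, dotProduct_add]
  rw [dotProduct_comm (M (Pi.single i 1)) (L (Pi.single j 1))]
  ring

lemma step_algebra (P A Mm R : Fin n → Fin (n+1) → ℝ) (Z X : Fin (n+1) → ℝ) (ν : Fin n → ℝ) (a θ : ℝ)
    (hA : ∀ i, A i = Mm i + R i)
    (hM : ∀ i, Mm i = ν i • (Real.cos θ • Z - (2 * Real.cos (2*θ)) • X))
    (hPZ : ∀ i, P i ⬝ᵥ Z = 0) (hPX : ∀ i, P i ⬝ᵥ X = a^2/4 * ν i) (hZ : Z ⬝ᵥ Z = 2 * a^2)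
    (hXZ : X ⬝ᵥ Z = 0) (i j : Fin n) :
    P i ⬝ᵥ A j + P j ⬝ᵥ A i + A i ⬝ᵥ A j - a^2 * ν i * ν j =
      P i ⬝ᵥ R j + P j ⬝ᵥ R i + Mm i ⬝ᵥ R j + R i ⬝ᵥ Mm j + R i ⬝ᵥ R j
        + 4 * Real.cos (2*θ)^2 * (ν i * ν j) * (X ⬝ᵥ X) := by
  have hZX : Z ⬝ᵥ X = 0 := by rw [dotProduct_comm, hXZ]
  have h1 : ∀ i j, P i ⬝ᵥ Mm j = - (a^2/2) * Real.cos (2*θ) * ν i * ν j := by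
    intro i j
    rw [hM, dotProduct_smul, dotProduct_sub, dotProduct_smul, dotProduct_smul, hPZ, hPX]
    simp only [smul_eq_mul]; ring
  have h2 : Mm i ⬝ᵥ Mm j = ν i * ν j * (Real.cos θ ^2 * (2 * a^2) + 4 * Real.cos (2*θ)^2 * (X ⬝ᵥ X)) := by
    rw [hM, hM]
    simp only [dotProduct_smul, smul_dotProduct, dotProduct_sub, sub_dotProduct, hZX, hXZ, hZ, smul_eq_mul]
    ring
  rw [hA i, hA j]
  simp only [dotProduct_add, add_dotProduct, h1, h2]
  have h3 : Real.cos (2*θ) = 2 * Real.cos θ ^2 - 1 := Real.cos_two_mul θ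
  have h4 : Real.cos θ ^2 = (1 + Real.cos (2*θ))/2 := by rw [h3]; ring
  rw [h4]
  ring

set_option maxHeartbeats 4000000 in
lemma step {g₀ : Matrix (Fin n) (Fin n) ℝ} {r₀ : ℝ} (hK : Kc g₀ r₀ ⊆ Om n) (ν : Fin n → ℝ) (N : ℕ)
    (C : ℝ) (hC : 0 < C) : ∃ C' > 0, ∀ (D : Set (Fin n → ℝ)) (u : (Fin n → ℝ) → (Fin (n+1) → ℝ))
      (a : (Fin n → ℝ) → ℝ) (lam δ K : ℝ), IsOpen D → 0 < lam → 0 < δ → δ ≤ 1 → 1 ≤ K →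
      ContDiffOn ℝ ∞ u D → SC D C lam (N+2) (fderiv ℝ u) →
      (∀ x ∈ D, ‖fderiv ℝ (fderiv ℝ u) x‖ ≤ C * δ * lam) →
      Set.MapsTo (fderiv ℝ u) D (Kc g₀ r₀) → SC D (C * δ) lam (N+2) a →
      ∃ w : (Fin n → ℝ) → (Fin (n+1) → ℝ), SC D (C' * δ / (K * lam)) (K * lam) (N+2) w ∧
        ∀ x ∈ D, ∀ i j, |pb (fderiv ℝ u x + fderiv ℝ w x) i j - pb (fderiv ℝ u x) i j - a x ^2 * ν i * ν j|
          ≤ C' * (δ^2 / K + δ^4) := by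
  obtain ⟨CZ, hCZ, hZf⟩ := SC.comp_compact (E := Fin n → ℝ) Om_open Zf_smooth (Kc_compact g₀ r₀) hK (N+2) C
  obtain ⟨CX, hCX, hXf⟩ := SC.comp_compact (E := Fin n → ℝ) Om_open (Xf_smooth ν) (Kc_compact g₀ r₀) hK (N+2) C
  -- constants
  set Z1 : ℝ := 2 ^ (N+2) * (|Real.sqrt 2| * C) * CZ with hZ1
  set X1 : ℝ := 2 ^ (N+2) * (|(1/4:ℝ)| * (2^(N+2) * C * C)) * CX with hX1
  set S1 : ℝ := ((N+2).factorial : ℝ) * 1 * (max ‖nuL ν‖ 1) ^ (N+2) with hS1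
  set S2 : ℝ := ((N+2).factorial : ℝ) * 1 * (max ‖(2:ℝ) • nuL ν‖ 1) ^ (N+2) with hS2
  have hZ1p : 0 < Z1 := by positivity
  have hX1p : 0 < X1 := by positivity
  have hS1p : 0 < S1 := by positivity
  have hS2p : 0 < S2 := by positivity
  set W1 : ℝ := 2^(N+2) * S1 * Z1 + 2^(N+2) * S2 * X1 with hW1
  set vn : ℝ := ‖ν‖ with hvn
  have hvn0 : 0 ≤ vn := norm_nonneg _
  let m : ℝ := ((n+1 : ℕ) : ℝ)
  set R1 : ℝ := Z1 + X1 with hR1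
  set M1 : ℝ := vn * (Z1 + 2 * X1) with hM1
  set PR : ℝ := m * C * Z1 + m * C * X1 with hPR
  have hm0 : 0 ≤ m := by positivity
  set E1 : ℝ := 2 * PR + 2 * (m * M1 * R1) + m * R1 * R1 + 4 * (vn * vn) * (m * X1 * X1) with hE1
  refine ⟨W1 + E1, by positivity, ?_⟩
  intro D u a lam δ K hD hlam hδ hδ1 hK1 hu hdu hd2u hmaps ha
  have hlam0 := hlam.le
  set lam' := K * lam with hlam'
  have hlp : 0 < lam' := by positivity
  have hll : lam ≤ lam' := by nlinarith
  -- the fields Z and X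
  have hZ0 := hZf D lam _ hD hlam0 hmaps hdu
  have hX0 := hXf D lam _ hD hlam0 hmaps hdu
  let Z : (Fin n → ℝ) → (Fin (n+1) → ℝ) := fun x => (Real.sqrt 2 • a x) • Zf (fderiv ℝ u x)
  let X : (Fin n → ℝ) → (Fin (n+1) → ℝ) := fun x => ((1/4:ℝ) • (a x * a x)) • Xf ν (fderiv ℝ u x)
  have hZs : SC D (Z1 * δ) lam (N+2) Z := by
    have h := SC.smul hD (by positivity) hCZ.le hlam0 (SC.const_smul hD (Real.sqrt 2) ha) hZ0
    refine h.mono (by positivity) hlam0 (le_of_eq ?_) le_rfl le_rfl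
    rw [hZ1]; ring
  have hXs2 : SC D (X1 * δ^2) lam (N+2) X := by
    have h := SC.smul hD (by positivity) hCX.le hlam0 (SC.const_smul hD (1/4:ℝ) (SC.mul hD (by positivity) (by positivity) hlam0 ha ha)) hX0
    refine h.mono (by positivity) hlam0 (le_of_eq ?_) le_rfl le_rfl
    rw [hX1]; ring
  have hXs : SC D (X1 * δ) lam (N+2) X := hXs2.mono (by positivity) hlam0
    (by nlinarith [mul_pos hX1p hδ]) le_rfl le_rfl
  have hs1 : SC D S1 lam' (N+2) (fun x => Real.sin (lam' * nuL ν x)) := SC.sin_lin D hD (nuL ν) (N+2) hlp.le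
  have hs2 : SC D S2 lam' (N+2) (fun x => Real.sin (lam' * ((2:ℝ) • nuL ν) x)) :=
    SC.sin_lin D hD ((2:ℝ) • nuL ν) (N+2) hlp.le
  let w : (Fin n → ℝ) → (Fin (n+1) → ℝ) := fun x => lam'⁻¹ •
    (Real.sin (lam' * nuL ν x) • Z x - Real.sin (lam' * ((2:ℝ) • nuL ν) x) • X x)
  have hE1p : 0 ≤ E1 := by positivity
  have hws : SC D ((W1 + E1) * δ / lam') lam' (N+2) w := by
    have h1 := SC.smul hD hS1p.le (by positivity) hlp.le hs1 (hZs.mono (by positivity) hlam0 le_rfl hll le_rfl)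
    have h2 := SC.smul hD hS2p.le (by positivity) hlp.le hs2 (hXs.mono (by positivity) hlam0 le_rfl hll le_rfl)
    have h := SC.const_smul hD lam'⁻¹ (SC.sub hD h1 h2)
    refine h.mono (by positivity) hlp.le ?_ le_rfl le_rfl
    rw [abs_of_pos (by positivity), div_eq_inv_mul]
    refine mul_le_mul_of_nonneg_left ?_ (by positivity)
    calc _ = W1 * δ := by rw [hW1]; ring
      _ ≤ (W1 + E1) * δ := mul_le_mul_of_nonneg_right (le_add_of_nonneg_right hE1p) hδ.le
  refine ⟨w, hws, ?_⟩
  intro x hx i j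
  -- derivatives
  have hZd : HasFDerivAt Z (fderiv ℝ Z x) x :=
    ((hZs.1.contDiffAt (hD.mem_nhds hx)).differentiableAt (by simp)).hasFDerivAt
  have hXd : HasFDerivAt X (fderiv ℝ X x) x :=
    ((hXs.1.contDiffAt (hD.mem_nhds hx)).differentiableAt (by simp)).hasFDerivAt
  have hPd : HasFDerivAt (fderiv ℝ u) (fderiv ℝ (fderiv ℝ u) x) x :=
    ((hdu.1.contDiffAt (hD.mem_nhds hx)).differentiableAt (by simp)).hasFDerivAt
  have hLx := hK (hmaps hx)
  set θ := lam' * nuL ν x with hθ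
  have hθ2 : lam' * ((2:ℝ) • nuL ν) x = 2 * θ := by
    simp only [_root_.smul_apply, smul_eq_mul, hθ]; ring
  let R : Fin n → Fin (n+1) → ℝ := fun i => lam'⁻¹ • (Real.sin θ • fderiv ℝ Z x (Pi.single i 1) -
    Real.sin (2*θ) • fderiv ℝ X x (Pi.single i 1))
  let Mm : Fin n → Fin (n+1) → ℝ := fun i => ν i • (Real.cos θ • Z x - (2 * Real.cos (2*θ)) • X x)
  have hA : ∀ i, fderiv ℝ w x (Pi.single i 1) = Mm i + R i := by
    intro i
    have d1 : HasFDerivAt (fun x => Real.sin (lam' * nuL ν x)) (Real.cos θ • (lam' • nuL ν)) x :=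
      ((nuL ν).hasFDerivAt.const_mul lam').sin
    have d2 : HasFDerivAt (fun x => Real.sin (lam' * ((2:ℝ) • nuL ν) x)) (Real.cos (2*θ) • (lam' • ((2:ℝ) • nuL ν))) x := by
      have := ((((2:ℝ) • nuL ν)).hasFDerivAt (x := x).const_mul lam').sin
      rwa [hθ2] at this
    have d3 := ((d1.smul hZd).sub (d2.smul hXd)).const_smul lam'⁻¹
    rw [hθ2, ← hθ] at d3
    have d4 : fderiv ℝ w x = _ := d3.fderiv
    rw [d4]
    funext k
    have hl0 : lam'⁻¹ * lam' = 1 := inv_mul_cancel₀ hlp.ne'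
    have n2 : ((2:ℝ) • nuL ν) (Pi.single i 1) = 2 * ν i := by
      rw [_root_.smul_apply, nuL_single, smul_eq_mul]
    simp only [R, Mm, _root_.smul_apply, _root_.sub_apply, _root_.add_apply, Pi.smul_apply, Pi.add_apply, Pi.sub_apply,
      ContinuousLinearMap.smulRight_apply, n2, nuL_single, smul_eq_mul]
    linear_combination (Real.cos θ * ν i * Z x k - Real.cos (2*θ) * (2 * ν i) * X x k) * hl0
  have hPZ : ∀ y, ∀ i, fderiv ℝ u y (Pi.single i 1) ⬝ᵥ Z y = 0 := by
    intro y i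
    simp only [Z, dotProduct_smul, Zf_orth, smul_zero]
  have hmain := step_algebra (fun i => fderiv ℝ u x (Pi.single i 1)) (fun i => fderiv ℝ w x (Pi.single i 1)) Mm R
    (Z x) (X x) ν (a x) θ hA (fun i => rfl) (hPZ x) (fun i => by
      simp only [X, dotProduct_smul, Xf_dot ν _ hLx, smul_eq_mul]; ring)
    (by
      simp only [Z, dotProduct_smul, smul_dotProduct, Zf_unit _ hLx, smul_eq_mul]
      have := Real.mul_self_sqrt (show (0:ℝ) ≤ 2 by norm_num)
      linear_combination (a x)^2 * this)
    (by simp only [X, Z, dotProduct_smul, smul_dotProduct, Xf_Zf, smul_zero]) i j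
  rw [pb_add]
  have e : pb (fderiv ℝ u x) i j + fderiv ℝ u x (Pi.single i 1) ⬝ᵥ fderiv ℝ w x (Pi.single j 1) +
      fderiv ℝ u x (Pi.single j 1) ⬝ᵥ fderiv ℝ w x (Pi.single i 1) + pb (fderiv ℝ w x) i j - pb (fderiv ℝ u x) i j
      - a x ^2 * ν i * ν j = fderiv ℝ u x (Pi.single i 1) ⬝ᵥ fderiv ℝ w x (Pi.single j 1) +
      fderiv ℝ u x (Pi.single j 1) ⬝ᵥ fderiv ℝ w x (Pi.single i 1) +
      fderiv ℝ w x (Pi.single i 1) ⬝ᵥ fderiv ℝ w x (Pi.single j 1) - a x ^2 * ν i * ν j := by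
    rw [pb_eq_dot (fderiv ℝ w x)]; ring
  rw [e, hmain]
  -- estimates
  have bZ : ‖Z x‖ ≤ Z1 * δ := hZs.bound hx
  have bX : ‖X x‖ ≤ X1 * δ := hXs.bound hx
  have bX2 : ‖X x‖ ≤ X1 * δ^2 := hXs2.bound hx
  have bdZ : ∀ i, ‖fderiv ℝ Z x (Pi.single i 1)‖ ≤ Z1 * δ * lam := fun i =>
    (clm_single_le _ i).trans ((hZs.mono (N' := 0+1) (by positivity) hlam0 le_rfl le_rfl (by omega)).norm_fderiv hD hx)
  have bdX : ∀ i, ‖fderiv ℝ X x (Pi.single i 1)‖ ≤ X1 * δ * lam := fun i =>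
    (clm_single_le _ i).trans ((hXs.mono (N' := 0+1) (by positivity) hlam0 le_rfl le_rfl (by omega)).norm_fderiv hD hx)
  have bdX2 : ∀ i, ‖fderiv ℝ X x (Pi.single i 1)‖ ≤ X1 * δ^2 * lam := fun i =>
    (clm_single_le _ i).trans ((hXs2.mono (N' := 0+1) (by positivity) hlam0 le_rfl le_rfl (by omega)).norm_fderiv hD hx)
  have hsc : lam'⁻¹ * lam = K⁻¹ := by rw [hlam']; field_simp
  have hKi : K⁻¹ ≤ 1 := inv_le_one_of_one_le₀ hK1
  have hKi0 : 0 < K⁻¹ := by positivity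
  have bs : ∀ t, |Real.sin t| ≤ 1 := Real.abs_sin_le_one
  have bc : ∀ t, |Real.cos t| ≤ 1 := Real.abs_cos_le_one
  have bR : ∀ i, ‖R i‖ ≤ R1 * δ * K⁻¹ := by
    intro i
    simp only [R]
    rw [norm_smul, Real.norm_of_nonneg (by positivity)]
    calc lam'⁻¹ * _ ≤ lam'⁻¹ * (1 * (Z1 * δ * lam) + 1 * (X1 * δ * lam)) := by
          gcongr
          refine (norm_sub_le _ _).trans ?_
          rw [norm_smul, norm_smul]
          gcongr
          · exact bs _
          · exact bdZ i
          · exact bs _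
          · exact bdX i
      _ = (Z1 + X1) * δ * (lam'⁻¹ * lam) := by ring
      _ = _ := by rw [hsc]
  have bM : ∀ i, ‖Mm i‖ ≤ M1 * δ := by
    intro i
    simp only [Mm]
    rw [norm_smul]
    calc _ ≤ vn * (1 * (Z1 * δ) + (2 * 1) * (X1 * δ)) := by
          gcongr
          · exact norm_le_pi_norm ν i
          · refine (norm_sub_le _ _).trans ?_
            rw [norm_smul (Real.cos θ) (Z x), norm_smul (2 * Real.cos (2*θ)) (X x)]
            refine add_le_add (mul_le_mul (bc _) bZ (norm_nonneg _) (by norm_num)) (mul_le_mul ?_ bX (norm_nonneg _) (by norm_num))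
            rw [Real.norm_eq_abs, abs_mul, abs_two]
            exact mul_le_mul_of_nonneg_left (bc _) (by norm_num)
      _ = _ := by rw [hM1]; ring
  have bP : ∀ i, ‖fderiv ℝ u x (Pi.single i 1)‖ ≤ C := fun i => (clm_single_le _ i).trans (hdu.bound hx)
  have bPZ : ∀ i j, |fderiv ℝ u x (Pi.single i 1) ⬝ᵥ fderiv ℝ Z x (Pi.single j 1)| ≤ m * (C * δ * lam) * (Z1 * δ) := by
    intro i j
    have h1 : HasFDerivAt (fun y => fderiv ℝ u y (Pi.single i 1)) ((ContinuousLinearMap.apply ℝ (Fin (n+1) → ℝ) (Pi.single i 1 : Fin n → ℝ)).comp (fderiv ℝ (fderiv ℝ u) x)) x :=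
      ((ContinuousLinearMap.apply ℝ (Fin (n+1) → ℝ) (Pi.single i 1 : Fin n → ℝ)).hasFDerivAt (x := fderiv ℝ u x)).comp x hPd
    have h2 := (dotL (n+1)).hasFDerivAt_of_bilinear h1 hZd
    have h3 : (fun y => dotL (n+1) (fderiv ℝ u y (Pi.single i 1)) (Z y)) = fun _ => 0 := by
      funext y; rw [dotL_apply, hPZ]
    rw [h3] at h2
    have h4 := h2.unique (hasFDerivAt_const (0:ℝ) x)
    have h5 := congrArg (fun L => L (Pi.single j 1)) h4
    simp [dotL_apply] at h5
    have h6 : fderiv ℝ u x (Pi.single i 1) ⬝ᵥ fderiv ℝ Z x (Pi.single j 1) =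
      - ((fderiv ℝ (fderiv ℝ u) x (Pi.single j 1) (Pi.single i 1)) ⬝ᵥ Z x) := by linarith
    rw [h6, abs_neg]
    refine (abs_dot_le _ _).trans ?_
    change m * _ * _ ≤ _
    gcongr
    exact (clm_single_le _ i).trans ((clm_single_le _ j).trans (hd2u x hx))
  have bPR : ∀ i j, |fderiv ℝ u x (Pi.single i 1) ⬝ᵥ R j| ≤ PR * (δ^2 * K⁻¹) := by
    intro i j
    simp only [R]
    rw [dotProduct_smul, dotProduct_sub, dotProduct_smul, dotProduct_smul, smul_eq_mul, smul_eq_mul, smul_eq_mul, abs_mul,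
      abs_of_pos (show 0 < lam'⁻¹ by positivity)]
    have h7 : |fderiv ℝ u x (Pi.single i 1) ⬝ᵥ fderiv ℝ X x (Pi.single j 1)| ≤ m * C * (X1 * δ^2 * lam) := by
      refine (abs_dot_le _ _).trans ?_
      change m * _ * _ ≤ _
      gcongr
      · exact bP i
      · exact bdX2 j
    calc _ ≤ lam'⁻¹ * (1 * (m * (C * δ * lam) * (Z1 * δ)) + 1 * (m * C * (X1 * δ^2 * lam))) := by
          gcongr
          refine (abs_sub _ _).trans ?_
          rw [abs_mul, abs_mul]
          gcongr
          · exact bs _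
          · exact bPZ i j
          · exact bs _
      _ = (m * C * Z1 + m * C * X1) * (δ^2 * (lam'⁻¹ * lam)) := by ring
      _ = _ := by rw [hsc]
  have bMR : ∀ i j, |Mm i ⬝ᵥ R j| ≤ (m * M1 * R1) * (δ^2 * K⁻¹) := by
    intro i j
    refine (abs_dot_le _ _).trans ?_
    change m * _ * _ ≤ _
    calc _ ≤ m * (M1 * δ) * (R1 * δ * K⁻¹) := by
          gcongr
          · exact bM i
          · exact bR j
      _ = _ := by ring
  have bRR : ∀ i j, |R i ⬝ᵥ R j| ≤ (m * R1 * R1) * (δ^2 * K⁻¹) := by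
    intro i j
    refine (abs_dot_le _ _).trans ?_
    change m * _ * _ ≤ _
    calc _ ≤ m * (R1 * δ * 1) * (R1 * δ * K⁻¹) := by
          gcongr
          · refine (bR i).trans ?_
            gcongr
          · exact bR j
      _ = _ := by ring
  have bXX : |4 * Real.cos (2*θ)^2 * (ν i * ν j) * (X x ⬝ᵥ X x)| ≤ 4 * (vn * vn) * (m * X1 * X1) * δ^4 := by
    rw [abs_mul, abs_mul, abs_mul, abs_mul, abs_pow]
    calc _ ≤ |(4:ℝ)| * 1^2 * (vn * vn) * (m * (X1 * δ^2) * (X1 * δ^2)) := by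
          gcongr
          · exact bc _
          · exact norm_le_pi_norm ν i
          · exact norm_le_pi_norm ν j
          · refine (abs_dot_le _ _).trans ?_
            change m * _ * _ ≤ _
            gcongr
      _ = _ := by rw [abs_of_pos (by norm_num : (0:ℝ) < 4)]; ring
  have q1 := bPR i j
  have q2 := bPR j i
  have q3 := bMR i j
  have q4 : |R i ⬝ᵥ Mm j| ≤ (m * M1 * R1) * (δ^2 * K⁻¹) := by rw [dotProduct_comm]; exact bMR j i
  have q5 := bRR i j
  have hq : 0 ≤ δ^2 * K⁻¹ := by positivity
  have hd4 : 0 ≤ δ^4 := by positivity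
  have hW1p : 0 ≤ W1 := by positivity
  refine (abs_add_le _ _).trans ?_
  refine (add_le_add ((abs_add_le _ _).trans (add_le_add ((abs_add_le _ _).trans (add_le_add ((abs_add_le _ _).trans
    (add_le_add ((abs_add_le _ _).trans (add_le_add q1 q2)) q3)) q4)) q5)) bXX).trans ?_
  rw [div_eq_mul_inv]
  have hPR0 : 0 ≤ PR := by positivity
  have hA1 : 0 ≤ 2 * PR + 2 * (m * M1 * R1) + m * R1 * R1 := by positivity
  have hA2 : 0 ≤ 4 * (vn * vn) * (m * X1 * X1) := by positivity
  calc _ = (2 * PR + 2 * (m * M1 * R1) + m * R1 * R1) * (δ^2 * K⁻¹) + 4 * (vn * vn) * (m * X1 * X1) * δ^4 := by ring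
    _ ≤ (W1 + E1) * (δ^2 * K⁻¹) + (W1 + E1) * δ^4 := by
        refine add_le_add (mul_le_mul_of_nonneg_right ?_ hq) (mul_le_mul_of_nonneg_right ?_ hd4)
        · rw [hE1]; linarith
        · rw [hE1]; linarith
    _ = _ := by ring

end step
end CI

namespace CI
open scoped ContDiff
section multistep
variable {n : ℕ}

lemma multistep {g₀ : Matrix (Fin n) (Fin n) ℝ} {r₀ : ℝ} (hr₀ : 0 < r₀) (hK : Kc g₀ r₀ ⊆ Om n) (ν : ℕ → Fin n → ℝ)
    (C : ℝ) (hC : 0 < C) (j : ℕ) : ∀ N : ℕ, ∃ C' > 0, ∃ δs > 0, δs ≤ 1 ∧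
      ∀ (D : Set (Fin n → ℝ)) (u : (Fin n → ℝ) → (Fin (n+1) → ℝ))
      (a : ℕ → (Fin n → ℝ) → ℝ) (lam δ K : ℝ), IsOpen D → 0 < lam → 0 < δ → δ ≤ δs → 1 ≤ K → δ^2 * K ≤ 1 →
      ContDiffOn ℝ ∞ u D → SC D C lam (N+j+2) (fderiv ℝ u) →
      (∀ x ∈ D, ‖fderiv ℝ (fderiv ℝ u) x‖ ≤ C * δ * lam) →
      Set.MapsTo (fderiv ℝ u) D (Kc g₀ (r₀/2)) → (∀ k, SC D (C * δ) lam (N+j+2) (a k)) →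
      ∃ v : (Fin n → ℝ) → (Fin (n+1) → ℝ), ContDiffOn ℝ ∞ v D ∧ SC D C' (K^j * lam) (N+2) (fderiv ℝ v) ∧
        (∀ x ∈ D, ‖fderiv ℝ (fderiv ℝ v) x‖ ≤ C' * δ * (K^j * lam)) ∧
        (∀ x ∈ D, ‖v x - u x‖ ≤ C' * δ / lam) ∧
        (∀ x ∈ D, ‖fderiv ℝ v x - fderiv ℝ u x‖ ≤ C' * δ) ∧
        ∀ x ∈ D, ∀ p q, |pb (fderiv ℝ v x) p q - pb (fderiv ℝ u x) p q
            - ∑ k ∈ Finset.range j, a k x ^2 * ν k p * ν k q| ≤ C' * (δ^2 / K) := by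
  induction j with
  | zero =>
    intro N
    refine ⟨C, hC, 1, one_pos, le_rfl, ?_⟩
    intro D u a lam δ K hD hlam hδ hδ1 hK1 hδK hu hdu hd2u hm ha
    refine ⟨u, hu, by simpa using hdu, by simpa using hd2u, ?_, ?_, ?_⟩
    · intro x hx; simp; positivity
    · intro x hx; simp; positivity
    · intro x hx p q; simp; positivity
  | succ j ih =>
    intro N
    obtain ⟨C1, hC1, δ1, hδ1, hδ11, h1⟩ := ih (N+1)
    obtain ⟨C2, hC2, h2⟩ := step hK (ν j) (N+1) (C + C1) (by positivity)
    -- bound on the change of the metric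
    set S : ℝ := ∑ k ∈ Finset.range j, C^2 * (‖ν k‖ * ‖ν k‖) with hS
    have hS0 : 0 ≤ S := Finset.sum_nonneg fun k _ => by positivity
    set B : ℝ := 2 * (C1 + S) with hB
    have hBp : 0 < B := by positivity
    refine ⟨C1 + 2 * C2, by positivity, min δ1 (r₀ / B), lt_min hδ1 (by positivity), (min_le_left _ _).trans hδ11, ?_⟩
    intro D u a lam δ K hD hlam hδ hδm hK1 hδK hu hdu hd2u hm ha
    have hδδ1 : δ ≤ δ1 := hδm.trans (min_le_left _ _)
    have hδB : δ * B ≤ r₀ := by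
      have := hδm.trans (min_le_right _ _)
      rwa [le_div_iff₀ hBp] at this
    have hδle : δ ≤ 1 := hδδ1.trans hδ11
    have eN : N + (j+1) + 2 = N + 1 + j + 2 := by omega
    rw [eN] at hdu ha
    obtain ⟨v, hv, hdv, hd2v, hvu, hdvu, hpv⟩ := h1 D u a lam δ K hD hlam hδ hδδ1 hK1 hδK hu hdu hd2u hm ha
    have hKj : 1 ≤ K^j := one_le_pow₀ hK1
    set lj := K^j * lam with hlj
    have hljp : 0 < lj := by positivity
    have hllj : lam ≤ lj := by nlinarith
    have hK0 : 0 < K := by linarith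
    have hKi : δ^2/K ≤ δ^2 := div_le_self (by positivity) hK1
    have hδ2 : δ^2 ≤ δ := by nlinarith
    have hmv : Set.MapsTo (fderiv ℝ v) D (Kc g₀ r₀) := by
      intro x hx p q
      have e1 := hpv x hx p q
      have e2 := hm hx p q
      have e3 : |∑ k ∈ Finset.range j, a k x ^2 * ν k p * ν k q| ≤ S * δ^2 := by
        refine (Finset.abs_sum_le_sum_abs _ _).trans ?_
        rw [hS, Finset.sum_mul]
        refine Finset.sum_le_sum fun k _ => ?_
        rw [abs_mul, abs_mul, abs_pow]
        have b1 : |a k x| ≤ C * δ := (ha k).bound hx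
        have b2 : |ν k p| ≤ ‖ν k‖ := norm_le_pi_norm (ν k) p
        have b3 : |ν k q| ≤ ‖ν k‖ := norm_le_pi_norm (ν k) q
        calc _ ≤ (C * δ)^2 * ‖ν k‖ * ‖ν k‖ := by gcongr
          _ = _ := by ring
      have e4 : |pb (fderiv ℝ v x) p q - g₀ p q| ≤ C1 * (δ^2/K) + S * δ^2 + r₀/2 := by
        rw [abs_le] at *
        constructor <;> linarith [e1.1, e1.2, e2.1, e2.2, e3.1, e3.2]
      refine e4.trans ?_
      have : C1 * (δ^2/K) ≤ C1 * δ := mul_le_mul_of_nonneg_left (hKi.trans hδ2) hC1.le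
      have : S * δ^2 ≤ S * δ := mul_le_mul_of_nonneg_left hδ2 hS0
      rw [hB] at hδB
      linarith
    obtain ⟨w, hw, hpw⟩ := h2 D v (a j) lj δ K hD hljp hδ hδle hK1 hv
      (hdv.mono hC1.le hljp.le (by linarith) le_rfl (by omega))
      (fun x hx => (hd2v x hx).trans (by gcongr; linarith)) hmv
      ((ha j).mono (by positivity) hlam.le (by gcongr; linarith) hllj (by omega))
    have hKlj : 0 < K * lj := by positivity
    have hdw := (hw.mono (N' := (N+2)+1) (by positivity) hKlj.le le_rfl le_rfl (by omega)).fderiv hD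
    have e5 : C2 * δ / (K*lj) * (K * lj) = C2 * δ := by field_simp
    rw [e5] at hdw
    have hd2w : ∀ x ∈ D, ‖fderiv ℝ (fderiv ℝ w) x‖ ≤ C2 * δ * (K * lj) := fun x hx => hdw.norm_fderiv hD hx
    have eK : K^(j+1) * lam = K * lj := by rw [hlj]; ring
    have hvd : ∀ x ∈ D, DifferentiableAt ℝ v x := fun x hx =>
      (hv.contDiffAt (hD.mem_nhds hx)).differentiableAt (by simp)
    have hwd : ∀ x ∈ D, DifferentiableAt ℝ w x := fun x hx =>
      (hw.1.contDiffAt (hD.mem_nhds hx)).differentiableAt (by simp)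
    have hsum : ∀ x ∈ D, fderiv ℝ (fun y => v y + w y) x = fderiv ℝ v x + fderiv ℝ w x := fun x hx =>
      fderiv_fun_add (hvd x hx) (hwd x hx)
    have hljK : lj ≤ K * lj := by nlinarith
    refine ⟨fun y => v y + w y, hv.add hw.1, ?_, ?_, ?_, ?_, ?_⟩
    · rw [eK]
      have h := SC.add hD (hdv.mono (N' := N+2) hC1.le hljp.le le_rfl hljK (by omega)) hdw
      refine (h.congr (fun x hx => hsum x hx)).mono (by positivity) hKlj.le ?_ le_rfl le_rfl
      nlinarith
    · intro x hx
      rw [eK]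
      have h1 : fderiv ℝ (fderiv ℝ (fun y => v y + w y)) x = fderiv ℝ (fun y => fderiv ℝ v y + fderiv ℝ w y) x := by
        refine Filter.EventuallyEq.fderiv_eq ?_
        filter_upwards [hD.mem_nhds hx] with y hy using hsum y hy
      rw [h1, fderiv_fun_add ((hdv.1.contDiffAt (hD.mem_nhds hx)).differentiableAt (by simp))
        ((hdw.1.contDiffAt (hD.mem_nhds hx)).differentiableAt (by simp))]
      have hq1 := hd2v x hx
      have hq2 := hd2w x hx
      refine (norm_add_le (fderiv ℝ (fderiv ℝ v) x) (fderiv ℝ (fderiv ℝ w) x)).trans ?_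
      have : C1 * δ * lj ≤ C1 * δ * (K * lj) := by gcongr
      have : 0 ≤ C2 * δ * (K * lj) := by positivity
      linarith
    · intro x hx
      have e : v x + w x - u x = (v x - u x) + w x := by abel
      simp only
      rw [e]
      refine (norm_add_le _ _).trans ((add_le_add (hvu x hx) (hw.bound hx)).trans ?_)
      have : C2 * δ / (K * lj) ≤ C2 * δ / lam := by
        gcongr
        exact hllj.trans hljK
      have h0 : 0 ≤ C2 * δ / lam := by positivity
      have : (C1 + 2 * C2) * δ / lam = C1 * δ / lam + 2 * (C2 * δ/lam) := by ring
      linarith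
    · intro x hx
      rw [hsum x hx]
      have e : fderiv ℝ v x + fderiv ℝ w x - fderiv ℝ u x = (fderiv ℝ v x - fderiv ℝ u x) + fderiv ℝ w x := by abel
      rw [e]
      refine (norm_add_le _ _).trans ((add_le_add (hdvu x hx) (hdw.bound hx)).trans ?_)
      have h0 : 0 ≤ C2 * δ := by positivity
      linarith
    · intro x hx p q
      rw [hsum x hx, Finset.sum_range_succ]
      have e1 := hpv x hx p q
      have e2 := hpw x hx p q
      have e3 : δ^4 ≤ δ^2/K := by
        rw [le_div_iff₀ hK0]
        calc δ^4 * K = δ^2 * (δ^2 * K) := by ring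
          _ ≤ δ^2 * 1 := by gcongr
          _ = _ := by ring
      have e4 : C2 * (δ^2/K + δ^4) ≤ 2 * C2 * (δ^2/K) := by nlinarith
      calc _ ≤ |pb (fderiv ℝ v x) p q - pb (fderiv ℝ u x) p q - ∑ k ∈ Finset.range j, a k x ^2 * ν k p * ν k q| +
            |pb (fderiv ℝ v x + fderiv ℝ w x) p q - pb (fderiv ℝ v x) p q - a j x ^2 * ν j p * ν j q| := by
              refine le_trans (le_of_eq ?_) (abs_add_le _ _)
              congr 1; ring
        _ ≤ _ := by linarith

end multistep
end CI

namespace CI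
open scoped ContDiff
section mollest
variable {n : ℕ} {F G : Type} [NormedAddCommGroup F] [NormedSpace ℝ F] [NormedAddCommGroup G] [NormedSpace ℝ G]

lemma SC.of_local {D : Set (Fin n → ℝ)} (hD : IsOpen D) {C lam : ℝ} {N : ℕ} {f : (Fin n → ℝ) → F}
    (h : ∀ x ∈ D, ∃ D', IsOpen D' ∧ x ∈ D' ∧ SC D' C lam N f) : SC D C lam N f := by
  refine ⟨fun x hx => ?_, fun k hk x hx => ?_⟩
  · obtain ⟨D', h1, h2, h3⟩ := h x hx
    exact (h3.1.contDiffAt (h1.mem_nhds h2)).contDiffWithinAt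
  · obtain ⟨D', h1, h2, h3⟩ := h x hx
    rw [iteratedFDerivWithin_of_isOpen k hD hx, ← iteratedFDerivWithin_of_isOpen k h1 h2]
    exact h3.2 k hk x h2

def kcm (n N : ℕ) : ℝ := ∑ k ∈ Finset.range (N+1), kc n k

lemma kc_le_kcm {N k : ℕ} (h : k ≤ N) : kc n k ≤ kcm n N :=
  Finset.single_le_sum (f := fun k => kc n k) (fun i _ => kc_nonneg i) (Finset.mem_range.2 (by omega))

lemma one_le_kcm (N : ℕ) : 1 ≤ kcm n N := by
  have := kc_le_kcm (n := n) (Nat.zero_le N)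
  rwa [kc_zero] at this

lemma moll_SC [CompleteSpace F] {D D' : Set (Fin n → ℝ)} (hD : IsOpen D) (hD' : IsOpen D')
    {f : (Fin n → ℝ) → F} {B : ℝ} {l : ℝ}
    (hl : 0 < l) (hf : ContinuousOn f D) (hB : ∀ x ∈ D, ‖f x‖ ≤ B)
    (hDD : ∀ x ∈ D', Metric.closedBall x l ⊆ D) (N : ℕ) (M : ℝ) (c : F)
    (hM : ∀ x ∈ D', ∀ z ∈ Metric.closedBall x l, ‖f z - c‖ ≤ M) :
    SC D' (kcm n N * M) l⁻¹ N (fun y => moll D l f y - c) := by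
  refine ⟨((moll_smooth hD hl hf hB).sub contDiff_const).contDiffOn, fun k hk x hx => ?_⟩
  refine (moll_deriv hD hD' hl hf hB hDD k hx M c (hM x hx)).trans ?_
  have hM0 : 0 ≤ M := (norm_nonneg _).trans (hM x hx x (by simp [hl.le]))
  have := kc_le_kcm (n := n) hk
  gcongr

lemma moll_add {D : Set (Fin n → ℝ)} (hD : IsOpen D) {f g : (Fin n → ℝ) → F} {B B' : ℝ} {l : ℝ}
    (hf : ContinuousOn f D) (hB : ∀ x ∈ D, ‖f x‖ ≤ B)
    (hg : ContinuousOn g D) (hB' : ∀ x ∈ D, ‖g x‖ ≤ B') (x : Fin n → ℝ) :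
    moll D l (fun y => f y + g y) x = moll D l f x + moll D l g x := by
  unfold moll
  rw [← integral_add (moll_integrable hD l hf hB x) (moll_integrable hD l hg hB' x)]
  congr 1; funext t
  rw [← smul_add]
  congr 1
  by_cases h : x - l • t ∈ D
  · simp [Set.indicator_of_mem h]
  · simp [Set.indicator_of_notMem h]

lemma moll_clm [CompleteSpace F] [CompleteSpace G] {D : Set (Fin n → ℝ)} (hD : IsOpen D) {f : (Fin n → ℝ) → F} {B : ℝ} {l : ℝ}
    (hf : ContinuousOn f D) (hB : ∀ x ∈ D, ‖f x‖ ≤ B) (A : F →L[ℝ] G) (x : Fin n → ℝ) :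
    moll D l (fun y => A (f y)) x = A (moll D l f x) := by
  unfold moll
  rw [← A.integral_comp_comm (moll_integrable hD l hf hB x)]
  congr 1; funext t
  rw [A.map_smul]
  congr 1
  by_cases h : x - l • t ∈ D
  · simp [Set.indicator_of_mem h]
  · simp [Set.indicator_of_notMem h]

lemma moll_congr {D : Set (Fin n → ℝ)} {f g : (Fin n → ℝ) → F} {l : ℝ}
    (h : Set.EqOn f g D) (x : Fin n → ℝ) : moll D l f x = moll D l g x := by
  unfold moll
  have : D.indicator f = D.indicator g := Set.indicator_congr h
  rw [this]

lemma fderiv_lip {D : Set (Fin n → ℝ)} (hD : IsOpen D) {u : (Fin n → ℝ) → F} {μ : ℝ}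
    (hu : ContDiffOn ℝ 2 u D) (hμ : ∀ x ∈ D, ‖fderiv ℝ (fderiv ℝ u) x‖ ≤ μ) {S : Set (Fin n → ℝ)}
    (hS : Convex ℝ S) (hSD : S ⊆ D) {x y : Fin n → ℝ} (hx : x ∈ S) (hy : y ∈ S) :
    ‖fderiv ℝ u y - fderiv ℝ u x‖ ≤ μ * ‖y - x‖ := by
  have hd : ContDiffOn ℝ 1 (fderiv ℝ u) D := hu.fderiv_of_isOpen hD (by norm_num)
  refine hS.norm_image_sub_le_of_norm_hasFDerivWithin_le (f' := fun x => fderiv ℝ (fderiv ℝ u) x) (fun z hz => ?_)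
    (fun z hz => hμ z (hSD hz)) hx hy
  exact (((hd.contDiffAt (hD.mem_nhds (hSD hz))).differentiableAt (by simp)).hasFDerivAt).hasFDerivWithinAt

/-- evaluation at the basis vector -/
def evb (i : Fin n) : Hm n →L[ℝ] (Fin (n+1) → ℝ) :=
  ContinuousLinearMap.apply ℝ (Fin (n+1) → ℝ) (Pi.single i 1 : Fin n → ℝ)

lemma evb_apply (i : Fin n) (L : Hm n) : evb i L = L (Pi.single i 1) := rfl

lemma evb_norm (i : Fin n) : ‖(evb i : Hm n →L[ℝ] _)‖ ≤ 1 :=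
  ContinuousLinearMap.opNorm_le_bound _ zero_le_one fun L => by
    rw [one_mul]; exact clm_single_le L i

lemma pb_dotL (L : Hm n) (i j : Fin n) : pb L i j = dotL (n+1) (evb i L) (evb j L) := by
  rw [dotL_apply]; rfl

lemma pb_abs_le (L : Hm n) (i j : Fin n) : |pb L i j| ≤ (n+1) * ‖L‖^2 := by
  rw [pb_eq_dot]
  refine (abs_dot_le _ _).trans ?_
  have h1 := clm_single_le L i
  have h2 := clm_single_le L j
  push_cast
  calc _ ≤ ((n:ℝ)+1) * ‖L‖ * ‖L‖ := by gcongr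
    _ = _ := by ring

lemma SC.pb {D : Set (Fin n → ℝ)} (hD : IsOpen D) {C lam : ℝ} {N : ℕ} {f : (Fin n → ℝ) → Hm n} (hC : 0 ≤ C)
    (hl : 0 ≤ lam) (h : SC D C lam N f) (i j : Fin n) :
    SC D (‖dotL (n+1)‖ * 2^N * C * C) lam N (fun x => CI.pb (f x) i j) := by
  have h1 : ∀ i, SC D C lam N (fun x => evb i (f x)) := fun i =>
    (SC.clm hD (evb i) h).mono (by positivity) hl (by nlinarith [evb_norm (n := n) i, norm_nonneg (evb (n := n) i)]) le_rfl le_rfl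
  have := SC.bilin hD (dotL (n+1)) hC hl (h1 i) (h1 j)
  exact this.congr fun x _ => pb_dotL _ _ _

end mollest

section hsc
variable {n : ℕ}

/-- data of the mollification of a map -/
structure MD (D D' : Set (Fin n → ℝ)) (u : (Fin n → ℝ) → (Fin (n+1) → ℝ)) (μ B l : ℝ) : Prop where
  hD : IsOpen D
  hD' : IsOpen D'
  hl : 0 < l
  hDD : ∀ x ∈ D', Metric.closedBall x l ⊆ D
  hu : ContDiffOn ℝ 2 u D
  hu0 : ∃ B0, ∀ x ∈ D, ‖u x‖ ≤ B0
  hu1 : ∀ x ∈ D, ‖fderiv ℝ u x‖ ≤ B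
  hu2 : ∀ x ∈ D, ‖fderiv ℝ (fderiv ℝ u) x‖ ≤ μ

variable {D D' : Set (Fin n → ℝ)} {u : (Fin n → ℝ) → (Fin (n+1) → ℝ)} {μ B l : ℝ}

lemma MD.cont1 (h : MD D D' u μ B l) : ContinuousOn (fderiv ℝ u) D :=
  h.hu.continuousOn_fderiv_of_isOpen h.hD (by norm_num)

lemma MD.smooth (h : MD D D' u μ B l) : ContDiff ℝ ∞ (moll D l u) := by
  obtain ⟨B0, hB0⟩ := h.hu0
  exact moll_smooth h.hD h.hl h.hu.continuousOn hB0

lemma MD.fd (h : MD D D' u μ B l) {x : Fin n → ℝ} (hx : x ∈ D') :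
    fderiv ℝ (moll D l u) x = moll D l (fderiv ℝ u) x := by
  obtain ⟨B0, hB0⟩ := h.hu0
  exact (moll_fderiv h.hD h.hD' h.hl (h.hu.of_le (by norm_num)) (B := max B0 B) (fun y hy => (hB0 y hy).trans (le_max_left _ _))
    (fun y hy => (h.hu1 y hy).trans (le_max_right _ _)) h.hDD hx).fderiv

lemma MD.local (h : MD D D' u μ B l) {x₀ : Fin n → ℝ} (hx₀ : x₀ ∈ D') {x z : Fin n → ℝ} (hx : x ∈ D')
    (hxx : x ∈ Metric.ball x₀ l) (hz : z ∈ Metric.closedBall x l) :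
    ‖fderiv ℝ u z - fderiv ℝ u x₀‖ ≤ 2 * (μ * l) := by
  have hl := h.hl
  have hm : 0 ≤ μ := (norm_nonneg (fderiv ℝ (fderiv ℝ u) x₀)).trans (h.hu2 x₀ (h.hDD x₀ hx₀ (by simp [hl.le])))
  have h1 := fderiv_lip h.hD h.hu h.hu2 (convex_closedBall x l) (h.hDD x hx) (x := x) (y := z) (by simp [hl.le]) hz
  have h2 := fderiv_lip h.hD h.hu h.hu2 (convex_closedBall x₀ l) (h.hDD x₀ hx₀) (x := x₀) (y := x) (by simp [hl.le])
    (Metric.ball_subset_closedBall hxx)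
  rw [mem_closedBall_iff_norm] at hz
  rw [mem_ball_iff_norm] at hxx
  have e : fderiv ℝ u z - fderiv ℝ u x₀ = (fderiv ℝ u z - fderiv ℝ u x) + (fderiv ℝ u x - fderiv ℝ u x₀) := by abel
  rw [e]
  refine (norm_add_le _ _).trans ?_
  have := mul_le_mul_of_nonneg_left hz hm
  have := mul_le_mul_of_nonneg_left hxx.le hm
  linarith

lemma MD.locSC (h : MD D D' u μ B l) (N : ℕ) {x₀ : Fin n → ℝ} (hx₀ : x₀ ∈ D') :
    SC (D' ∩ Metric.ball x₀ l) (kcm n N * (2 * (μ * l))) l⁻¹ N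
      (fun y => fderiv ℝ (moll D l u) y - fderiv ℝ u x₀) := by
  have := moll_SC h.hD (h.hD'.inter Metric.isOpen_ball) h.hl h.cont1 h.hu1 (fun x hx => h.hDD x hx.1) N (2 * (μ * l))
    (fderiv ℝ u x₀) (fun x hx z hz => h.local hx₀ hx.1 hx.2 hz)
  exact this.congr fun x hx => by simp only [h.fd hx.1]

lemma MD.SC1 (h : MD D D' u μ B l) (N : ℕ) :
    SC D' (kcm n N * (2 * (μ * l)) + B) l⁻¹ N (fderiv ℝ (moll D l u)) := by
  refine SC.of_local h.hD' fun x₀ hx₀ => ⟨D' ∩ Metric.ball x₀ l, h.hD'.inter Metric.isOpen_ball,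
    ⟨hx₀, Metric.mem_ball_self h.hl⟩, ?_⟩
  have hl := h.hl
  have hb := h.hu1 x₀ (h.hDD x₀ hx₀ (by simp [hl.le]))
  have h2 := SC.add (h.hD'.inter Metric.isOpen_ball) (h.locSC N hx₀)
    (SC.const (D := D' ∩ Metric.ball x₀ l) (lam := l⁻¹) (N := N) ((norm_nonneg _).trans hb) (by positivity) (fderiv ℝ u x₀) hb)
  exact h2.congr fun x _ => by simp

lemma MD.d2 (h : MD D D' u μ B l) {x : Fin n → ℝ} (hx : x ∈ D') :
    ‖fderiv ℝ (fderiv ℝ (moll D l u)) x‖ ≤ kcm n 1 * 2 * μ := by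
  have hl := h.hl
  have h1 := (h.locSC 1 hx).norm_fderiv (N := 0) (h.hD'.inter Metric.isOpen_ball) (x := x) ⟨hx, Metric.mem_ball_self h.hl⟩
  rw [fderiv_sub_const] at h1
  refine h1.trans (le_of_eq ?_)
  field_simp

lemma MD.c0 (h : MD D D' u μ B l) {x : Fin n → ℝ} (hx : x ∈ D') : ‖moll D l u x - u x‖ ≤ B * l := by
  obtain ⟨B0, hB0⟩ := h.hu0
  have hl := h.hl
  have hb := h.hu1 x (h.hDD x hx (by simp [hl.le]))
  have hB : 0 ≤ B := (norm_nonneg _).trans hb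
  refine moll_close h.hD hl h.hu.continuousOn hB0 (h.hDD x hx) _ _ fun z hz => ?_
  have : ‖u z - u x‖ ≤ B * ‖z - x‖ :=
    (convex_closedBall x l).norm_image_sub_le_of_norm_hasFDerivWithin_le (f' := fun x => fderiv ℝ u x) (fun y hy =>
      ((h.hu.contDiffAt (h.hD.mem_nhds (h.hDD x hx hy))).differentiableAt (by simp)).hasFDerivAt.hasFDerivWithinAt)
      (fun y hy => h.hu1 y (h.hDD x hx hy)) (by simp [hl.le]) hz
  rw [mem_closedBall_iff_norm] at hz
  exact this.trans (mul_le_mul_of_nonneg_left hz hB)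

lemma MD.c1 (h : MD D D' u μ B l) {x : Fin n → ℝ} (hx : x ∈ D') :
    ‖fderiv ℝ (moll D l u) x - fderiv ℝ u x‖ ≤ 2 * (μ * l) := by
  rw [h.fd hx]
  exact moll_close h.hD h.hl h.cont1 h.hu1 (h.hDD x hx) _ _ fun z hz =>
    h.local hx hx (Metric.mem_ball_self h.hl) hz

/-- the commutator-type estimate -/
lemma MD.hSC (h : MD D D' u μ B l) (N : ℕ) (i j : Fin n) {γ : (Fin n → ℝ) → ℝ} {s ε : ℝ}
    (hγ : ContinuousOn γ D)
    (hε : ∀ x ∈ D, |γ x - s - pb (fderiv ℝ u x) i j| ≤ ε) :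
    SC D' (kcm n N * (ε + (n+1) * (2 * (μ * l))^2) + ‖dotL (n+1)‖ * 2^N * (kcm n N * (2 * (μ * l))) * (kcm n N * (2 * (μ * l))))
      l⁻¹ N (fun x => moll D l γ x - s - pb (fderiv ℝ (moll D l u) x) i j) := by
  refine SC.of_local h.hD' fun x₀ hx₀ => ⟨D' ∩ Metric.ball x₀ l, h.hD'.inter Metric.isOpen_ball,
    ⟨hx₀, Metric.mem_ball_self h.hl⟩, ?_⟩
  have hl := h.hl
  have hO := h.hD'.inter (Metric.isOpen_ball (x := x₀) (ε := l))
  set c := fderiv ℝ u x₀ with hc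
  have hm : 0 ≤ μ := (norm_nonneg (fderiv ℝ (fderiv ℝ u) x₀)).trans (h.hu2 x₀ (h.hDD x₀ hx₀ (by simp [hl.le])))
  have hkp : 0 ≤ kcm n N := zero_le_one.trans (one_le_kcm N)
  have hq := SC.pb hO (by positivity) (by positivity) (h.locSC N hx₀) i j
  -- the function to be mollified
  let ψ : (Fin n → ℝ) → ℝ := fun y => (γ y - s - pb (fderiv ℝ u y) i j) + pb (fderiv ℝ u y - c) i j
  let A : Hm n →L[ℝ] ℝ := (dotL (n+1) (evb i c)).comp (evb j) + (dotL (n+1) (evb j c)).comp (evb i)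
  have hpbc : ∀ i j, ContinuousOn (fun y => pb (fderiv ℝ u y) i j) D := fun i j =>
    (pb_smooth i j).continuous.comp_continuousOn h.cont1
  have hψc : ContinuousOn ψ D :=
    ((hγ.sub continuousOn_const).sub (hpbc i j)).add
      ((pb_smooth i j).continuous.comp_continuousOn (h.cont1.sub continuousOn_const))
  have hψb : ∀ x ∈ D, ‖ψ x‖ ≤ ε + (n+1) * (B + ‖c‖)^2 := by
    intro x hx
    refine (norm_add_le _ _).trans (add_le_add (hε x hx) ((pb_abs_le _ _ _).trans ?_))
    have := h.hu1 x hx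
    gcongr
    exact (norm_sub_le _ _).trans (by gcongr)
  have hψl : ∀ x ∈ D' ∩ Metric.ball x₀ l, ∀ z ∈ Metric.closedBall x l, ‖ψ z - 0‖ ≤ ε + (n+1) * (2 * (μ * l))^2 := by
    intro x hx z hz
    rw [sub_zero]
    refine (norm_add_le _ _).trans (add_le_add (hε z (h.hDD x hx.1 hz)) ((pb_abs_le _ _ _).trans ?_))
    have := h.local hx₀ hx.1 hx.2 hz
    gcongr
  have hmψ := moll_SC h.hD hO hl hψc hψb (fun x hx => h.hDD x hx.1) N _ 0 hψl
  refine (SC.sub hO hmψ hq).congr fun x hx => ?_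
  -- algebra
  have hid : ∀ L : Hm n, pb L i j = pb (L - c) i j + A L - pb c i j := by
    intro L
    have := pb_add (L - c) c i j
    rw [sub_add_cancel] at this
    rw [this]
    simp only [A, _root_.add_apply, ContinuousLinearMap.comp_apply, dotL_apply, evb_apply, _root_.sub_apply,
      sub_dotProduct]
    rw [pb_eq_dot c, dotProduct_comm (L (Pi.single i 1)), dotProduct_comm (L (Pi.single j 1))]
    rw [dotProduct_comm (c (Pi.single j 1)) (c (Pi.single i 1))]
    ring
  have hg : Set.EqOn γ (fun y => (ψ y + A (fderiv ℝ u y)) - (pb c i j - s)) D := by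
    intro y hy
    simp only [ψ]
    rw [hid (fderiv ℝ u y)]; ring
  have hAc : ContinuousOn (fun y => A (fderiv ℝ u y)) D := A.continuous.comp_continuousOn h.cont1
  have hAb : ∀ y ∈ D, ‖A (fderiv ℝ u y)‖ ≤ ‖A‖ * B := fun y hy =>
    (A.le_opNorm _).trans (mul_le_mul_of_nonneg_left (h.hu1 y hy) (norm_nonneg _))
  have hsum : moll D l γ x = moll D l ψ x + A (moll D l (fderiv ℝ u) x) - (pb c i j - s) := by
    rw [moll_congr hg, moll_sub_const h.hD hl (f := fun y => ψ y + A (fderiv ℝ u y)) (hψc.add hAc) (fun y hy => (norm_add_le _ _).trans (add_le_add (hψb y hy) (hAb y hy)))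
      (h.hDD x hx.1), moll_add h.hD hψc hψb hAc hAb, moll_clm h.hD h.cont1 h.hu1]
  simp only
  rw [hsum, hid (fderiv ℝ (moll D l u) x), h.fd hx.1]
  ring

end hsc
end CI

namespace CI
open scoped ContDiff
section stage
variable {n : ℕ}

set_option maxHeartbeats 2000000 in
lemma stage {g₀ : Matrix (Fin n) (Fin n) ℝ} (hg : g₀.PosDef) :
    ∃ m : ℕ, 2 * m = n * (n+1) ∧ ∃ C₁ ≥ (1:ℝ), ∃ σ > (0:ℝ), ∃ c₀ > (0:ℝ), ∃ δ₁ > (0:ℝ), ∃ r₁ > (0:ℝ),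
    c₀ ≤ 1 ∧ δ₁ ≤ 1 ∧
    ∀ (K : ℝ) (D D' : Set (Fin n → ℝ)) (u : (Fin n → ℝ) → (Fin (n+1) → ℝ)) (g : (Fin n → ℝ) → Matrix (Fin n) (Fin n) ℝ)
      (δ δ' μ : ℝ), 1 ≤ K → IsOpen D → IsOpen D' → 0 < δ → δ ≤ δ₁ → δ^2 * K ≤ 1 → δ'^2 ≤ δ^2/2 → 0 < μ →
      (∀ x ∈ D', Metric.closedBall x (c₀ * δ / μ) ⊆ D) → ContDiffOn ℝ 2 u D → (∃ B0, ∀ x ∈ D, ‖u x‖ ≤ B0) →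
      (∀ x ∈ D, ‖fderiv ℝ (fderiv ℝ u) x‖ ≤ μ) →
      (∀ i j, ContinuousOn (fun x => g x i j) D) → (∀ x i j, g x i j = g x j i) →
      (∀ x ∈ D, ∀ i j, |g x i j - g₀ i j| ≤ r₁) →
      (∀ x ∈ D', ∀ z ∈ Metric.closedBall x (c₀ * δ / μ), ∀ i j, |g z i j - g x i j| ≤ δ^2/K) →
      (∀ x ∈ D, ∀ i j, |g x i j - δ^2 * g₀ i j - pb (fderiv ℝ u x) i j| ≤ σ * δ^2) →
      ∃ v : (Fin n → ℝ) → (Fin (n+1) → ℝ), ContDiffOn ℝ ∞ v D' ∧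
        (∀ x ∈ D', ‖v x - u x‖ ≤ C₁ * δ / μ) ∧
        (∀ x ∈ D', ‖fderiv ℝ v x - fderiv ℝ u x‖ ≤ C₁ * δ) ∧
        (∀ x ∈ D', ‖fderiv ℝ (fderiv ℝ v) x‖ ≤ C₁ * K^m * μ) ∧
        (∀ x ∈ D', ∀ i j, |g x i j - δ'^2 * g₀ i j - pb (fderiv ℝ v x) i j| ≤ C₁ * (δ^2 / K)) := by
  obtain ⟨r₀, hr₀, hKc⟩ := exists_r0 hg
  obtain ⟨m, ν, l, hm, hdec, hpos⟩ := decomp hg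
  obtain ⟨B', hB'⟩ := Kc_bound g₀ r₀
  set B := max B' 1 with hBdef
  have hB1 : 1 ≤ B := le_max_right _ _
  -- constants
  set k := kcm n (0+m+2) with hk
  have hk1 : 1 ≤ k := one_le_kcm _
  obtain ⟨G0, hG0p, hG0⟩ : ∃ G0 > (0:ℝ), ∀ i j, |g₀ i j| ≤ G0 := by
    refine ⟨∑ i, ∑ j, |g₀ i j| + 1, by positivity, fun i j => ?_⟩
    have h1 : |g₀ i j| ≤ ∑ j, |g₀ i j| := Finset.single_le_sum (f := fun j => |g₀ i j|) (fun _ _ => abs_nonneg _) (Finset.mem_univ j)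
    have h2 : ∑ j, |g₀ i j| ≤ ∑ i, ∑ j, |g₀ i j| := Finset.single_le_sum (f := fun i => ∑ j, |g₀ i j|)
      (fun _ _ => Finset.sum_nonneg fun _ _ => abs_nonneg _) (Finset.mem_univ i)
    linarith
  obtain ⟨τ, hτp, hτ⟩ : ∃ τ > (0:ℝ), ∀ k, 4 * τ ≤ ∑ a, ∑ b, l k a b * g₀ a b := by
    rcases isEmpty_or_nonempty (Fin m) with he | he
    · exact ⟨1, one_pos, fun k => he.elim k⟩
    · obtain ⟨k0, hk0⟩ := Finite.exists_min (fun k => ∑ a, ∑ b, l k a b * g₀ a b)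
      exact ⟨(∑ a, ∑ b, l k0 a b * g₀ a b)/4, by linarith [hpos k0], fun k => by linarith [hk0 k]⟩
  obtain ⟨Λ, hΛp, hΛ⟩ : ∃ Λ > (0:ℝ), ∀ k, ∑ a, ∑ b, |l k a b| ≤ Λ := by
    refine ⟨∑ k, ∑ a, ∑ b, |l k a b| + 1, by positivity, fun k => ?_⟩
    have : ∑ a, ∑ b, |l k a b| ≤ ∑ k, ∑ a, ∑ b, |l k a b| := Finset.single_le_sum (f := fun k => ∑ a, ∑ b, |l k a b|)
      (fun _ _ => Finset.sum_nonneg fun _ _ => Finset.sum_nonneg fun _ _ => abs_nonneg _) (Finset.mem_univ k)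
    linarith
  set e0 := τ / Λ with he0
  have he0p : 0 < e0 := by positivity
  set a0 : ℝ := ‖dotL (n+1)‖ * 2^(0+m+2) * k * k * 4 + 4 * k * (n+1) with ha0
  have ha0p : 0 < a0 := by positivity
  set σ := e0 / (2 * k) with hσ
  have hσp : 0 < σ := by positivity
  have hkσ : k * σ = e0/2 := by rw [hσ]; field_simp
  have hσe : σ ≤ e0 := by
    have hk2 : 1 ≤ 2 * k := by linarith
    exact div_le_self (by positivity) hk2
  set c₀ := min 1 (e0 / (2 * a0)) with hc₀
  have hc₀p : 0 < c₀ := lt_min one_pos (by positivity)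
  have hc₀1 : c₀ ≤ 1 := min_le_left _ _
  have hac : a0 * c₀^2 ≤ e0/2 := by
    have h1 : c₀ ≤ e0 / (2*a0) := min_le_right _ _
    have h2 : c₀ * (2 * a0) ≤ e0 := by rwa [le_div_iff₀ (by positivity)] at h1
    have h3 : c₀^2 ≤ c₀ := pow_le_of_le_one hc₀p.le hc₀1 two_ne_zero
    have h4 : a0 * c₀^2 ≤ a0 * c₀ := by gcongr
    linarith
  set T := Λ * (e0 + G0) with hT
  have hTp : 0 < T := by positivity
  obtain ⟨Ca, hCa, hsq⟩ := SC.comp_compact (E := Fin n → ℝ) (isOpen_Ioi (a := (0:ℝ))) (φ := Real.sqrt) (fun x hx =>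
    (Real.contDiffAt_sqrt (ne_of_gt hx)).contDiffWithinAt) (isCompact_Icc (a := τ) (b := T)) (fun x hx => lt_of_lt_of_le hτp hx.1) (0+m+2) T
  set Cc := 2 * k + B + Ca + 2 * kcm n 1 with hCc
  have hk11 : 1 ≤ kcm n 1 := one_le_kcm _
  have hCcp : 0 < Cc := by positivity
  let ν' : ℕ → Fin n → ℝ := fun q => if h : q < m then ν ⟨q, h⟩ else 0
  obtain ⟨C', hC', δs, hδs, hδs1, hms⟩ := multistep hr₀ hKc ν' Cc hCcp m 0
  refine ⟨m, hm, C' + B + 2 + C'/c₀, ?_, σ, hσp, c₀, hc₀p, min δs (r₀/(4*(G0+e0))), lt_min hδs (by positivity), r₀/4, by positivity,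
    hc₀1, (min_le_left _ _).trans hδs1, ?_⟩
  · have : 0 ≤ C'/c₀ := by positivity
    linarith
  intro K D D' u g δ δ' μ hK1 hD hD' hδ hδδ hδK hδ' hμ hDD hu hu0 hu2 hgc hgs hgr hgo hmet
  have hδδs : δ ≤ δs := hδδ.trans (min_le_left _ _)
  have hδ1 : δ ≤ 1 := hδδs.trans hδs1
  have hδ2 : δ^2 ≤ δ := pow_le_of_le_one hδ.le hδ1 two_ne_zero
  have hδr : δ^2 * (G0 + e0) ≤ r₀/4 := by
    have h1 := hδδ.trans (min_le_right _ _)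
    rw [le_div_iff₀ (by positivity)] at h1
    have : δ^2 * (G0+e0) ≤ δ * (G0+e0) := by gcongr
    linarith
  have hδ2p : 0 < δ^2 := by positivity
  have hG : ∀ i j, |δ^2 * g₀ i j| ≤ δ^2 * G0 := fun i j => by
    rw [abs_mul, abs_of_pos hδ2p]; exact mul_le_mul_of_nonneg_left (hG0 i j) hδ2p.le
  set L := c₀ * δ / μ with hL
  have hLp : 0 < L := by positivity
  have hμL : μ * L = c₀ * δ := by rw [hL]; field_simp
  have hmapu : ∀ x ∈ D, fderiv ℝ u x ∈ Kc g₀ r₀ := by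
    intro x hx i j
    have h1 := abs_le.1 (hmet x hx i j)
    have h2 := abs_le.1 (hgr x hx i j)
    have h3 := abs_le.1 (hG i j)
    have h4 : σ * δ^2 ≤ e0 * δ^2 := by gcongr
    rw [abs_le]
    constructor <;> linarith [h1.1, h1.2, h2.1, h2.2, h3.1, h3.2]
  have MDu : MD D D' u μ B L := ⟨hD, hD', hLp, hDD, hu, hu0, fun x hx => (hB' _ (hmapu x hx)).trans (le_max_left _ _), hu2⟩
  -- the error tensor
  let hh : Fin n → Fin n → (Fin n → ℝ) → ℝ := fun i j x =>
    moll D L (fun y => g y i j) x - δ^2 * g₀ i j - pb (fderiv ℝ (moll D L u) x) i j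
  have hhSC : ∀ i j, SC D' (δ^2 * e0) L⁻¹ (0+m+2) (hh i j) := by
    intro i j
    have h1 := MDu.hSC (0+m+2) i j (hgc i j) (fun x hx => hmet x hx i j)
    refine h1.mono (by positivity) (by positivity) ?_ le_rfl le_rfl
    rw [hμL]
    calc _ = δ^2 * (k * σ + a0 * c₀^2) := by rw [ha0, ← hk]; ring
      _ ≤ δ^2 * e0 := by gcongr; linarith
  set s := 1 - δ'^2/δ^2 with hs
  have hsr : δ'^2/δ^2 ≤ 1/2 := by rw [div_le_iff₀ hδ2p]; linarith
  have hs0 : 0 ≤ δ'^2/δ^2 := by positivity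
  let H : Fin n → Fin n → (Fin n → ℝ) → ℝ := fun i j x => (δ^2)⁻¹ • hh i j x + s * g₀ i j
  have HSC : ∀ i j, SC D' (e0 + G0) L⁻¹ (0+m+2) (H i j) := by
    intro i j
    have h1 := SC.const_smul hD' (δ^2)⁻¹ (hhSC i j)
    have h2 := SC.const (D := D') (C := G0) (lam := L⁻¹) (N := 0+m+2) hG0p.le (by positivity) (s * g₀ i j) (by
      rw [Real.norm_eq_abs, abs_mul]
      have : |s| ≤ 1 := by rw [abs_le]; constructor <;> linarith
      calc |s| * |g₀ i j| ≤ 1 * G0 := by gcongr; exact hG0 i j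
        _ = _ := one_mul _)
    refine (SC.add hD' h1 h2).mono (by positivity) (by positivity) (le_of_eq ?_) le_rfl le_rfl
    rw [abs_of_pos (by positivity)]
    field_simp
  let t : Fin m → (Fin n → ℝ) → ℝ := fun q x => ∑ a, ∑ b, l q a b • H a b x
  have htSC : ∀ q, SC D' T L⁻¹ (0+m+2) (t q) := by
    intro q
    have h1 := SC.sum hD' (Finset.univ : Finset (Fin n)) (lam := L⁻¹) (by positivity) (fun a _ =>
      SC.sum hD' (Finset.univ : Finset (Fin n)) (lam := L⁻¹) (by positivity) (fun b _ => SC.const_smul hD' (l q a b) (HSC a b)))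
    refine h1.mono (Finset.sum_nonneg fun _ _ => Finset.sum_nonneg fun _ _ => by positivity) (by positivity) ?_ le_rfl le_rfl
    calc _ = (∑ a, ∑ b, |l q a b|) * (e0 + G0) := by simp only [Finset.sum_mul]
      _ ≤ _ := by rw [hT]; gcongr; exact hΛ q
  have htlow : ∀ q, ∀ x ∈ D', τ ≤ t q x := by
    intro q x hx
    have h1 : t q x = (δ^2)⁻¹ * (∑ a, ∑ b, l q a b * hh a b x) + s * ∑ a, ∑ b, l q a b * g₀ a b := by
      simp only [t, H, smul_eq_mul, Finset.mul_sum, ← Finset.sum_add_distrib]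
      refine Finset.sum_congr rfl fun a _ => Finset.sum_congr rfl fun b _ => by ring
    have h2 : |∑ a, ∑ b, l q a b * hh a b x| ≤ Λ * (δ^2 * e0) := by
      calc _ ≤ ∑ a, ∑ b, |l q a b| * (δ^2 * e0) := by
            refine (Finset.abs_sum_le_sum_abs _ _).trans (Finset.sum_le_sum fun a _ => ?_)
            refine (Finset.abs_sum_le_sum_abs _ _).trans (Finset.sum_le_sum fun b _ => ?_)
            rw [abs_mul]
            exact mul_le_mul_of_nonneg_left ((hhSC a b).bound hx) (abs_nonneg _)
        _ = (∑ a, ∑ b, |l q a b|) * (δ^2 * e0) := by simp only [Finset.sum_mul]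
        _ ≤ _ := by gcongr; exact hΛ q
    have h3 : |(δ^2)⁻¹ * (∑ a, ∑ b, l q a b * hh a b x)| ≤ τ := by
      rw [abs_mul, abs_of_pos (by positivity)]
      calc _ ≤ (δ^2)⁻¹ * (Λ * (δ^2 * e0)) := by gcongr
        _ = τ := by rw [he0]; field_simp
    have h4 : 2 * τ ≤ s * ∑ a, ∑ b, l q a b * g₀ a b := by
      have := hτ q
      nlinarith
    rw [h1]
    linarith [(abs_le.1 h3).1]
  have htmap : ∀ q, Set.MapsTo (t q) D' (Set.Icc τ T) := fun q x hx =>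
    ⟨htlow q x hx, (le_abs_self _).trans ((htSC q).bound hx)⟩
  let a : ℕ → (Fin n → ℝ) → ℝ := fun q => if h : q < m then (fun x => δ • Real.sqrt (t ⟨q, h⟩ x)) else fun _ => 0
  have haSC : ∀ q, SC D' (Cc * δ) L⁻¹ (0+m+2) (a q) := by
    intro q
    simp only [a]
    split_ifs with h
    · have h1 := SC.const_smul hD' δ (hsq D' L⁻¹ _ hD' (by positivity) (htmap ⟨q, h⟩) (htSC ⟨q, h⟩))
      refine h1.mono (by positivity) (by positivity) ?_ le_rfl le_rfl
      rw [abs_of_pos hδ, mul_comm]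
      gcongr
      rw [hCc]; linarith
    · exact SC.const (by positivity) (by positivity) 0 (by simp; positivity)
  have hsum : ∀ x ∈ D', ∀ i j, ∑ q ∈ Finset.range m, a q x ^2 * ν' q i * ν' q j = δ^2 * H i j x := by
    intro x hx i j
    rw [Finset.sum_range]
    have hsym : ∀ i j, H i j x = H j i x := by
      intro i j
      simp only [H, hh]
      have e1 : (fun y => g y i j) = fun y => g y j i := by funext y; exact hgs y i j
      have e2 : g₀ i j = g₀ j i := by
        have := hg.isHermitian.apply j i
        simpa using this
      rw [e1, e2, pb_symm]
    have hd := hdec (fun i j => H i j x) hsym i j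
    rw [hd, Finset.mul_sum]
    refine Finset.sum_congr rfl fun q _ => ?_
    simp only [a, ν', Fin.is_lt, dite_true, Fin.eta, smul_eq_mul]
    rw [mul_pow, Real.sq_sqrt (hτp.le.trans (htlow q x hx))]
    simp only [t, smul_eq_mul]
    ring
  have hGr : ∀ x ∈ D', ∀ i j, |moll D L (fun y => g y i j) x - g₀ i j| ≤ r₀/4 := by
    intro x hx i j
    refine moll_close hD hLp (hgc i j) (B := |g₀ i j| + r₀/4) (fun y hy => ?_) (hDD x hx) _ _ fun z hz => hgr z (hDD x hx hz) i j
    have h1 := hgr y hy i j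
    have e : g y i j = g₀ i j + (g y i j - g₀ i j) := by ring
    rw [e]
    exact (norm_add_le _ _).trans (add_le_add le_rfl h1)
  have hmapl : Set.MapsTo (fderiv ℝ (moll D L u)) D' (Kc g₀ (r₀/2)) := by
    intro x hx i j
    have h1 : |hh i j x| ≤ δ^2 * e0 := (hhSC i j).bound hx
    simp only [hh] at h1
    have h1 := abs_le.1 h1
    have h2 := abs_le.1 (hGr x hx i j)
    have h3 := abs_le.1 (hG i j)
    rw [abs_le]
    constructor <;> linarith [h1.1, h1.2, h2.1, h2.2, h3.1, h3.2]
  have hLi : L⁻¹ = μ / (c₀ * δ) := by rw [hL, inv_div]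
  obtain ⟨v, hv, -, hd2v, hvu, hdvu, hpv⟩ := hms D' (moll D L u) a L⁻¹ δ K hD' (by positivity) hδ hδδs hK1 hδK MDu.smooth.contDiffOn
    ((MDu.SC1 (0+m+2)).mono (by rw [hμL]; positivity) (by positivity) (by
      rw [hμL, ← hk]
      have : k * (2 * (c₀ * δ)) ≤ k * (2 * (1 * 1)) := by gcongr
      rw [hCc]; linarith) le_rfl le_rfl)
    (fun x hx => (MDu.d2 hx).trans (by
      have h1 : Cc * δ * L⁻¹ = Cc * (μ / c₀) := by rw [hLi]; field_simp
      rw [h1]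
      have h2 : μ ≤ μ / c₀ := by rw [le_div_iff₀ hc₀p]; exact mul_le_of_le_one_right hμ.le hc₀1
      calc kcm n 1 * 2 * μ ≤ Cc * μ := by gcongr; rw [hCc]; linarith
        _ ≤ _ := by gcongr))
    hmapl haSC
  refine ⟨v, hv, ?_, ?_, ?_, ?_⟩
  · intro x hx
    have h1 := hvu x hx
    have h2 := MDu.c0 hx
    have e : v x - u x = (v x - moll D L u x) + (moll D L u x - u x) := by abel
    rw [e]
    refine (norm_add_le _ _).trans ((add_le_add h1 h2).trans ?_)
    have h3 : L ≤ δ/μ := by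
      rw [hL]; gcongr; exact mul_le_of_le_one_left hδ.le hc₀1
    calc C' * δ / L⁻¹ + B * L = (C' * δ + B) * L := by rw [div_inv_eq_mul]; ring
      _ ≤ (C' * 1 + B) * (δ/μ) := by gcongr
      _ ≤ (C' + B + 2 + C'/c₀) * (δ / μ) := by
        have : 0 ≤ C'/c₀ := by positivity
        refine mul_le_mul_of_nonneg_right ?_ (by positivity)
        linarith
      _ = _ := by ring
  · intro x hx
    have h1 := hdvu x hx
    have h2 := MDu.c1 hx
    have e : fderiv ℝ v x - fderiv ℝ u x = (fderiv ℝ v x - fderiv ℝ (moll D L u) x) + (fderiv ℝ (moll D L u) x - fderiv ℝ u x) := by abel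
    rw [e]
    refine (norm_add_le _ _).trans ((add_le_add h1 h2).trans ?_)
    rw [hμL]
    have h3 : c₀ * δ ≤ 1 * δ := by gcongr
    have h4 : 0 ≤ C'/c₀ * δ := by positivity
    have h5 : 0 ≤ B * δ := by positivity
    linarith
  · intro x hx
    refine (hd2v x hx).trans ?_
    rw [hLi]
    have e : C' * δ * (K^m * (μ / (c₀ * δ))) = C'/c₀ * K^m * μ := by field_simp
    rw [e]
    gcongr
    linarith
  · intro x hx i j
    have h1 := hpv x hx i j
    rw [hsum x hx i j] at h1
    have hz : 0 < δ^2/K := by positivity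
    have h2 : ‖moll D L (fun y => g y i j) x - g x i j‖ ≤ δ^2/K := by
      refine moll_close hD hLp (hgc i j) (B := |g₀ i j| + r₀/4) (fun y hy => ?_) (hDD x hx) _ _ fun z hz => hgo x hx z hz i j
      have h1 := hgr y hy i j
      have e : g y i j = g₀ i j + (g y i j - g₀ i j) := by ring
      rw [e]
      exact (norm_add_le _ _).trans (add_le_add le_rfl h1)
    have h3 : δ^2 * H i j x = moll D L (fun y => g y i j) x - δ'^2 * g₀ i j - pb (fderiv ℝ (moll D L u) x) i j := by
      simp only [H, hh, hs, smul_eq_mul]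
      field_simp
      ring
    rw [h3] at h1
    have h1 := abs_le.1 h1
    have h2 := abs_le.1 h2
    have h4 : C' * (δ^2/K) + δ^2/K ≤ (C' + B + 2 + C'/c₀) * (δ^2/K) := by
      have : 0 ≤ C'/c₀ := by positivity
      have hB9 : 0 ≤ B * (δ^2/K) := by positivity
      have hC9 : 0 ≤ C'/c₀ * (δ^2/K) := by positivity
      linarith
    rw [abs_le]
    constructor <;> linarith [h1.1, h1.2, h2.1, h2.2]

end stage
end CI

namespace CI
open scoped ContDiff
section iter
variable {n : ℕ}

lemma exists_kappa (A : ℝ) (hA : 0 < A) (m : ℕ) (α β : ℝ) (hα : 0 < α) (hα1 : α * (1 + 2 * m) < 1) (hβ : 0 < β) (hαβ : α < β / 2)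
    (κ₀ : ℝ) : ∃ κ ≥ κ₀, 2 ≤ κ ∧ κ ^ (-(1-α)) * (max (A * κ^(2*m)) (κ^((2-β)/β)))^α < 1 := by
  have t1 : Filter.Tendsto (fun κ : ℝ => A^α * κ^(-(1 - α * (1+2*m)))) Filter.atTop (𝓝 (A^α * 0)) :=
    (tendsto_rpow_neg_atTop (by linarith)).const_mul _
  have h2 : 0 < 1 - 2 * α / β := by
    have : 2 * α / β < 1 := by rw [div_lt_one hβ]; linarith
    linarith
  have t2 : Filter.Tendsto (fun κ : ℝ => κ^(-(1 - 2*α/β))) Filter.atTop (𝓝 0) := tendsto_rpow_neg_atTop h2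
  rw [mul_zero] at t1
  obtain ⟨κ, h3, h4, h5, h6⟩ := ((t1.eventually (gt_mem_nhds one_pos)).and ((t2.eventually (gt_mem_nhds one_pos)).and
    ((Filter.eventually_ge_atTop κ₀).and (Filter.eventually_ge_atTop 2)))).exists
  have hκ : 0 < κ := by linarith
  refine ⟨κ, h5, h6, ?_⟩
  rcases max_choice (A * κ^(2*m)) (κ^((2-β)/β)) with h | h
  · rw [h]
    refine lt_of_eq_of_lt ?_ h3
    rw [Real.mul_rpow hA.le (by positivity), ← Real.rpow_natCast, ← Real.rpow_mul hκ.le, mul_left_comm, ← Real.rpow_add hκ]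
    congr 2; push_cast; ring
  · rw [h]
    refine lt_of_eq_of_lt ?_ h4
    rw [← Real.rpow_mul hκ.le, ← Real.rpow_add hκ]
    congr 1; field_simp; ring

/-- interpolation -/
lemma interp {a B L d α : ℝ} (ha : 0 ≤ a) (hB : 0 ≤ B) (hL : 0 ≤ L) (hd : 0 ≤ d) (h1 : a ≤ B) (h2 : a ≤ L * d) (hα : 0 < α) (hα1 : α < 1) :
    a ≤ B^(1-α) * L^α * d^α := by
  have e : a = a^(1-α) * a^α := by
    rw [← Real.rpow_add_of_nonneg ha (by linarith) hα.le]; simp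
  rw [e, mul_assoc, ← Real.mul_rpow hL hd]
  gcongr

lemma fderiv_diff_lip {F : Type} [NormedAddCommGroup F] [NormedSpace ℝ F] {D : Set (Fin n → ℝ)} (hD : IsOpen D) {u v : (Fin n → ℝ) → F} {μ μ' : ℝ}
    (hu : ContDiffOn ℝ 2 u D) (hv : ContDiffOn ℝ 2 v D) (hμ : ∀ x ∈ D, ‖fderiv ℝ (fderiv ℝ u) x‖ ≤ μ)
    (hμ' : ∀ x ∈ D, ‖fderiv ℝ (fderiv ℝ v) x‖ ≤ μ') {S : Set (Fin n → ℝ)}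
    (hS : Convex ℝ S) (hSD : S ⊆ D) {x y : Fin n → ℝ} (hx : x ∈ S) (hy : y ∈ S) :
    ‖(fderiv ℝ v x - fderiv ℝ u x) - (fderiv ℝ v y - fderiv ℝ u y)‖ ≤ (μ + μ') * ‖x - y‖ := by
  have h1 := fderiv_lip hD hu hμ hS hSD hy hx
  have h2 := fderiv_lip hD hv hμ' hS hSD hy hx
  have e : (fderiv ℝ v x - fderiv ℝ u x) - (fderiv ℝ v y - fderiv ℝ u y) =
    (fderiv ℝ v x - fderiv ℝ v y) - (fderiv ℝ u x - fderiv ℝ u y) := by abel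
  rw [e]
  refine (norm_sub_le _ _).trans ?_
  linarith

lemma ball_thick {U : Set (Fin n → ℝ)} {x : Fin n → ℝ} {a b c : ℝ} (hx : x ∈ Metric.thickening a U) (h : a + b ≤ c) :
    Metric.closedBall x b ⊆ Metric.thickening c U := by
  intro z hz
  rw [Metric.mem_thickening_iff] at *
  obtain ⟨y, hy, hxy⟩ := hx
  refine ⟨y, hy, ?_⟩
  rw [Metric.mem_closedBall] at hz
  linarith [dist_triangle z x y]

set_option maxHeartbeats 2000000 in
lemma iterate {g₀ : Matrix (Fin n) (Fin n) ℝ} (hg : g₀.PosDef) (α β : ℝ) (hα : 0 < α) (hβ : 0 < β) (hβ1 : β < 1)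
    (hα1 : α < 1 / (1 + (n:ℝ) * ((n:ℝ)+1))) (hαβ : α < β / 2) :
    ∃ C > (0:ℝ), ∃ σ > (0:ℝ), ∃ δ₁ > (0:ℝ), ∃ r₁ > (0:ℝ), ∃ ε₁ > (0:ℝ), δ₁ ≤ 1 ∧
    ∀ (U : Set (Fin n → ℝ)) (u : (Fin n → ℝ) → (Fin (n+1) → ℝ)) (g : (Fin n → ℝ) → Matrix (Fin n) (Fin n) ℝ)
      (Θ δ μ : ℝ), 0 ≤ Θ → 0 < δ → δ ≤ δ₁ → 0 < μ → Θ * (δ/μ)^β ≤ ε₁ * δ^2 →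
      ContDiffOn ℝ 2 u (Metric.thickening (3 * (δ/μ)) U) →
      (∃ B0, ∀ x ∈ Metric.thickening (3 * (δ/μ)) U, ‖u x‖ ≤ B0) →
      (∀ x ∈ Metric.thickening (3 * (δ/μ)) U, ‖fderiv ℝ (fderiv ℝ u) x‖ ≤ μ) →
      (∀ x i j, g x i j = g x j i) →
      (∀ x i j, |g x i j - g₀ i j| ≤ r₁) →
      (∀ x y i j, |g x i j - g y i j| ≤ Θ * ‖x - y‖^β) →
      (∀ x ∈ Metric.thickening (3 * (δ/μ)) U, ∀ i j, |g x i j - δ^2 * g₀ i j - pb (fderiv ℝ u x) i j| ≤ σ * δ^2) →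
      ∃ ub : (Fin n → ℝ) → (Fin (n+1) → ℝ),
        (∀ x ∈ Metric.thickening (δ/μ) U, DifferentiableAt ℝ ub x) ∧
        (∀ x ∈ U, ∀ i j, pb (fderiv ℝ ub x) i j = g x i j) ∧
        (∀ x ∈ U, ‖fderiv ℝ ub x - fderiv ℝ u x‖ ≤ C * δ) ∧
        (∀ x ∈ U, ∀ y ∈ U, ‖(fderiv ℝ ub x - fderiv ℝ u x) - (fderiv ℝ ub y - fderiv ℝ u y)‖ ≤
          C * (μ^α * δ^(1-α)) * ‖x - y‖^α) := by
  obtain ⟨m, hm, C₁, hC₁, σ, hσ, c₀, hc₀, δ₁, hδ₁, r₁, hr₁, hc₀1, hδ₁1, hst⟩ := stage hg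
  have hmR : (n:ℝ) * ((n:ℝ)+1) = 2 * m := by exact_mod_cast hm.symm
  rw [hmR] at hα1
  have hα2 : α * (1 + 2 * m) < 1 := by
    rwa [lt_div_iff₀ (by positivity)] at hα1
  have hα3 : α < 1 := by linarith
  have hC₁0 : 0 < C₁ := by linarith
  obtain ⟨κ, hκ0, hκ2, hκM⟩ := exists_kappa (C₁ * (C₁/σ)^m) (by positivity) m α β hα hα2 hβ hαβ σ
  have hκ : 0 < κ := by linarith
  set K := C₁ * κ^2/σ with hK
  have hK1 : 1 ≤ K := by
    rw [hK, le_div_iff₀ hσ]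
    nlinarith
  have hK0 : 0 < K := by linarith
  have eM : C₁ * (C₁/σ)^m * κ^(2*m) = C₁ * K^m := by
    rw [hK, pow_mul, mul_assoc, ← mul_pow]; congr 2; ring
  rw [eM] at hκM
  set M := max (C₁ * K^m) (κ^((2-β)/β)) with hM
  set ζ := κ ^ (-(1-α)) * M^α with hζ
  have hM1 : 1 ≤ M := by
    refine le_trans ?_ (le_max_left _ _)
    have : 1 ≤ K^m := one_le_pow₀ hK1
    nlinarith
  have hM0 : 0 < M := by linarith
  have hζ0 : 0 < ζ := by positivity
  set CH := 2 * C₁ * M / (1 - ζ) with hCH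
  have h1ζ : 0 < 1 - ζ := by linarith
  have hCH0 : 0 < CH := by positivity
  refine ⟨CH + 4 * C₁, by positivity, σ, hσ, min δ₁ (1/K), lt_min hδ₁ (by positivity), r₁, hr₁, 1/K, by positivity,
    (min_le_left _ _).trans hδ₁1, ?_⟩
  intro U u g Θ δ μ hΘ hδ hδδ hμ hΘδ hu hub hu2 hgs hgr hgh hmet
  set d := δ/μ with hd
  have hdp : 0 < d := by positivity
  -- sequences
  let δq : ℕ → ℝ := fun q => δ / κ^q
  let μq : ℕ → ℝ := fun q => μ * M^q
  let ρq : ℕ → ℝ := fun q => d * (1 + 2 / 2^q)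
  have hδq : ∀ q, 0 < δq q := fun q => by positivity
  have hμq : ∀ q, 0 < μq q := fun q => by positivity
  have hκq : ∀ q, (2:ℝ)^q ≤ κ^q := fun q => pow_le_pow_left₀ (by norm_num) hκ2 q
  have hδq2 : ∀ q, δq q ≤ δ * (1/2)^q := fun q => by
    simp only [δq]
    rw [one_div, inv_pow, ← div_eq_mul_inv]
    exact div_le_div_of_nonneg_left hδ.le (by positivity) (hκq q)
  have hδqδ : ∀ q, δq q ≤ δ := fun q => (hδq2 q).trans (by
    have : ((1:ℝ)/2)^q ≤ 1 := pow_le_one₀ (by norm_num) (by norm_num)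
    exact mul_le_of_le_one_right hδ.le this)
  have hMq : ∀ q, 1 ≤ M^q := fun q => one_le_pow₀ hM1
  have hdq : ∀ q, δq q / μq q ≤ d / 2^q := by
    intro q
    simp only [δq, μq, hd]
    rw [div_div, div_div]
    refine div_le_div_of_nonneg_left hδ.le (by positivity) ?_
    calc μ * 2^q ≤ μ * (κ^q * M^q) := by
          gcongr
          exact (hκq q).trans (le_mul_of_one_le_right (pow_pos hκ q).le (hMq q))
      _ = _ := by ring
  have hρ0 : ρq 0 = 3 * d := by simp only [ρq]; norm_num; ring
  have hρs : ∀ q, ρq (q+1) + c₀ * δq q / μq q ≤ ρq q := by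
    intro q
    have h1 : c₀ * δq q / μq q ≤ d / 2^q := by
      refine le_trans ?_ (hdq q)
      have := hμq q; have := hδq q
      gcongr
      exact mul_le_of_le_one_left (hδq q).le hc₀1
    have h2 : ρq q - ρq (q+1) = d/2^q := by
      simp only [ρq]; rw [pow_succ]; field_simp; ring
    linarith
  have hρd : ∀ q, d ≤ ρq q := fun q => by
    simp only [ρq]
    have : 0 ≤ 2/(2:ℝ)^q := by positivity
    exact le_mul_of_one_le_right hdp.le (by linarith)
  let Dq : ℕ → Set (Fin n → ℝ) := fun q => Metric.thickening (ρq q) U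
  have hDo : ∀ q, IsOpen (Dq q) := fun q => Metric.isOpen_thickening
  let P : ℕ → ((Fin n → ℝ) → (Fin (n+1) → ℝ)) → Prop := fun q v =>
    ContDiffOn ℝ 2 v (Dq q) ∧ (∃ B0, ∀ x ∈ Dq q, ‖v x‖ ≤ B0) ∧
      (∀ x ∈ Dq q, ‖fderiv ℝ (fderiv ℝ v) x‖ ≤ μq q) ∧
      (∀ x ∈ Dq q, ∀ i j, |g x i j - (δq q)^2 * g₀ i j - pb (fderiv ℝ v x) i j| ≤ σ * (δq q)^2)
  let R : ℕ → ((Fin n → ℝ) → (Fin (n+1) → ℝ)) → ((Fin n → ℝ) → (Fin (n+1) → ℝ)) → Prop := fun q v v' =>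
    (∀ x ∈ Dq (q+1), ‖v' x - v x‖ ≤ C₁ * δq q / μq q) ∧ (∀ x ∈ Dq (q+1), ‖fderiv ℝ v' x - fderiv ℝ v x‖ ≤ C₁ * δq q)
  have hgc : ∀ i j, Continuous (fun x => g x i j) := by
    intro i j
    rw [continuous_iff_continuousAt]
    intro x
    rw [ContinuousAt, tendsto_iff_norm_sub_tendsto_zero]
    have t1 : Filter.Tendsto (fun y => Θ * ‖y - x‖^β) (𝓝 x) (𝓝 (Θ * ‖x - x‖^β)) := by
      have : Continuous (fun y : Fin n → ℝ => Θ * ‖y - x‖^β) :=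
        continuous_const.mul ((continuous_id.sub continuous_const).norm.rpow_const (fun _ => Or.inr hβ.le))
      exact this.tendsto x
    rw [sub_self, norm_zero, Real.zero_rpow hβ.ne', mul_zero] at t1
    exact squeeze_zero (fun _ => norm_nonneg _) (fun y => hgh y x i j) t1
  have hδ1K : δ ≤ 1/K := hδδ.trans (min_le_right _ _)
  have hδ1 : δ ≤ 1 := hδδ.trans ((min_le_left _ _).trans hδ₁1)
  -- Hölder smallness on every stage
  have hosc : ∀ q, Θ * (δq q / μq q)^β ≤ (δq q)^2 / K := by
    intro q
    have e1 : δq q / μq q = d * (κ^q)⁻¹ * (M^q)⁻¹ := by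
      simp only [δq, μq, hd]; field_simp
    have e2 : κ^(2-β) ≤ M^β := by
      have : κ^((2-β)/β) ≤ M := le_max_right _ _
      calc κ^(2-β) = (κ^((2-β)/β))^β := by rw [← Real.rpow_mul hκ.le]; congr 1; field_simp
        _ ≤ M^β := by gcongr
    have e3 : κ^(2:ℕ) ≤ κ^β * M^β := by
      calc κ^(2:ℕ) = κ^β * κ^(2-β) := by rw [← Real.rpow_add hκ]; norm_num
        _ ≤ _ := by gcongr
    have e4 : (κ^2)^q ≤ ((κ^q)^β) * (M^q)^β := by
      calc (κ^2)^q ≤ (κ^β * M^β)^q := pow_le_pow_left₀ (by positivity) e3 q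
        _ = _ := by
          rw [mul_pow]
          congr 1 <;> rw [← Real.rpow_natCast, ← Real.rpow_natCast, ← Real.rpow_mul (by positivity), ← Real.rpow_mul (by positivity), mul_comm]
    rw [e1, Real.mul_rpow (by positivity) (by positivity), Real.mul_rpow (by positivity) (by positivity),
      Real.inv_rpow (by positivity), Real.inv_rpow (by positivity)]
    calc Θ * (d^β * ((κ^q)^β)⁻¹ * ((M^q)^β)⁻¹) = (Θ * d^β) * ((κ^q)^β * (M^q)^β)⁻¹ := by rw [mul_inv]; ring
      _ ≤ (1/K * δ^2) * ((κ^2)^q)⁻¹ := by gcongr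
      _ = _ := by simp only [δq]; rw [div_pow, ← pow_mul, ← pow_mul, mul_comm 2 q]; field_simp
  have step : ∀ q v, P q v → ∃ v', P (q+1) v' ∧ R q v v' := by
    intro q v ⟨p1, ⟨B0, p2⟩, p3, p4⟩
    have hsub : Dq (q+1) ⊆ Dq q := Metric.thickening_mono (by
      have := hρs q
      have h0 : 0 ≤ c₀ * δq q / μq q := by have := hμq q; have := hδq q; positivity
      linarith) U
    have hl : c₀ * δq q / μq q ≤ δq q / μq q := by
      have := hμq q; have := hδq q
      gcongr; exact mul_le_of_le_one_left (hδq q).le hc₀1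
    have hl0 : 0 ≤ c₀ * δq q / μq q := by have := hμq q; have := hδq q; positivity
    have es : δq (q+1) = δq q / κ := by simp only [δq]; rw [pow_succ, div_div]
    obtain ⟨v', w1, w2, w3, w4, w5⟩ := hst K (Dq q) (Dq (q+1)) v g (δq q) (δq (q+1)) (μq q) hK1 (hDo q) (hDo (q+1)) (hδq q)
      ((hδqδ q).trans (hδδ.trans (min_le_left _ _)))
      (by
        have h1 : δq q ≤ 1/K := (hδqδ q).trans hδ1K
        have h2 : δq q * K ≤ 1 := by rwa [le_div_iff₀ hK0] at h1
        have h3 : δq q ≤ 1 := (hδqδ q).trans hδ1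
        have h4 := hδq q
        nlinarith)
      (by
        rw [es, div_pow]
        refine div_le_div_of_nonneg_left (by positivity) (by norm_num) (by nlinarith))
      (hμq q) (fun x hx => ball_thick hx (hρs q)) p1 ⟨B0, p2⟩ p3 (fun i j => (hgc i j).continuousOn) hgs
      (fun x _ => hgr x)
      (fun x hx z hz i j => by
        refine (hgh z x i j).trans (le_trans ?_ (hosc q))
        rw [mem_closedBall_iff_norm] at hz
        gcongr
        exact hz.trans hl)
      p4
    refine ⟨v', ⟨w1.of_le (by norm_cast), ⟨B0 + C₁ * δq q / μq q, fun x hx => ?_⟩, ?_, ?_⟩, w2, w3⟩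
    · have h1 := w2 x hx
      have h2 := p2 x (hsub hx)
      have e : v' x = v x + (v' x - v x) := by abel
      rw [e]
      exact (norm_add_le _ _).trans (add_le_add h2 h1)
    · intro x hx
      refine (w4 x hx).trans ?_
      simp only [μq]
      rw [pow_succ]
      have h1 : C₁ * K^m ≤ M := le_max_left _ _
      calc C₁ * K^m * (μ * M^q) ≤ M * (μ * M^q) := by gcongr
        _ = _ := by ring
    · intro x hx i j
      refine (w5 x hx i j).trans (le_of_eq ?_)
      rw [es, hK]; field_simp
  choose! f hf using step
  let V : ℕ → ((Fin n → ℝ) → (Fin (n+1) → ℝ)) := fun q => Nat.rec u (fun q v => f q v) q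
  have hV0 : V 0 = u := rfl
  have hVs : ∀ q, V (q+1) = f q (V q) := fun q => rfl
  have hP : ∀ q, P q (V q) := by
    intro q
    induction q with
    | zero =>
      have e0 : δq 0 = δ := by simp [δq]
      have e1 : μq 0 = μ := by simp [μq]
      rw [hV0]
      simp only [P, Dq, hρ0, e0, e1]
      exact ⟨hu, hub, hu2, hmet⟩
    | succ q ih => rw [hVs]; exact (hf q (V q) ih).1
  have hR : ∀ q, R q (V q) (V (q+1)) := fun q => by rw [hVs]; exact (hf q (V q) (hP q)).2
  clear_value V
  clear hf
  set T := Metric.thickening d U with hT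
  have hTo : IsOpen T := Metric.isOpen_thickening
  have hTD : ∀ q, T ⊆ Dq q := fun q => Metric.thickening_mono (hρd q) U
  have hUT : U ⊆ T := Metric.self_subset_thickening hdp U
  have hc1 : ∀ x ∈ T, ∀ q, dist (V q x) (V (q+1) x) ≤ C₁ * d * (1/2)^q := by
    intro x hx q
    rw [dist_comm, dist_eq_norm]
    refine ((hR q).1 x (hTD _ hx)).trans ?_
    have := hdq q
    calc C₁ * δq q / μq q = C₁ * (δq q / μq q) := by ring
      _ ≤ C₁ * (d / 2^q) := by gcongr
      _ = _ := by rw [one_div, inv_pow]; ring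
  have hc2 : ∀ x ∈ T, ∀ q, dist (fderiv ℝ (V q) x) (fderiv ℝ (V (q+1)) x) ≤ C₁ * δ * (1/2)^q := by
    intro x hx q
    rw [dist_comm, dist_eq_norm]
    refine ((hR q).2 x (hTD _ hx)).trans ?_
    calc C₁ * δq q ≤ C₁ * (δ * (1/2)^q) := by gcongr; exact hδq2 q
      _ = _ := by ring
  have l1 : ∀ x, ∃ y, x ∈ T → Filter.Tendsto (fun q => V q x) Filter.atTop (𝓝 y) := by
    intro x
    by_cases hx : x ∈ T
    · obtain ⟨y, hy⟩ := cauchySeq_tendsto_of_complete (cauchySeq_of_le_geometric (1/2) (C₁ * d) (by norm_num) (hc1 x hx))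
      exact ⟨y, fun _ => hy⟩
    · exact ⟨0, fun h => absurd h hx⟩
  have l2 : ∀ x, ∃ y, x ∈ T → Filter.Tendsto (fun q => fderiv ℝ (V q) x) Filter.atTop (𝓝 y) := by
    intro x
    by_cases hx : x ∈ T
    · obtain ⟨y, hy⟩ := cauchySeq_tendsto_of_complete (cauchySeq_of_le_geometric (1/2) (C₁ * δ) (by norm_num) (hc2 x hx))
      exact ⟨y, fun _ => hy⟩
    · exact ⟨0, fun h => absurd h hx⟩
  choose ub hub' using l1
  choose ub' hubd using l2
  have hunif : TendstoUniformlyOn (fun q x => fderiv ℝ (V q) x) ub' Filter.atTop T := by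
    rw [Metric.tendstoUniformlyOn_iff]
    intro ε hε
    have t : Filter.Tendsto (fun q : ℕ => C₁ * δ * (1/2:ℝ)^q / (1 - 1/2)) Filter.atTop (𝓝 (C₁ * δ * 0 / (1-1/2))) :=
      ((tendsto_pow_atTop_nhds_zero_of_lt_one (by norm_num) (by norm_num)).const_mul _).div_const _
    rw [mul_zero, zero_div] at t
    filter_upwards [t.eventually (gt_mem_nhds hε)] with q hq x hx
    rw [dist_comm]
    exact lt_of_le_of_lt (dist_le_of_le_geometric_of_tendsto (1/2) (C₁ * δ) (by norm_num) (hc2 x hx) (hubd x hx) q) hq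
  have hVd : ∀ q, ∀ x ∈ T, HasFDerivAt (V q) (fderiv ℝ (V q) x) x := fun q x hx =>
    (((hP q).1.contDiffAt ((hDo q).mem_nhds (hTD q hx))).differentiableAt (by simp)).hasFDerivAt
  have hder : ∀ x ∈ T, HasFDerivAt ub (ub' x) x := fun x hx =>
    hasFDerivAt_of_tendstoUniformlyOn hTo hunif (fun q x hx => hVd q x hx) (fun x hx => hub' x hx) hx
  have hfd : ∀ x ∈ T, fderiv ℝ ub x = ub' x := fun x hx => (hder x hx).fderiv
  have hclose : ∀ x ∈ U, ‖fderiv ℝ ub x - fderiv ℝ u x‖ ≤ 2 * C₁ * δ := by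
    intro x hx
    rw [hfd x (hUT hx), ← hV0, ← dist_eq_norm, dist_comm]
    refine (dist_le_of_le_geometric_of_tendsto₀ (1/2) (C₁ * δ) (by norm_num) (hc2 x (hUT hx)) (hubd x (hUT hx))).trans (le_of_eq ?_)
    ring
  refine ⟨ub, fun x hx => (hder x hx).differentiableAt, ?_, ?_, ?_⟩
  · intro x hx i j
    have hxT := hUT hx
    rw [hfd x hxT]
    have t1 : Filter.Tendsto (fun q => pb (fderiv ℝ (V q) x) i j) Filter.atTop (𝓝 (pb (ub' x) i j)) :=
      ((pb_smooth i j).continuous.tendsto _).comp (hubd x hxT)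
    have tδ : Filter.Tendsto δq Filter.atTop (𝓝 0) := by
      refine squeeze_zero (fun q => (hδq q).le) hδq2 ?_
      have := (tendsto_pow_atTop_nhds_zero_of_lt_one (r := (1/2:ℝ)) (by norm_num) (by norm_num)).const_mul δ
      rwa [mul_zero] at this
    have t2 : Filter.Tendsto (fun q => |g x i j - (δq q)^2 * g₀ i j - pb (fderiv ℝ (V q) x) i j|) Filter.atTop
        (𝓝 |g x i j - 0^2 * g₀ i j - pb (ub' x) i j|) :=
      ((tendsto_const_nhds.sub ((tδ.pow 2).mul_const _)).sub t1).abs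
    have t3 : Filter.Tendsto (fun q => σ * (δq q)^2) Filter.atTop (𝓝 (σ * 0^2)) := (tδ.pow 2).const_mul σ
    have h := le_of_tendsto_of_tendsto' t2 t3 (fun q => (hP q).2.2.2 x (hTD q hxT) i j)
    norm_num at h
    linarith
  · intro x hx
    refine (hclose x hx).trans ?_
    clear * - hδ hCH0 hC₁0
    nlinarith
  · intro x hx y hy
    have hz : 0 ≤ ‖x - y‖ := norm_nonneg _
    by_cases hxy : ‖x - y‖ < d
    · -- geometric sum of interpolated bounds
      have hS : Metric.ball x d ⊆ T := fun z hz => Metric.mem_thickening_iff.2 ⟨x, hx, hz⟩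
      have hyS : y ∈ Metric.ball x d := by rw [mem_ball_iff_norm, norm_sub_rev]; exact hxy
      have hxS : x ∈ Metric.ball x d := Metric.mem_ball_self hdp
      set A := 2 * C₁ * M * (μ^α * δ^(1-α)) * ‖x-y‖^α with hA
      have hgeo : ∀ q, dist (fderiv ℝ (V q) x - fderiv ℝ (V q) y) (fderiv ℝ (V (q+1)) x - fderiv ℝ (V (q+1)) y) ≤ A * ζ^q := by
        intro q
        rw [dist_comm, dist_eq_norm]
        have e : fderiv ℝ (V (q+1)) x - fderiv ℝ (V (q+1)) y - (fderiv ℝ (V q) x - fderiv ℝ (V q) y) =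
          (fderiv ℝ (V (q+1)) x - fderiv ℝ (V q) x) - (fderiv ℝ (V (q+1)) y - fderiv ℝ (V q) y) := by abel
        rw [e]
        have b1 : ‖(fderiv ℝ (V (q+1)) x - fderiv ℝ (V q) x) - (fderiv ℝ (V (q+1)) y - fderiv ℝ (V q) y)‖ ≤ 2 * C₁ * δq q := by
          refine (norm_sub_le _ _).trans ?_
          linarith [(hR q).2 x (hTD _ (hUT hx)), (hR q).2 y (hTD _ (hUT hy))]
        have b2 := fderiv_diff_lip hTo ((hP q).1.mono (hTD q)) ((hP (q+1)).1.mono (hTD (q+1)))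
          (fun z hz => (hP q).2.2.1 z (hTD q hz)) (fun z hz => (hP (q+1)).2.2.1 z (hTD (q+1) hz)) (convex_ball x d) hS hxS hyS
        have hμs : μq q + μq (q+1) ≤ 2 * M * μq q := by
          have e : μq (q+1) = M * μq q := by simp only [μq]; ring
          rw [e]; linarith [le_mul_of_one_le_left (hμq q).le hM1]
        have b3 := interp (norm_nonneg _) (by have := hδq q; positivity) (by have := hμq q; positivity) hz b1
          (b2.trans (mul_le_mul_of_nonneg_right hμs hz)) hα hα3
        refine b3.trans ?_
        have f1 : (2 * C₁ * δq q)^(1-α) = (2*C₁)^(1-α) * (δ^(1-α) * (κ^(-(1-α)))^q) := by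
          rw [Real.mul_rpow (by positivity) (hδq q).le]
          simp only [δq]
          rw [Real.div_rpow hδ.le (by positivity), ← Real.rpow_natCast κ q, ← Real.rpow_natCast, ← Real.rpow_mul hκ.le, ← Real.rpow_mul hκ.le,
            div_eq_mul_inv, ← Real.rpow_neg hκ.le]
          congr 3; ring
        have f2 : (2 * M * μq q)^α = (2*M)^α * (μ^α * (M^α)^q) := by
          rw [Real.mul_rpow (by positivity) (hμq q).le]
          simp only [μq]
          rw [Real.mul_rpow hμ.le (by positivity), ← Real.rpow_natCast M q, ← Real.rpow_natCast, ← Real.rpow_mul hM0.le, ← Real.rpow_mul hM0.le,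
            mul_comm (q:ℝ) α]
        have f3 : (2*C₁)^(1-α) * (2*M)^α ≤ 2 * C₁ * M := by
          rw [Real.mul_rpow (by norm_num) hC₁0.le, Real.mul_rpow (by norm_num) hM0.le]
          have s1 : (2:ℝ)^(1-α) * 2^α = 2 := by rw [← Real.rpow_add (by norm_num)]; norm_num
          have s2 : C₁^(1-α) ≤ C₁ := by
            calc C₁^(1-α) ≤ C₁^(1:ℝ) := Real.rpow_le_rpow_of_exponent_le hC₁ (by linarith)
              _ = C₁ := Real.rpow_one _
          have s3 : M^α ≤ M := by
            calc M^α ≤ M^(1:ℝ) := Real.rpow_le_rpow_of_exponent_le hM1 (by linarith)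
              _ = M := Real.rpow_one _
          calc (2:ℝ)^(1-α) * C₁^(1-α) * (2^α * M^α) = ((2:ℝ)^(1-α) * 2^α) * (C₁^(1-α) * M^α) := by ring
            _ = 2 * (C₁^(1-α) * M^α) := by rw [s1]
            _ ≤ 2 * (C₁ * M) := by gcongr
            _ = _ := by ring
        rw [f1, f2]
        calc _ = ((2*C₁)^(1-α) * (2*M)^α) * ((μ^α * δ^(1-α)) * ‖x-y‖^α * ((κ^(-(1-α)))^q * (M^α)^q)) := by ring
          _ ≤ (2 * C₁ * M) * ((μ^α * δ^(1-α)) * ‖x-y‖^α * ((κ^(-(1-α)))^q * (M^α)^q)) := by gcongr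
          _ = _ := by rw [← mul_pow, ← hζ, hA]; ring
      have hlim : Filter.Tendsto (fun q => fderiv ℝ (V q) x - fderiv ℝ (V q) y) Filter.atTop (𝓝 (ub' x - ub' y)) :=
        (hubd x (hUT hx)).sub (hubd y (hUT hy))
      have hfin := dist_le_of_le_geometric_of_tendsto₀ ζ A hκM hgeo hlim
      rw [hfd x (hUT hx), hfd y (hUT hy)]
      have e : ub' x - fderiv ℝ u x - (ub' y - fderiv ℝ u y) = (ub' x - ub' y) - (fderiv ℝ (V 0) x - fderiv ℝ (V 0) y) := by
        rw [hV0]; abel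
      rw [e, ← dist_eq_norm, dist_comm]
      refine hfin.trans ?_
      have e2 : A / (1 - ζ) = CH * (μ^α * δ^(1-α)) * ‖x-y‖^α := by rw [hA, hCH]; ring
      rw [e2]
      gcongr
      linarith
    · push Not at hxy
      have b1 : ‖(fderiv ℝ ub x - fderiv ℝ u x) - (fderiv ℝ ub y - fderiv ℝ u y)‖ ≤ 4 * C₁ * δ := by
        refine (norm_sub_le _ _).trans ?_
        linarith [hclose x hx, hclose y hy]
      refine b1.trans ?_
      have h1 : δ ≤ (μ^α * δ^(1-α)) * ‖x-y‖^α := by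
        calc δ = (μ^α * δ^(1-α)) * d^α := by
              rw [hd, Real.div_rpow hδ.le hμ.le]
              have : δ = δ^(1-α) * δ^α := by rw [← Real.rpow_add hδ]; simp
              have h0 : μ^α ≠ 0 := by positivity
              nth_rewrite 1 [this]
              field_simp
          _ ≤ _ := by gcongr
      calc 4 * C₁ * δ ≤ 4 * C₁ * ((μ^α * δ^(1-α)) * ‖x-y‖^α) := by gcongr
        _ ≤ _ := by
          rw [mul_assoc (CH + 4*C₁)]
          gcongr
          linarith

end iter
end CI

namespace CI
open scoped ContDiff
section geo
variable {n : ℕ}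

lemma smooth_bdd {G : Type} [NormedAddCommGroup G] [NormedSpace ℝ G] {f : (Fin n → ℝ) → G} (hf : ContDiff ℝ ∞ f) (R : ℝ) :
    ∃ M ≥ (1:ℝ), (∀ x ∈ Metric.ball (0 : Fin n → ℝ) R, ‖f x‖ ≤ M) ∧
      ∀ x ∈ Metric.ball (0 : Fin n → ℝ) R, ∀ y ∈ Metric.ball (0 : Fin n → ℝ) R, ‖f x - f y‖ ≤ M * ‖x - y‖ := by
  obtain ⟨M1, h1⟩ := (isCompact_closedBall (0 : Fin n → ℝ) R).exists_bound_of_continuousOn hf.continuous.continuousOn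
  have hd : ContDiff ℝ ∞ (fderiv ℝ f) := hf.fderiv_right (by norm_cast)
  obtain ⟨M2, h2⟩ := (isCompact_closedBall (0 : Fin n → ℝ) R).exists_bound_of_continuousOn hd.continuous.continuousOn
  refine ⟨max 1 (max M1 M2), le_max_left _ _, fun x hx => (h1 x (Metric.ball_subset_closedBall hx)).trans (by simp),
    fun x hx y hy => ?_⟩
  refine (convex_ball (0 : Fin n → ℝ) R).norm_image_sub_le_of_norm_fderiv_le (𝕜 := ℝ)
    (fun z _ => (hf.differentiable (by simp)).differentiableAt)
    (fun z hz => (h2 z (Metric.ball_subset_closedBall hz)).trans (by simp)) hy hx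

/-- geometric data of a smooth domain -/
structure Geo (U : Set (Fin n → ℝ)) (η : (Fin n → ℝ) → (Fin n → ℝ)) (M t₀ c R : ℝ) : Prop where
  hη : ContDiff ℝ ∞ η
  hM : 1 ≤ M
  ht0 : 0 < t₀
  ht1 : t₀ ≤ 1
  hc0 : 0 < c
  hc1 : c ≤ 1
  hR : Metric.thickening 1 U ⊆ Metric.ball (0 : Fin n → ℝ) R
  b0 : ∀ x ∈ Metric.ball (0 : Fin n → ℝ) R, ‖η x‖ ≤ M
  l0 : ∀ x ∈ Metric.ball (0 : Fin n → ℝ) R, ∀ y ∈ Metric.ball (0 : Fin n → ℝ) R, ‖η x - η y‖ ≤ M * ‖x - y‖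
  b1 : ∀ x ∈ Metric.ball (0 : Fin n → ℝ) R, ‖fderiv ℝ η x‖ ≤ M
  l1 : ∀ x ∈ Metric.ball (0 : Fin n → ℝ) R, ∀ y ∈ Metric.ball (0 : Fin n → ℝ) R,
    ‖fderiv ℝ η x - fderiv ℝ η y‖ ≤ M * ‖x - y‖
  inn : ∀ t, 0 < t → t ≤ t₀ → ∀ x ∈ Metric.thickening (c * t) U, Metric.ball (x + t • η x) (c * t) ⊆ U

set_option maxHeartbeats 1600000 in
lemma exists_geo {U : Set (Fin n → ℝ)} (hUo : IsOpen U) (hUb : Bornology.IsBounded U) (hs : HasSmoothBoundary U) :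
    ∃ η M t₀ c R, Geo U η M t₀ c R := by
  obtain ⟨ρ, hρ, hU, hfr⟩ := hs
  obtain ⟨R0, hR0⟩ := hUb.subset_closedBall (0 : Fin n → ℝ)
  set R := R0 + 4 with hR
  have hsub : ∀ x ∈ Metric.thickening 1 U, ‖x‖ < R0 + 1 := by
    intro x hx
    rw [Metric.mem_thickening_iff] at hx
    obtain ⟨y, hy, hxy⟩ := hx
    have := hR0 hy
    rw [mem_closedBall_zero_iff] at this
    rw [dist_eq_norm] at hxy
    have := norm_le_norm_add_norm_sub' x y
    linarith
  set η : (Fin n → ℝ) → (Fin n → ℝ) := fun x i => - fderiv ℝ ρ x (Pi.single i 1) with hη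
  have hdρ : ContDiff ℝ ∞ (fderiv ℝ ρ) := hρ.fderiv_right (by norm_cast)
  have hηs : ContDiff ℝ ∞ η := by
    rw [contDiff_pi]
    intro i
    exact (hdρ.clm_apply contDiff_const).neg
  have hG : ∀ x, fderiv ℝ ρ x (η x) = - ∑ i, (η x i)^2 := by
    intro x
    have e : η x = ∑ i, (η x i) • (Pi.single i 1 : Fin n → ℝ) := by
      ext j; simp [Finset.sum_apply, Pi.single_apply]
    conv_lhs => rw [e]
    rw [map_sum, ← Finset.sum_neg_distrib]
    refine Finset.sum_congr rfl fun i _ => ?_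
    rw [map_smul, smul_eq_mul]
    have : fderiv ℝ ρ x (Pi.single i 1) = - η x i := by simp [hη]
    rw [this]; ring
  set G : (Fin n → ℝ) → ℝ := fun x => ∑ i, (η x i)^2 with hGd
  have hGc : Continuous G := by
    have := hηs.continuous
    fun_prop
  have hGpos : ∀ x ∈ frontier U, 0 < G x := by
    intro x hx
    by_contra hcon
    apply hfr x hx
    have h0 : G x = 0 := le_antisymm (not_lt.1 hcon) (Finset.sum_nonneg fun i _ => sq_nonneg _)
    have h1 := (Finset.sum_eq_zero_iff_of_nonneg (fun i _ => sq_nonneg (η x i))).1 h0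
    ext v
    have e : v = ∑ i, (v i) • (Pi.single i 1 : Fin n → ℝ) := by
      ext j; simp [Finset.sum_apply, Pi.single_apply]
    rw [e, map_sum]
    simp only [map_smul, _root_.zero_apply]
    refine Finset.sum_eq_zero fun i hi => ?_
    have := h1 i hi
    simp only [hη, ne_eq, OfNat.ofNat_ne_zero, not_false_eq_true, pow_eq_zero_iff, neg_eq_zero] at this
    rw [this, smul_zero]
  have hcl : IsCompact (closure U) := hUb.isCompact_closure
  have hfrc : IsCompact (frontier U) := hcl.of_isClosed_subset isClosed_frontier frontier_subset_closure
  obtain ⟨γ, hγ, hγf⟩ := hfrc.exists_forall_le' hGc.continuousOn hGpos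
  obtain ⟨a, ha, haG⟩ := hfrc.exists_thickening_subset_open (isOpen_lt (continuous_const (y := γ/2)) hGc)
    (fun x hx => by simp only [Set.mem_ofPred_eq]; linarith [hγf x hx])
  have hcore : IsCompact (closure U \ Metric.thickening (a/2) (frontier U)) := hcl.diff Metric.isOpen_thickening
  obtain ⟨m, hm, hmc⟩ := hcore.exists_forall_le' (f := fun x => - ρ x) hρ.continuous.neg.continuousOn (a := 0) (fun x hx => by
    have : x ∈ U := by
      by_contra h
      exact hx.2 (Metric.self_subset_thickening (by linarith) _ ⟨hx.1, by rwa [hUo.interior_eq]⟩)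
    rw [hU] at this
    simp only [Set.mem_preimage, Set.mem_Iio] at this
    linarith)
  obtain ⟨M1, hM1, b0, l0⟩ := smooth_bdd hηs R
  obtain ⟨M2, hM2, b1, l1⟩ := smooth_bdd (hηs.fderiv_right (m := ∞) (by norm_cast)) R
  obtain ⟨M3, hM3, -, l3⟩ := smooth_bdd hρ R
  obtain ⟨M4, hM4, b4, l4⟩ := smooth_bdd hdρ R
  set M := M1 + M2 with hMM
  have hM : 1 ≤ M := by linarith
  -- constants
  set c := min 1 (γ / (8 * (M3 + M4))) with hc
  have hc0 : 0 < c := by positivity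
  have hcγ : c * (8 * (M3 + M4)) ≤ γ := by
    rw [← le_div_iff₀ (by positivity)]; exact min_le_right _ _
  set T := min (a/4) (min (γ / (8 * (M4 * (M+1)^2))) (min (m / (2 * (M3 * (M + 2)))) (1/(M+2)))) with hT
  have hT0 : 0 < T := by positivity
  have hT1 : T * (M + 2) ≤ 1 := by
    rw [← le_div_iff₀ (by positivity)]; exact (min_le_right _ _).trans ((min_le_right _ _).trans (min_le_right _ _))
  have hTm : T * (2 * (M3 * (M+2))) ≤ m := by
    rw [← le_div_iff₀ (by positivity)]; exact (min_le_right _ _).trans ((min_le_right _ _).trans (min_le_left _ _))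
  have hTγ : T * (8 * (M4 * (M+1)^2)) ≤ γ := by
    rw [← le_div_iff₀ (by positivity)]; exact (min_le_right _ _).trans (min_le_left _ _)
  have hTa : T ≤ a / 4 := min_le_left _ _
  have hTle : T ≤ 1 := by nlinarith
  have hRb : Metric.thickening 1 U ⊆ Metric.ball (0 : Fin n → ℝ) R := by
    intro x hx
    have := hsub x hx
    rw [mem_ball_zero_iff]; linarith
  have hcle : c ≤ 1 := min_le_left _ _
  refine ⟨η, M, T, c, R, hηs, hM, hT0, hTle, hc0, hcle, hRb, fun x hx => (b0 x hx).trans (by linarith),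
    fun x hx y hy => (l0 x hx y hy).trans (by gcongr; linarith), fun x hx => (b1 x hx).trans (by linarith),
    fun x hx y hy => (l1 x hx y hy).trans (by gcongr; linarith), ?_⟩
  intro t ht htT x hx z hz
  rw [Metric.mem_thickening_iff] at hx
  obtain ⟨y, hy, hxy⟩ := hx
  have hct : c * t ≤ t := by nlinarith
  have hx1 : x ∈ Metric.thickening 1 U := by
    rw [Metric.mem_thickening_iff]; exact ⟨y, hy, by linarith⟩
  have hxR := hRb hx1
  have hxn := hsub x hx1
  have hyR : y ∈ Metric.ball (0 : Fin n → ℝ) R := hRb (Metric.self_subset_thickening one_pos _ hy)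
  rw [Metric.mem_ball, dist_eq_norm] at hz
  rw [dist_eq_norm] at hxy
  have hηx := b0 x hxR
  have hzx : ‖z - x‖ ≤ t * M + c * t := by
    have e : z - x = (z - (x + t • η x)) + t • η x := by abel
    rw [e]
    refine (norm_add_le _ _).trans ?_
    rw [norm_smul, Real.norm_of_nonneg ht.le]
    have : t * ‖η x‖ ≤ t * M := by gcongr; linarith
    linarith
  have htM : t * (M + 1) ≤ T * (M+2) := by
    nlinarith
  have hzx1 : ‖z - x‖ ≤ 1 := by nlinarith
  have hzR : z ∈ Metric.ball (0 : Fin n → ℝ) R := by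
    rw [mem_ball_zero_iff]
    have := norm_le_norm_add_norm_sub' z x
    linarith
  have hUx : ρ y < 0 := by rw [hU] at hy; exact hy
  have key : ρ z < 0 := by
    by_cases hyf : y ∈ Metric.thickening (a/2) (frontier U)
    · have hGx : γ / 2 < G x := by
        apply haG
        rw [Metric.mem_thickening_iff] at hyf ⊢
        obtain ⟨w, hw, hyw⟩ := hyf
        refine ⟨w, hw, ?_⟩
        have := dist_triangle x y w
        rw [dist_eq_norm x y] at this
        linarith
      have h1 := l3 x hxR y hyR
      rw [Real.norm_eq_abs] at h1
      have h1' := (abs_le.1 h1).2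
      have hseg : segment ℝ x z ⊆ Metric.ball (0 : Fin n → ℝ) R := (convex_ball _ _).segment_subset hxR hzR
      have h2 : ‖ρ z - ρ x - fderiv ℝ ρ x (z - x)‖ ≤ (M4 * ‖z - x‖) * ‖z - x‖ := by
        refine (convex_segment x z).norm_image_sub_le_of_norm_fderiv_le' (𝕜 := ℝ)
          (fun w _ => (hρ.differentiable (by simp)).differentiableAt) (fun w hw => ?_) (left_mem_segment _ _ _) (right_mem_segment _ _ _)
        refine (l4 w (hseg hw) x hxR).trans ?_
        have := norm_sub_le_of_mem_segment hw
        gcongr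
      rw [Real.norm_eq_abs] at h2
      have h2' := (abs_le.1 h2).2
      have h3 : fderiv ℝ ρ x (z - x) ≤ M4 * (c * t) - t * G x := by
        have e : z - x = (z - (x + t • η x)) + t • η x := by abel
        rw [e, map_add, map_smul, hG, smul_eq_mul]
        have h5 := (fderiv ℝ ρ x).le_opNorm (z - (x + t • η x))
        have h6 := (le_abs_self _).trans h5
        have h7 : ‖fderiv ℝ ρ x‖ * ‖z - (x + t • η x)‖ ≤ M4 * (c * t) := by
          gcongr
          exact b4 x hxR
        linarith
      have h8 : M3 * ‖x - y‖ ≤ M3 * (c * t) := by gcongr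
      have h9 : M4 * ‖z - x‖ * ‖z - x‖ ≤ M4 * (t * (M + 1)) * (t * (M+1)) := by
        have : ‖z - x‖ ≤ t * (M + 1) := by nlinarith
        gcongr
      have h10 : M4 * (t * (M + 1)) * (t * (M+1)) ≤ t * γ / 8 := by
        have : t * (8 * (M4 * (M+1)^2)) ≤ γ := le_trans (by gcongr) hTγ
        calc M4 * (t * (M + 1)) * (t * (M+1)) = t * (t * (8 * (M4 * (M+1)^2))) / 8 := by ring
          _ ≤ t * γ / 8 := by gcongr
      have h11 : t * (c * (8 * (M3 + M4))) ≤ t * γ := by gcongr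
      have h12 : t * (γ/2) < t * G x := by gcongr
      have h13 : t * (c * (8 * (M3 + M4))) = 8 * (M3 * (c * t)) + 8 * (M4 * (c*t)) := by ring
      have h14 : 0 < t * γ := by positivity
      linarith
    · have h1 := hmc y ⟨subset_closure hy, hyf⟩
      have h2 := l3 z hzR y hyR
      rw [Real.norm_eq_abs] at h2
      have h2' := (abs_le.1 h2).2
      have h3 : ‖z - y‖ ≤ t * (M + 2) := by
        have := norm_sub_le_norm_sub_add_norm_sub z x y
        nlinarith
      have h4 : M3 * ‖z - y‖ ≤ M3 * (T * (M+2)) := by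
        have : t * (M+2) ≤ T * (M+2) := by gcongr
        gcongr; linarith
      nlinarith
  rw [hU]; exact key

end geo
end CI

namespace CI
open scoped ContDiff
section korn
variable {n : ℕ}

lemma vec_sum (v : Fin n → ℝ) : v = ∑ i, (v i) • (Pi.single i 1 : Fin n → ℝ) := by
  ext j; simp [Finset.sum_apply, Pi.single_apply]

/-- discrete Korn inequality: pointwise bars rigidity -/
lemma korn_pt (V : (Fin n → ℝ) → (Fin n → ℝ)) (R : Set (Fin n → ℝ)) (b : Fin n → ℝ) (h D ε : ℝ) (hh : 0 < h) (hε : 0 ≤ ε)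
    (hD : 0 ≤ D) (hb : b ∈ R) (hbk : ∀ k, b + h • (Pi.single k 1 : Fin n → ℝ) ∈ R) (hRD : ∀ y ∈ R, ‖y - b‖ ≤ D * h)
    (hV : ∀ y ∈ R, ∀ y' ∈ R, |(y - y') ⬝ᵥ (V y - V y')| ≤ ε * ‖y - y'‖^2) :
    ∃ Ω : Fin n → Fin n → ℝ, (∀ i j, |Ω i j + Ω j i| ≤ 3 * ε) ∧
      ∀ y ∈ R, ∀ i, |V y i - V b i - ∑ j, Ω i j * (y j - b j)| ≤ (D^2 + 1 + (D+1)^2 + 3 * n * D) * ε * h := by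
  set W : Fin n → (Fin n → ℝ) := fun k => V (b + h • (Pi.single k 1 : Fin n → ℝ)) - V b with hW
  have hn1 : ∀ k : Fin n, ‖(Pi.single k 1 : Fin n → ℝ)‖ ≤ 1 := fun k => norm_single_le k
  have hd : ∀ k, |W k k| ≤ ε * h := by
    intro k
    have h1 := hV _ (hbk k) b hb
    have e : b + h • (Pi.single k 1 : Fin n → ℝ) - b = h • (Pi.single k 1 : Fin n → ℝ) := by abel
    rw [e, smul_dotProduct, single_one_dotProduct, smul_eq_mul, abs_mul, abs_of_pos hh, norm_smul, Real.norm_of_nonneg hh.le, mul_pow] at h1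
    have h2 : ‖(Pi.single k 1 : Fin n → ℝ)‖^2 ≤ 1 := pow_le_one₀ (norm_nonneg _) (hn1 k)
    have h3 : h * |W k k| ≤ h * (ε * h) := by
      refine h1.trans ?_
      have : ε * (h^2 * ‖(Pi.single k 1 : Fin n → ℝ)‖^2) ≤ ε * (h^2 * 1) := by gcongr
      linarith
    exact le_of_mul_le_mul_left h3 hh
  have hjk : ∀ j k, |W j k + W k j| ≤ 3 * ε * h := by
    intro j k
    have h1 := hV _ (hbk j) _ (hbk k)
    have e : b + h • (Pi.single j 1 : Fin n → ℝ) - (b + h • (Pi.single k 1 : Fin n → ℝ)) =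
      h • ((Pi.single j 1 : Fin n → ℝ) - (Pi.single k 1 : Fin n → ℝ)) := by rw [smul_sub]; abel
    have e2 : V (b + h • (Pi.single j 1 : Fin n → ℝ)) - V (b + h • (Pi.single k 1 : Fin n → ℝ)) = W j - W k := by
      simp only [hW]; abel
    rw [e, e2, smul_dotProduct, sub_dotProduct, single_one_dotProduct, single_one_dotProduct, smul_eq_mul, abs_mul, abs_of_pos hh,
      norm_smul, Real.norm_of_nonneg hh.le, mul_pow] at h1
    have h2 : ‖(Pi.single j 1 : Fin n → ℝ) - (Pi.single k 1 : Fin n → ℝ)‖ ≤ 1 := by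
      rw [pi_norm_le_iff_of_nonneg zero_le_one]
      intro i
      simp only [Pi.sub_apply, Pi.single_apply]
      split_ifs <;> norm_num
    have h2' := pow_le_one₀ (n := 2) (norm_nonneg _) h2
    have h3 : h * |(W j - W k) j - (W j - W k) k| ≤ h * (ε * h) := by
      refine h1.trans ?_
      have : ε * (h^2 * ‖(Pi.single j 1 : Fin n → ℝ) - (Pi.single k 1 : Fin n → ℝ)‖^2) ≤ ε * (h^2 * 1) := by gcongr
      linarith
    have h4 := le_of_mul_le_mul_left h3 hh
    simp only [Pi.sub_apply] at h4
    have h5 := hd j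
    have h6 := hd k
    rw [abs_le] at *
    constructor <;> linarith [h4.1, h4.2, h5.1, h5.2, h6.1, h6.2]
  refine ⟨fun i j => W j i / h, fun i j => ?_, fun y hy k => ?_⟩
  · rw [← add_div, abs_div, abs_of_pos hh, div_le_iff₀ hh]
    exact hjk j i
  · have h1 := hV y hy b hb
    have h2 := hV y hy _ (hbk k)
    have hyb := hRD y hy
    have hy2 : ‖y - b‖^2 ≤ (D * h)^2 := by gcongr
    have hyk : ‖y - (b + h • (Pi.single k 1 : Fin n → ℝ))‖ ≤ (D + 1) * h := by
      have e : y - (b + h • (Pi.single k 1 : Fin n → ℝ)) = (y - b) - h • (Pi.single k 1 : Fin n → ℝ) := by abel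
      rw [e]
      refine (norm_sub_le _ _).trans ?_
      rw [norm_smul, Real.norm_of_nonneg hh.le]
      nlinarith [hn1 k]
    have hyk2 : ‖y - (b + h • (Pi.single k 1 : Fin n → ℝ))‖^2 ≤ ((D + 1) * h)^2 := by gcongr
    have h1' : |(y - b) ⬝ᵥ (V y - V b)| ≤ ε * (D * h)^2 := h1.trans (by gcongr)
    have h2' := h2.trans (show _ ≤ ε * ((D+1) * h)^2 by gcongr)
    have e3 : y - (b + h • (Pi.single k 1 : Fin n → ℝ)) = (y - b) - h • (Pi.single k 1 : Fin n → ℝ) := by abel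
    have e4 : V y - V (b + h • (Pi.single k 1 : Fin n → ℝ)) = (V y - V b) - W k := by simp only [hW]; abel
    rw [e3, e4, sub_dotProduct, smul_dotProduct, single_one_dotProduct, smul_eq_mul, Pi.sub_apply, Pi.sub_apply,
      dotProduct_sub (y - b) (V y - V b) (W k)] at h2'
    have h5 : |h * ∑ j, W j k / h * (y j - b j) + (y - b) ⬝ᵥ W k| ≤ n * (D * h * (3 * ε * h)) := by
      unfold dotProduct
      rw [Finset.mul_sum, ← Finset.sum_add_distrib]
      refine (Finset.abs_sum_le_sum_abs _ _).trans ?_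
      refine (Finset.sum_le_card_nsmul _ _ (D * h * (3 * ε * h)) fun j _ => ?_).trans (by simp)
      have e : h * (W j k / h * (y j - b j)) + (y - b) j * W k j = (y - b) j * (W j k + W k j) := by
        rw [Pi.sub_apply]; field_simp
      rw [e, abs_mul]
      have : |(y - b) j| ≤ ‖y - b‖ := norm_le_pi_norm (y - b) j
      exact mul_le_mul (this.trans hyb) (hjk j k) (abs_nonneg _) (by positivity)
    have h6 := hd k
    have h7 : h * |V y k - V b k - ∑ j, W j k / h * (y j - b j)| ≤ h * ((D^2 + 1 + (D+1)^2 + 3 * n * D) * ε * h) := by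
      rw [← abs_of_pos hh, ← abs_mul, abs_of_pos hh]
      have h6' : |h * W k k| ≤ ε * h^2 := by
        rw [abs_mul, abs_of_pos hh]; nlinarith
      have e : h * (V y k - V b k - ∑ j, W j k / h * (y j - b j)) = h * (V y k - V b k) - h * ∑ j, W j k / h * (y j - b j) := by ring
      rw [e]
      rw [abs_le] at *
      constructor <;> nlinarith [h1'.1, h1'.2, h2'.1, h2'.2, h5.1, h5.2, h6'.1, h6'.2]
    exact le_of_mul_le_mul_left h7 hh

lemma pb_quad (L : Hm n) (w : Fin n → ℝ) : L w ⬝ᵥ L w = ∑ i, ∑ j, w i * w j * pb L i j := by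
  have e : L w = ∑ i, w i • L (Pi.single i 1) := by
    conv_lhs => rw [vec_sum w]
    rw [map_sum]; simp only [map_smul]
  rw [e, sum_dotProduct]
  refine Finset.sum_congr rfl fun i _ => ?_
  rw [dotProduct_sum]
  refine Finset.sum_congr rfl fun j _ => ?_
  rw [pb_eq_dot, smul_dotProduct, dotProduct_smul, smul_eq_mul, smul_eq_mul]; ring

lemma quad_le (A : Fin n → Fin n → ℝ) (w : Fin n → ℝ) (ε : ℝ) (h : ∀ i j, |A i j| ≤ ε) :
    |∑ i, ∑ j, w i * w j * A i j| ≤ n^2 * ε * ‖w‖^2 := by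
  refine (Finset.abs_sum_le_sum_abs _ _).trans ?_
  refine (Finset.sum_le_card_nsmul _ _ (n * (ε * ‖w‖^2)) fun i _ => ?_).trans (le_of_eq (by simp; ring))
  refine (Finset.abs_sum_le_sum_abs _ _).trans ?_
  refine (Finset.sum_le_card_nsmul _ _ (ε * ‖w‖^2) fun j _ => ?_).trans (le_of_eq (by simp))
  rw [abs_mul, abs_mul]
  have h1 : |w i| ≤ ‖w‖ := norm_le_pi_norm w i
  have h2 : |w j| ≤ ‖w‖ := norm_le_pi_norm w j
  calc |w i| * |w j| * |A i j| ≤ ‖w‖ * ‖w‖ * ε := by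
        gcongr
        exact h i j
    _ = _ := by ring

lemma bar {R D : Set (Fin n → ℝ)} (hD : IsOpen D) (hRD : R ⊆ D) (hR : Convex ℝ R) {u : (Fin n → ℝ) → (Fin (n+1) → ℝ)}
    (hu : DifferentiableOn ℝ u D) (P : Hm n) {ε₁ e : ℝ} (h1 : ∀ y ∈ R, ∀ i j, |pb (fderiv ℝ u y) i j - pb P i j| ≤ ε₁)
    (h2 : ∀ y ∈ R, ‖fderiv ℝ u y - P‖ ≤ e) {y y' : Fin n → ℝ} (hy : y ∈ R) (hy' : y' ∈ R) :
    |P (y - y') ⬝ᵥ ((u y - P y) - (u y' - P y'))| ≤ n^2 * (ε₁ + (n+1) * e^2) * ‖y - y'‖^2 := by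
  set w := y - y' with hw
  have hder : ∀ τ ∈ Set.Icc (0:ℝ) 1, HasDerivWithinAt (fun τ : ℝ => dotL (n+1) (P w) (u (y' + τ • w) - P (y' + τ • w)))
      (dotL (n+1) (P w) (fderiv ℝ u (y' + τ • w) w - P w)) (Set.Icc 0 1) τ := by
    intro τ hτ
    have hm : y' + τ • w ∈ R := by
      have := hR.add_smul_sub_mem hy' hy hτ
      exact this
    have hl : HasDerivAt (fun τ : ℝ => y' + τ • w) w τ := by
      have := ((hasDerivAt_id τ).smul_const w).const_add y'
      simpa using this
    have hu1 := ((hu.differentiableAt (hD.mem_nhds (hRD hm))).hasFDerivAt.sub (P.hasFDerivAt)).comp_hasDerivAt τ hl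
    have := ((dotL (n+1) (P w)).hasFDerivAt.comp_hasDerivAt τ hu1).hasDerivWithinAt (s := Set.Icc 0 1)
    exact this
  have := norm_image_sub_le_of_norm_deriv_le_segment_01' (C := n^2 * (ε₁ + (n+1) * e^2) * ‖w‖^2) hder (fun τ hτ => ?_)
  · simp only [one_smul, zero_smul, add_zero] at this
    have e1 : y' + w = y := by rw [hw]; abel
    rw [e1, ← map_sub, dotL_apply] at this
    exact this
  · have hm : y' + τ • w ∈ R := hR.add_smul_sub_mem hy' hy ⟨hτ.1, hτ.2.le⟩
    set L := fderiv ℝ u (y' + τ • w) with hL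
    have e1 : dotL (n+1) (P w) (L w - P w) = (1/2) * ((L w ⬝ᵥ L w - P w ⬝ᵥ P w) - (L - P) w ⬝ᵥ (L - P) w) := by
      rw [dotL_apply, _root_.sub_apply]
      simp only [dotProduct_sub, sub_dotProduct]
      rw [dotProduct_comm (L w) (P w)]; ring
    rw [e1, pb_quad, pb_quad, pb_quad]
    have e2 : ∑ i, ∑ j, w i * w j * pb L i j - ∑ i, ∑ j, w i * w j * pb P i j = ∑ i, ∑ j, w i * w j * (pb L i j - pb P i j) := by
      simp only [mul_sub, Finset.sum_sub_distrib]
    rw [e2, Real.norm_eq_abs, abs_mul]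
    have h3 := quad_le (fun i j => pb L i j - pb P i j) w ε₁ (h1 _ hm)
    have h4 := quad_le (pb (L - P)) w ((n+1) * e^2) (fun i j => (pb_abs_le _ i j).trans (by
      have := h2 _ hm
      gcongr))
    have h5 := abs_sub (∑ i, ∑ j, w i * w j * (pb L i j - pb P i j)) (∑ i, ∑ j, w i * w j * pb (L - P) i j)
    have h6 : |(1/2:ℝ)| = 1/2 := abs_of_pos (by norm_num)
    rw [h6]
    have h7 := abs_nonneg (∑ i, ∑ j, w i * w j * (pb L i j - pb P i j))
    have h8 := abs_nonneg (∑ i, ∑ j, w i * w j * pb (L - P) i j)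
    nlinarith

end korn
end CI

namespace CI
open scoped ContDiff
section kornmoll
variable {n : ℕ}

lemma korn_moll {D D' : Set (Fin n → ℝ)} {u : (Fin n → ℝ) → (Fin (n+1) → ℝ)} {μ B l : ℝ} (h : MD D D' u μ B l)
    (hDb : Bornology.IsBounded D) {R : Set (Fin n → ℝ)} (hRD : R ⊆ D) (hR : Convex ℝ R) (P : Hm n) {ε₁ e : ℝ} (hε : 0 ≤ ε₁)
    (h1 : ∀ y ∈ R, ∀ i j, |pb (fderiv ℝ u y) i j - pb P i j| ≤ ε₁)
    (h2 : ∀ y ∈ R, ‖fderiv ℝ u y - P‖ ≤ e) {p : Fin n → ℝ} (hpR : Metric.closedBall p l ⊆ R) {Dm : ℝ} (hDm0 : 0 ≤ Dm)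
    (hDm : ∀ y ∈ R, ‖y - p‖ ≤ Dm * l) :
    ∃ Ω : Fin n → Fin n → ℝ, (∀ i j, |Ω i j + Ω j i| ≤ 3 * (n^2 * (ε₁ + (n+1) * e^2))) ∧
      ∀ q ∈ D', Metric.closedBall q l ⊆ R → ∀ i j,
        |P (Pi.single i 1) ⬝ᵥ (fderiv ℝ (moll D l u) q (Pi.single j 1) - P (Pi.single j 1)) - Ω i j| ≤
          kc n 1 * ((Dm^2 + 1 + (Dm+1)^2 + 3 * n * Dm) * (n^2 * (ε₁ + (n+1) * e^2))) := by
  have hl := h.hl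
  have hud : DifferentiableOn ℝ u D := h.hu.differentiableOn (by norm_num)
  set ε := (n:ℝ)^2 * (ε₁ + (n+1) * e^2) with hεd
  have hε0 : 0 ≤ ε := by positivity
  set V : (Fin n → ℝ) → (Fin n → ℝ) := fun y i => P (Pi.single i 1) ⬝ᵥ (u y - P y) with hV
  have hVd : ∀ (w : Fin n → ℝ) y y', w ⬝ᵥ (V y - V y') = P w ⬝ᵥ ((u y - P y) - (u y' - P y')) := by
    intro w y y'
    have e : P w = ∑ i, w i • P (Pi.single i 1) := by
      conv_lhs => rw [vec_sum w]
      rw [map_sum]; simp only [map_smul]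
    rw [e, sum_dotProduct]
    unfold dotProduct
    refine Finset.sum_congr rfl fun i _ => ?_
    simp only [hV, Pi.sub_apply]
    rw [← dotProduct_sub]
    change _ = (w i • P (Pi.single i 1)) ⬝ᵥ _
    rw [smul_dotProduct, smul_eq_mul]; rfl
  obtain ⟨Ω, hΩ1, hΩ2⟩ := korn_pt V R p l Dm ε hl hε0 hDm0 (hpR (by simp [hl.le])) (fun k => hpR (by
      rw [mem_closedBall_iff_norm]
      have := norm_single_le k
      have e : p + l • (Pi.single k 1 : Fin n → ℝ) - p = l • (Pi.single k 1 : Fin n → ℝ) := by abel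
      rw [e, norm_smul, Real.norm_of_nonneg hl.le]
      nlinarith)) hDm (fun y hy y' hy' => by
        rw [hVd]
        exact bar h.hD hRD hR hud P h1 h2 hy hy')
  refine ⟨Ω, hΩ1, fun q hq hqR i j => ?_⟩
  set ℓ : (Fin (n+1) → ℝ) →L[ℝ] ℝ := dotL (n+1) (P (Pi.single i 1)) with hℓ
  set om : (Fin n → ℝ) →L[ℝ] ℝ := ∑ j, Ω i j • ContinuousLinearMap.proj (R := ℝ) (φ := fun _ : Fin n => ℝ) j with hom
  set f : (Fin n → ℝ) → ℝ := fun y => ℓ (u y) - (ℓ.comp P + om) y - (V p i - om p) with hf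
  have hfV : ∀ y, f y = V y i - V p i - ∑ j, Ω i j * (y j - p j) := by
    intro y
    simp only [hf, hV, hℓ, hom, dotL_apply, _root_.add_apply, _root_.sum_apply, _root_.smul_apply,
      ContinuousLinearMap.comp_apply, ContinuousLinearMap.proj_apply, smul_eq_mul, mul_sub, Finset.sum_sub_distrib, dotProduct_sub]
    ring
  have hfd : ∀ y ∈ D, HasFDerivAt f (ℓ.comp (fderiv ℝ u y) - (ℓ.comp P + om)) y := by
    intro y hy
    have h3 := (hud.differentiableAt (h.hD.mem_nhds hy)).hasFDerivAt
    exact ((ℓ.hasFDerivAt.comp y h3).sub (ℓ.comp P + om).hasFDerivAt).sub_const _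
  have hfc : ContDiffOn ℝ 1 f D := by
    have h3 : ContDiffOn ℝ 1 u D := h.hu.of_le (by norm_num)
    exact ((ℓ.contDiff.comp_contDiffOn h3).sub (ℓ.comp P + om).contDiff.contDiffOn).sub contDiffOn_const
  obtain ⟨B0, hB0⟩ := h.hu0
  obtain ⟨Rd, hRd⟩ := hDb.subset_closedBall (0 : Fin n → ℝ)
  set Bf := max (‖ℓ‖ * B0 + ‖ℓ.comp P + om‖ * Rd + ‖V p i - om p‖) (‖ℓ‖ * B + ‖ℓ.comp P + om‖) with hBf
  have hfb : ∀ y ∈ D, ‖f y‖ ≤ Bf := by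
    intro y hy
    refine le_trans ?_ (le_max_left _ _)
    have h3 := hRd hy
    rw [mem_closedBall_zero_iff] at h3
    refine (norm_sub_le _ _).trans (add_le_add_left ((norm_sub_le _ _).trans (add_le_add ?_ ?_)) _)
    · exact (ℓ.le_opNorm _).trans (by gcongr; exact hB0 y hy)
    · exact ((ℓ.comp P + om).le_opNorm _).trans (by gcongr)
  have hfb' : ∀ y ∈ D, ‖fderiv ℝ f y‖ ≤ Bf := by
    intro y hy
    refine le_trans ?_ (le_max_right _ _)
    rw [(hfd y hy).fderiv]
    refine (norm_sub_le _ _).trans (add_le_add_left ((ContinuousLinearMap.opNorm_comp_le _ _).trans ?_) _)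
    gcongr
    exact h.hu1 y hy
  have h5 := moll_deriv0 h.hD hl hfc.continuousOn hfb 1 q ((Dm^2 + 1 + (Dm+1)^2 + 3 * n * Dm) * ε * l) (by positivity)
    (fun z hz _ => by
      rw [hfV, Real.norm_eq_abs]
      exact hΩ2 z (hqR hz) i)
  rw [norm_iteratedFDeriv_one, pow_one] at h5
  have h6 := (clm_single_le (fderiv ℝ (moll D l f) q) j).trans h5
  have hqD : Metric.closedBall q l ⊆ D := h.hDD q hq
  have h7 : fderiv ℝ (moll D l f) q (Pi.single j 1) =
      P (Pi.single i 1) ⬝ᵥ (fderiv ℝ (moll D l u) q (Pi.single j 1) - P (Pi.single j 1)) - Ω i j := by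
    rw [(moll_fderiv h.hD h.hD' hl hfc hfb hfb' h.hDD hq).fderiv]
    have hc1 : ContinuousOn (fderiv ℝ f) D := hfc.continuousOn_fderiv_of_isOpen h.hD (by norm_num)
    have e1 := moll_clm (l := l) h.hD hc1 hfb' (ContinuousLinearMap.apply ℝ ℝ (Pi.single j 1 : Fin n → ℝ)) q
    simp only [ContinuousLinearMap.apply_apply] at e1
    rw [← e1]
    have e2 : moll D l (fun y => fderiv ℝ f y (Pi.single j 1)) q =
        moll D l (fun y => (ℓ.comp (evb j)) (fderiv ℝ u y) - (ℓ.comp P + om) (Pi.single j 1)) q := by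
      refine moll_congr (fun y hy => ?_) q
      simp only [(hfd y hy).fderiv]
      rfl
    have hcu : ∀ y ∈ D, ‖(ℓ.comp (evb j)) (fderiv ℝ u y)‖ ≤ ‖ℓ.comp (evb j)‖ * B := fun y hy =>
      ((ℓ.comp (evb j)).le_opNorm _).trans (by gcongr; exact h.hu1 y hy)
    rw [e2, moll_sub_const (f := fun y => (ℓ.comp (evb j)) (fderiv ℝ u y)) h.hD hl ((ℓ.comp (evb j)).continuous.comp_continuousOn h.cont1) hcu hqD,
      moll_clm h.hD h.cont1 h.hu1, ← h.fd hq]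
    simp only [hℓ, hom, dotL_apply, _root_.add_apply, _root_.sum_apply, _root_.smul_apply,
      ContinuousLinearMap.comp_apply, ContinuousLinearMap.proj_apply, smul_eq_mul, dotProduct_sub, evb_apply]
    simp [Pi.single_apply]
    ring
  rw [h7, Real.norm_eq_abs] at h6
  refine h6.trans (le_of_eq ?_)
  field_simp

end kornmoll
end CI

namespace CI
open scoped ContDiff
section ext
variable {n : ℕ}

lemma osc_le {Θ τ M' ρ β d : ℝ} (hΘ : 0 ≤ Θ) (hτ : 0 ≤ τ) (hM : 1 ≤ M') (hρ : 0 ≤ ρ) (hτρ : τ ≤ M' * ρ) (hβ : 0 < β) (hβ1 : β < 1)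
    (h : Θ * ρ^β ≤ d) : Θ * τ^β ≤ M' * d := by
  have h1 : τ^β ≤ M' * ρ^β := by
    refine (Real.rpow_le_rpow hτ hτρ hβ.le).trans ?_
    rw [Real.mul_rpow (by linarith) hρ]
    have : M'^β ≤ M' := by
      calc M'^β ≤ M'^(1:ℝ) := Real.rpow_le_rpow_of_exponent_le hM hβ1.le
        _ = M' := Real.rpow_one _
    gcongr
  calc Θ * τ^β ≤ Θ * (M' * ρ^β) := by gcongr
    _ = M' * (Θ * ρ^β) := by ring
    _ ≤ _ := by gcongr

variable {U : Set (Fin n → ℝ)} {η : (Fin n → ℝ) → (Fin n → ℝ)} {M t₀ c R : ℝ}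

lemma Geo.seg (G : Geo U η M t₀ c R) {x : Fin n → ℝ} (hx : x ∈ U) {τ : ℝ} (h0 : 0 ≤ τ) (h1 : τ ≤ t₀) :
    segment ℝ x (x + τ • η x) ⊆ U := by
  intro y hy
  rw [segment_eq_image'] at hy
  obtain ⟨θ, hθ, rfl⟩ := hy
  have e : x + θ • (x + τ • η x - x) = x + (θ * τ) • η x := by
    rw [add_sub_cancel_left, smul_smul]
  simp only [e]
  rcases eq_or_lt_of_le (mul_nonneg hθ.1 h0) with h | h
  · rw [← h, zero_smul, add_zero]; exact hx
  · have hc := G.hc0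
    exact G.inn (θ * τ) h (by nlinarith [hθ.2]) x (Metric.self_subset_thickening (by positivity) _ hx)
      (Metric.mem_ball_self (by positivity))

lemma Geo.UR (G : Geo U η M t₀ c R) {x : Fin n → ℝ} (hx : x ∈ U) : x ∈ Metric.ball (0 : Fin n → ℝ) R :=
  G.hR (Metric.self_subset_thickening one_pos _ hx)

/-- local quasiconvexity -/
lemma Geo.quasi (G : Geo U η M t₀ c R) (hUo : IsOpen U) {u : (Fin n → ℝ) → (Fin (n+1) → ℝ)} {μ : ℝ}
    (hu : ContDiffOn ℝ 2 u U) (hμ : ∀ x ∈ U, ‖fderiv ℝ (fderiv ℝ u) x‖ ≤ μ) {x y : Fin n → ℝ} (hx : x ∈ U) (hy : y ∈ U)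
    (hxy : ‖x - y‖ ≤ c * t₀ / (3 * M)) : ‖fderiv ℝ u x - fderiv ℝ u y‖ ≤ (6 * M / c + 2) * μ * ‖x - y‖ := by
  have hμ0 : 0 ≤ μ := (norm_nonneg (fderiv ℝ (fderiv ℝ u) x)).trans (hμ x hx)
  rcases eq_or_ne x y with rfl | hne
  · simp
  have hd : 0 < ‖x - y‖ := norm_pos_iff.2 (sub_ne_zero.2 hne)
  have hM := G.hM
  have hc := G.hc0
  have ht0 := G.ht0
  have ht1 := G.ht1
  set τ := 3 * ‖x - y‖ / c with hτ
  have hτ0 : 0 < τ := by positivity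
  have hτM : τ * M ≤ t₀ := by
    rw [le_div_iff₀ (by positivity)] at hxy
    rw [hτ, div_mul_eq_mul_div, div_le_iff₀ hc]
    linarith
  have hτt : τ ≤ t₀ := by nlinarith
  have h1 : ∀ z ∈ U, ‖fderiv ℝ u (z + τ • η z) - fderiv ℝ u z‖ ≤ μ * (τ * M) := by
    intro z hz
    refine (fderiv_lip hUo hu hμ (convex_segment z (z + τ • η z)) (G.seg hz hτ0.le hτt) (left_mem_segment _ _ _)
      (right_mem_segment _ _ _)).trans ?_
    rw [add_sub_cancel_left, norm_smul, Real.norm_of_nonneg hτ0.le]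
    gcongr
    exact G.b0 z (G.UR hz)
  have h2 : ‖(x + τ • η x) - (y + τ • η y)‖ ≤ 2 * ‖x - y‖ := by
    have e : (x + τ • η x) - (y + τ • η y) = (x - y) + τ • (η x - η y) := by rw [smul_sub]; abel
    rw [e]
    refine (norm_add_le _ _).trans ?_
    rw [norm_smul, Real.norm_of_nonneg hτ0.le]
    have h3 := G.l0 x (G.UR hx) y (G.UR hy)
    have : τ * ‖η x - η y‖ ≤ τ * (M * ‖x - y‖) := by gcongr
    nlinarith
  have hcτ : c * τ = 3 * ‖x - y‖ := by rw [hτ]; field_simp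
  have h3 := fderiv_lip hUo hu hμ (convex_ball (y + τ • η y) (c * τ))
    (G.inn τ hτ0 hτt y (Metric.self_subset_thickening (by positivity) _ hy))
    (Metric.mem_ball_self (by positivity)) (y := x + τ • η x) (by rw [mem_ball_iff_norm]; linarith)
  have h4 : ‖fderiv ℝ u (x + τ • η x) - fderiv ℝ u (y + τ • η y)‖ ≤ μ * (2 * ‖x - y‖) := h3.trans (by gcongr)
  have h5 := h1 x hx
  have h6 := h1 y hy
  rw [norm_sub_rev] at h5
  have e : fderiv ℝ u x - fderiv ℝ u y = (fderiv ℝ u x - fderiv ℝ u (x + τ • η x)) +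
    (fderiv ℝ u (x + τ • η x) - fderiv ℝ u (y + τ • η y)) + (fderiv ℝ u (y + τ • η y) - fderiv ℝ u y) := by abel
  rw [e]
  refine norm_add₃_le.trans ?_
  have e2 : (6 * M / c + 2) * μ * ‖x - y‖ = μ * (τ * M) + μ * (2 * ‖x - y‖) + μ * (τ * M) := by
    rw [hτ]; field_simp; ring
  rw [e2]
  linarith

/-- pointwise estimate of the pullback of the reflected gradient -/
lemma ext_point {P A C X : Hm n} {N : (Fin n → ℝ) →L[ℝ] (Fin n → ℝ)} {s M δ Kε k₁ : ℝ} (hM : 1 ≤ M) (hs : 0 ≤ s) (hs1 : 2 * s ≤ 1)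
    (hK : 0 ≤ Kε) (hk : 0 ≤ k₁) (hδ : 0 ≤ δ)
    (hX : X = (2:ℝ) • A - C - P + (2 * s) • (A - C).comp N) (hN : ‖N‖ ≤ M)
    (hA : ‖A - P‖ ≤ 2 * δ) (hC : ‖C - P‖ ≤ 4 * M * δ) (Ω : Fin n → Fin n → ℝ) (hΩ : ∀ i j, |Ω i j + Ω j i| ≤ 3 * (Kε * δ^2))
    (h1 : ∀ i j, |P (Pi.single i 1) ⬝ᵥ (A (Pi.single j 1) - P (Pi.single j 1)) - Ω i j| ≤ k₁ * (Kε * δ^2))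
    (h2 : ∀ i j, |P (Pi.single i 1) ⬝ᵥ (C (Pi.single j 1) - P (Pi.single j 1)) - Ω i j| ≤ k₁ * (Kε * δ^2)) :
    ‖X‖ ≤ 14 * M^2 * δ ∧ ∀ i j, |pb (P + X) i j - pb P i j| ≤
      (3 * (3 + 2 * k₁) * Kε + 4 * n * M * k₁ * Kε + (n+1) * (14 * M^2)^2) * δ^2 := by
  have hXn : ‖X‖ ≤ 14 * M^2 * δ := by
    have e : X = (2:ℝ) • (A - P) - (C - P) + (2*s) • (A - C).comp N := by
      rw [hX, smul_sub, two_smul ℝ P]; abel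
    have hAC : ‖A - C‖ ≤ 6 * M * δ := by
      have e2 : A - C = (A - P) - (C - P) := by abel
      rw [e2]
      refine (norm_sub_le _ _).trans ?_
      nlinarith
    rw [e]
    refine (norm_add_le _ _).trans ?_
    have a1 := norm_sub_le ((2:ℝ) • (A - P)) (C - P)
    rw [norm_smul] at a1 ⊢
    have a2 := ContinuousLinearMap.opNorm_comp_le (A - C) N
    have a3 : ‖A - C‖ * ‖N‖ ≤ 6 * M * δ * M := by gcongr
    rw [Real.norm_of_nonneg (by positivity : 0 ≤ 2 * s)]
    have a4 : 2 * s * ‖(A - C).comp N‖ ≤ 1 * (6 * M * δ * M) := by gcongr; linarith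
    have a5 : ‖(2:ℝ)‖ = 2 := by norm_num
    rw [a5] at a1
    have a6 : M * δ ≤ M^2 * δ := by gcongr; nlinarith
    have a7 : δ ≤ M * δ := by nlinarith
    nlinarith
  refine ⟨hXn, fun i j => ?_⟩
  have hPX : ∀ i j, |P (Pi.single i 1) ⬝ᵥ X (Pi.single j 1) -
      (2 * (P (Pi.single i 1) ⬝ᵥ (A (Pi.single j 1) - P (Pi.single j 1))) -
        P (Pi.single i 1) ⬝ᵥ (C (Pi.single j 1) - P (Pi.single j 1)))| ≤ 2 * n * M * k₁ * Kε * δ^2 := by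
    intro i j
    set w := N (Pi.single j 1) with hw
    have hwM : ‖w‖ ≤ M := (clm_single_le N j).trans hN
    have e : P (Pi.single i 1) ⬝ᵥ X (Pi.single j 1) -
      (2 * (P (Pi.single i 1) ⬝ᵥ (A (Pi.single j 1) - P (Pi.single j 1))) -
        P (Pi.single i 1) ⬝ᵥ (C (Pi.single j 1) - P (Pi.single j 1))) = 2 * s * (P (Pi.single i 1) ⬝ᵥ (A - C) w) := by
      rw [hX]
      simp only [_root_.add_apply, _root_.sub_apply, _root_.smul_apply, ContinuousLinearMap.comp_apply, dotProduct_add, dotProduct_sub,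
        dotProduct_smul, smul_eq_mul]
      ring
    have e2 : P (Pi.single i 1) ⬝ᵥ (A - C) w = ∑ k, w k * (P (Pi.single i 1) ⬝ᵥ (A - C) (Pi.single k 1)) := by
      conv_lhs => rw [vec_sum w]
      rw [map_sum, dotProduct_sum]
      refine Finset.sum_congr rfl fun k _ => ?_
      rw [map_smul, dotProduct_smul, smul_eq_mul]
    have hAC : ∀ k, |P (Pi.single i 1) ⬝ᵥ (A - C) (Pi.single k 1)| ≤ 2 * (k₁ * (Kε * δ^2)) := by
      intro k
      have a1 := h1 i k
      have a2 := h2 i k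
      simp only [_root_.sub_apply, dotProduct_sub] at *
      rw [abs_le] at *
      constructor <;> linarith [a1.1, a1.2, a2.1, a2.2]
    have h3 : |P (Pi.single i 1) ⬝ᵥ (A - C) w| ≤ n * (M * (2 * (k₁ * (Kε * δ^2)))) := by
      rw [e2]
      refine (Finset.abs_sum_le_sum_abs _ _).trans ?_
      refine (Finset.sum_le_card_nsmul _ _ (M * (2 * (k₁ * (Kε * δ^2)))) fun k _ => ?_).trans (by simp)
      rw [abs_mul]
      have : |w k| ≤ ‖w‖ := norm_le_pi_norm w k
      exact mul_le_mul (this.trans hwM) (hAC k) (abs_nonneg _) (by linarith)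
    rw [e, abs_mul, abs_of_nonneg (by positivity : 0 ≤ 2 * s)]
    calc 2 * s * |P (Pi.single i 1) ⬝ᵥ (A - C) w| ≤ 1 * (n * (M * (2 * (k₁ * (Kε * δ^2))))) := by gcongr
      _ = _ := by ring
  have hpX : |pb X i j| ≤ (n+1) * (14 * M^2)^2 * δ^2 := by
    refine (pb_abs_le X i j).trans ?_
    calc ((n:ℝ)+1) * ‖X‖^2 ≤ (n+1) * (14 * M^2 * δ)^2 := by gcongr
      _ = _ := by ring
  rw [pb_add]
  have b1 := hPX i j
  have b2 := hPX j i
  have b3 := h1 i j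
  have b4 := h1 j i
  have b5 := h2 i j
  have b6 := h2 j i
  have b7 := hΩ i j
  clear hPX h1 h2 hΩ
  generalize P (Pi.single i 1) ⬝ᵥ X (Pi.single j 1) = x1 at *
  generalize P (Pi.single j 1) ⬝ᵥ X (Pi.single i 1) = x2 at *
  generalize P (Pi.single i 1) ⬝ᵥ (A (Pi.single j 1) - P (Pi.single j 1)) = x3 at *
  generalize P (Pi.single j 1) ⬝ᵥ (A (Pi.single i 1) - P (Pi.single i 1)) = x4 at *
  generalize P (Pi.single i 1) ⬝ᵥ (C (Pi.single j 1) - P (Pi.single j 1)) = x5 at *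
  generalize P (Pi.single j 1) ⬝ᵥ (C (Pi.single i 1) - P (Pi.single i 1)) = x6 at *
  rw [abs_le] at *
  constructor <;> linarith [b1.1, b1.2, b2.1, b2.2, b3.1, b3.2, b4.1, b4.2, b5.1, b5.2, b6.1, b6.2, b7.1, b7.2, hpX.1, hpX.2]

end ext
end CI

namespace CI
open scoped ContDiff
section ext2
variable {n : ℕ} {U : Set (Fin n → ℝ)} {η : (Fin n → ℝ) → (Fin n → ℝ)} {M t₀ c R : ℝ}

lemma refl_fderiv {f : (Fin n → ℝ) → (Fin (n+1) → ℝ)} (hf : ContDiff ℝ ∞ f) (hη : ContDiff ℝ ∞ η) (s : ℝ) (y : Fin n → ℝ) :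
    fderiv ℝ (fun x => (2:ℝ) • f (x + s • η x) - f (x + (2 * s) • η x)) y =
      (2:ℝ) • fderiv ℝ f (y + s • η y) - fderiv ℝ f (y + (2*s) • η y) +
        (2 * s) • (fderiv ℝ f (y + s • η y) - fderiv ℝ f (y + (2*s) • η y)).comp (fderiv ℝ η y) := by
  have hd : ∀ t : ℝ, HasFDerivAt (fun x => x + t • η x) (ContinuousLinearMap.id ℝ _ + t • fderiv ℝ η y) y := fun t =>
    (hasFDerivAt_id y).add ((hη.differentiable (by simp)).differentiableAt.hasFDerivAt.const_smul t)
  have hF : ∀ z, HasFDerivAt f (fderiv ℝ f z) z := fun z => (hf.differentiable (by simp)).differentiableAt.hasFDerivAt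
  have h1 := (hF (y + s • η y)).comp y (hd s)
  have h2 := (hF (y + (2*s) • η y)).comp y (hd (2*s))
  have h3 := (h1.const_smul (2:ℝ)).sub h2
  refine HasFDerivAt.fderiv (h3.congr_fderiv ?_)
  ext v k
  simp
  ring

set_option maxHeartbeats 1600000 in
lemma extend (G : Geo U η M t₀ c R) (hUo : IsOpen U) (hUb : Bornology.IsBounded U) (β : ℝ) (hβ : 0 < β) (hβ1 : β < 1) :
    ∃ K ≥ (1:ℝ), ∃ a > (0:ℝ), ∀ (u : (Fin n → ℝ) → (Fin (n+1) → ℝ)) (g : (Fin n → ℝ) → Matrix (Fin n) (Fin n) ℝ) (B δ μ Θ : ℝ),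
      0 < δ → δ ≤ μ → 0 ≤ Θ → Θ * (δ/μ)^β ≤ δ^2 → ContDiffOn ℝ 2 u U → (∃ B0, ∀ x ∈ U, ‖u x‖ ≤ B0) →
      (∀ x ∈ U, ‖fderiv ℝ u x‖ ≤ B) → (∀ x ∈ U, ‖fderiv ℝ (fderiv ℝ u) x‖ ≤ μ) →
      (∀ x ∈ U, ∀ i j, |pb (fderiv ℝ u x) i j - g x i j| ≤ δ^2) →
      (∀ x y i j, |g x i j - g y i j| ≤ Θ * ‖x - y‖^β) →
      ∃ v : (Fin n → ℝ) → (Fin (n+1) → ℝ), ContDiff ℝ ∞ v ∧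
        (∀ x ∈ Metric.thickening (a * (δ/μ)) U, ‖fderiv ℝ (fderiv ℝ v) x‖ ≤ K * μ) ∧
        (∀ x ∈ Metric.thickening (a * (δ/μ)) U, ∀ i j, |pb (fderiv ℝ v x) i j - g x i j| ≤ K * δ^2) ∧
        (∀ x ∈ U, ‖fderiv ℝ v x - fderiv ℝ u x‖ ≤ K * δ) := by
  have hM := G.hM
  have hc := G.hc0
  have hc1 := G.hc1
  have ht0 := G.ht0
  have ht1 := G.ht1
  set k := kcm n 1 * 2 with hk
  have hk1 : 1 ≤ k := by have := one_le_kcm (n := n) 1; linarith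
  set L := k * (2 * M) with hL
  set Dm := (c + M) * 4 / c with hDm
  have hDm0 : 0 ≤ Dm := by positivity
  set k₁ := kc n 1 * (Dm^2 + 1 + (Dm+1)^2 + 3 * n * Dm) with hk₁
  have hk₁0 : 0 ≤ k₁ := mul_nonneg (kc_nonneg 1) (by positivity)
  set Kε := (n:ℝ)^2 * (2 + 2 * M + (n+1) * (2 * M)^2) with hKε
  have hKε0 : 0 ≤ Kε := by positivity
  set K3 := 3 * (3 + 2 * k₁) * Kε + 4 * n * M * k₁ * Kε + (n+1) * (14 * M^2)^2 with hK3
  have hK30 : 0 ≤ K3 := by positivity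
  set K2 := 3 * L + 2 * L * M + k * M^2 with hK2
  have hL0 : 0 < L := by positivity
  have hK20 : 0 ≤ K2 := by positivity
  refine ⟨1 + K2 + K3 + (1 + M) + (14 * M^2 + M), by have hM9 : 0 ≤ M^2 := sq_nonneg M; linarith, c * (t₀ / 2) / 4, by positivity, ?_⟩
  intro u g B δ μ Θ hδ hδμ hΘ hΘδ hu hu0 hu1 hu2 hg hgh
  have hμ : 0 < μ := by linarith
  have hρ : 0 < δ/μ := by positivity
  have hρ1 : δ/μ ≤ 1 := (div_le_one hμ).2 hδμ
  set s := t₀ / 2 * (δ / μ) with hs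
  have hs0 : 0 < s := by positivity
  have hst : 2 * s ≤ t₀ := by
    have h1 := mul_le_of_le_one_right ht0.le hρ1
    have h2 : 2 * s = t₀ * (δ/μ) := by rw [hs]; ring
    linarith
  have hs1 : 2 * s ≤ 1 := by linarith
  have hsρ : s ≤ δ/μ := by
    rw [hs]; exact mul_le_of_le_one_left hρ.le (by linarith)
  have hμs : μ * s ≤ δ := by
    have : μ * (δ/μ) = δ := by field_simp
    calc μ * s ≤ μ * (δ/μ) := by gcongr
      _ = δ := this
  set l := c * s / 4 with hl
  have hl0 : 0 < l := by positivity
  have hls : l ≤ s := by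
    have h1 := mul_le_of_le_one_left hs0.le hc1
    rw [hl]; linarith
  have hal : c * (t₀ / 2) / 4 * (δ/μ) = l := by rw [hl, hs]; ring
  rw [hal]
  set T := Metric.thickening l U with hT
  have hTo : IsOpen T := Metric.isOpen_thickening
  set D' : Set (Fin n → ℝ) := ⋃ x ∈ T, ⋃ t ∈ Set.Icc s (2*s), Metric.ball (x + t • η x) l with hD'
  have hTR : ∀ x ∈ T, x ∈ Metric.ball (0 : Fin n → ℝ) R := fun x hx =>
    G.hR (Metric.thickening_mono (by linarith) _ hx)
  have hTin : ∀ x ∈ T, ∀ t ∈ Set.Icc s (2*s), Metric.ball (x + t • η x) (c * s) ⊆ U := by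
    intro x hx t ht
    have ht0' : 0 < t := lt_of_lt_of_le hs0 ht.1
    have hcs : c * s ≤ c * t := by have := ht.1; gcongr
    have hlc : l ≤ c * t := by
      have : l ≤ c * s := by rw [hl]; linarith [mul_pos hc hs0]
      linarith
    exact (Metric.ball_subset_ball hcs).trans (G.inn t ht0' (ht.2.trans hst) x (Metric.thickening_mono hlc _ hx))
  have hmd : MD U D' u μ B l := by
    refine ⟨hUo, ?_, hl0, ?_, hu, hu0, hu1, hu2⟩
    · exact isOpen_biUnion fun x _ => isOpen_biUnion fun t _ => Metric.isOpen_ball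
    · intro y hy z hz
      simp only [hD', Set.mem_iUnion] at hy
      obtain ⟨x, hx, t, ht, hy⟩ := hy
      refine hTin x hx t ht ?_
      rw [Metric.mem_ball] at hy ⊢
      rw [Metric.mem_closedBall] at hz
      have := dist_triangle z y (x + t • η x)
      have : l + l < c * s := by rw [hl]; linarith [mul_pos hc hs0]
      linarith
  set f := moll U l u with hf
  have hfs : ContDiff ℝ ∞ f := hmd.smooth
  set v : (Fin n → ℝ) → (Fin (n+1) → ℝ) := fun x => (2:ℝ) • f (x + s • η x) - f (x + (2 * s) • η x) with hv
  have hηs := G.hη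
  have hvs : ContDiff ℝ ∞ v := by
    refine ((hfs.comp (contDiff_id.add (hηs.const_smul s))).const_smul (2:ℝ)).sub (hfs.comp (contDiff_id.add (hηs.const_smul (2*s))))
  have hfd := refl_fderiv hfs hηs s
  have hbD : ∀ x ∈ T, ∀ t ∈ Set.Icc s (2*s), Metric.ball (x + t • η x) l ⊆ D' := by
    intro x hx t ht z hz
    simp only [hD', Set.mem_iUnion]
    exact ⟨x, hx, t, ht, hz⟩
  have hsI : s ∈ Set.Icc s (2*s) := ⟨le_rfl, by linarith⟩
  have h2sI : 2 * s ∈ Set.Icc s (2*s) := ⟨by linarith, le_rfl⟩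
  have hf2 : ContDiffOn ℝ 2 f D' := (hfs.of_le (by norm_cast)).contDiffOn
  have hf2b : ∀ x ∈ D', ‖fderiv ℝ (fderiv ℝ f) x‖ ≤ k * μ := fun x hx => hmd.d2 hx
  -- segments
  have hsegt : ∀ x : Fin n → ℝ, ∀ y ∈ segment ℝ (x + s • η x) (x + (2 * s) • η x), ∃ t ∈ Set.Icc s (2*s), y = x + t • η x := by
    intro x y hy
    rw [segment_eq_image'] at hy
    obtain ⟨θ, hθ, rfl⟩ := hy
    refine ⟨s + θ * s, ⟨by linarith [mul_nonneg hθ.1 hs0.le], by linarith [mul_le_of_le_one_left hs0.le hθ.2]⟩, ?_⟩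
    have e : x + (2 * s) • η x - (x + s • η x) = s • η x := by rw [two_mul, add_smul]; abel
    simp only [e]
    rw [add_smul, smul_smul, add_assoc]
  have hpq : ∀ x ∈ T, ‖(x + (2 * s) • η x) - (x + s • η x)‖ ≤ s * M := by
    intro x hx
    have e : x + (2 * s) • η x - (x + s • η x) = s • η x := by rw [two_mul, add_smul]; abel
    rw [e, norm_smul, Real.norm_of_nonneg hs0.le]
    gcongr
    exact G.b0 x (hTR x hx)
  have hB : ∀ x ∈ T, ‖fderiv ℝ f (x + s • η x) - fderiv ℝ f (x + (2*s) • η x)‖ ≤ k * μ * (s * M) := by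
    intro x hx
    have := fderiv_lip hmd.hD' hf2 hf2b (convex_segment (x + s • η x) (x + (2 * s) • η x)) (fun y hy => by
      obtain ⟨t, ht, rfl⟩ := hsegt x y hy
      exact hbD x hx t ht (Metric.mem_ball_self hl0)) (left_mem_segment _ _ _) (right_mem_segment _ _ _)
    rw [norm_sub_rev]
    exact this.trans (by gcongr; exact hpq x hx)
  refine ⟨v, hvs, ?_, ?_⟩
  · intro x hx
    have hvd : HasFDerivAt (fderiv ℝ v) (fderiv ℝ (fderiv ℝ v) x) x :=
      ((hvs.fderiv_right (m := ∞) (by norm_cast)).differentiable (by simp)).differentiableAt.hasFDerivAt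
    refine (hvd.le_of_lip' (C := K2 * μ) (by positivity) ?_).trans (by have hM9 : 0 ≤ M^2 := sq_nonneg M; gcongr; linarith)
    have hev : ∀ t : ℝ, ∀ᶠ y in 𝓝 x, y + t • η y ∈ Metric.ball (x + t • η x) l := by
      intro t
      have hcont : Continuous (fun y => y + t • η y) := continuous_id.add (hηs.continuous.const_smul t)
      exact hcont.continuousAt.eventually_mem (Metric.ball_mem_nhds _ hl0)
    filter_upwards [hTo.mem_nhds hx, hev s, hev (2*s)] with y hy hy1 hy2
    have hxR := hTR x hx
    have hyR := hTR y hy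
    have hpl : ∀ t : ℝ, 0 ≤ t → t ≤ 1 → ‖(y + t • η y) - (x + t • η x)‖ ≤ 2 * M * ‖y - x‖ := by
      intro t ht0 ht1
      have e : (y + t • η y) - (x + t • η x) = (y - x) + t • (η y - η x) := by rw [smul_sub]; abel
      rw [e]
      refine (norm_add_le _ _).trans ?_
      rw [norm_smul, Real.norm_of_nonneg ht0]
      have h3 := G.l0 y hyR x hxR
      have h4 : t * ‖η y - η x‖ ≤ 1 * (M * ‖y - x‖) := by gcongr
      linarith [le_mul_of_one_le_left (norm_nonneg (y - x)) hM]
    have hlip : ∀ t ∈ Set.Icc s (2*s), y + t • η y ∈ Metric.ball (x + t • η x) l →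
        ‖fderiv ℝ f (y + t • η y) - fderiv ℝ f (x + t • η x)‖ ≤ L * μ * ‖y - x‖ := by
      intro t ht hyt
      have := fderiv_lip hmd.hD' hf2 hf2b (convex_ball (x + t • η x) l) (hbD x hx t ht) (Metric.mem_ball_self hl0) hyt
      refine this.trans ?_
      calc k * μ * ‖(y + t • η y) - (x + t • η x)‖ ≤ k * μ * (2 * M * ‖y - x‖) := by
            gcongr
            exact hpl t (hs0.le.trans ht.1) (ht.2.trans hs1)
        _ = _ := by rw [hL]; ring
    have g1 := hlip s hsI hy1
    have g2 := hlip (2*s) h2sI hy2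
    have g3 := hB x hx
    have g4 := G.b1 y hyR
    have g5 := G.l1 y hyR x hxR
    rw [hfd y, hfd x]
    clear_value f
    generalize fderiv ℝ f (y + s • η y) = Ay at *
    generalize fderiv ℝ f (y + (2*s) • η y) = Cy at *
    generalize fderiv ℝ f (x + s • η x) = Ax at *
    generalize fderiv ℝ f (x + (2*s) • η x) = Cx at *
    generalize fderiv ℝ η y = Ny at *
    generalize fderiv ℝ η x = Nx at *
    have e : ((2:ℝ) • Ay - Cy + (2 * s) • (Ay - Cy).comp Ny) - ((2:ℝ) • Ax - Cx + (2 * s) • (Ax - Cx).comp Nx) =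
      ((2:ℝ) • (Ay - Ax) - (Cy - Cx)) + (2 * s) • (((Ay - Ax) - (Cy - Cx)).comp Ny + (Ax - Cx).comp (Ny - Nx)) := by
      ext w k
      simp
      ring
    rw [e]
    refine (norm_add_le _ _).trans ?_
    have f1 : ‖(2:ℝ) • (Ay - Ax) - (Cy - Cx)‖ ≤ 3 * (L * μ * ‖y - x‖) := by
      refine (norm_sub_le _ _).trans ?_
      rw [norm_smul, show ‖(2:ℝ)‖ = 2 by norm_num]
      linarith
    have f2 : ‖((Ay - Ax) - (Cy - Cx)).comp Ny‖ ≤ 2 * (L * μ * ‖y - x‖) * M := by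
      refine (ContinuousLinearMap.opNorm_comp_le _ _).trans ?_
      have := norm_sub_le (Ay - Ax) (Cy - Cx)
      gcongr
      linarith
    have f3 : ‖(Ax - Cx).comp (Ny - Nx)‖ ≤ k * μ * (s * M) * (M * ‖y - x‖) := by
      refine (ContinuousLinearMap.opNorm_comp_le _ _).trans ?_
      gcongr
    have f4 : k * μ * (s * M) * (M * ‖y - x‖) ≤ k * μ * (1 * M) * (M * ‖y - x‖) := by
      gcongr; linarith
    have f5 : ‖(2 * s) • (((Ay - Ax) - (Cy - Cx)).comp Ny + (Ax - Cx).comp (Ny - Nx))‖ ≤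
        1 * (2 * (L * μ * ‖y - x‖) * M + k * μ * (1 * M) * (M * ‖y - x‖)) := by
      rw [norm_smul, Real.norm_of_nonneg (by positivity : 0 ≤ 2 * s)]
      have := norm_add_le (((Ay - Ax) - (Cy - Cx)).comp Ny) ((Ax - Cx).comp (Ny - Nx))
      refine mul_le_mul hs1 (by linarith) (norm_nonneg _) zero_le_one
    refine (add_le_add f1 f5).trans (le_of_eq ?_)
    rw [hK2]; ring
  · -- common pointwise estimate
    have main : ∀ x ∈ T, ‖fderiv ℝ v x - fderiv ℝ u (x + s • η x)‖ ≤ 14 * M^2 * δ ∧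
        ∀ i j, |pb (fderiv ℝ v x) i j - pb (fderiv ℝ u (x + s • η x)) i j| ≤ K3 * δ^2 := by
      intro x hx
      set p := x + s • η x with hp
      set q := x + (2*s) • η x with hq
      set P := fderiv ℝ u p with hP
      set Rx := Metric.thickening (c * s) (segment ℝ p q) with hRx
      have hRxU : Rx ⊆ U := by
        intro y hy
        rw [hRx, Metric.mem_thickening_iff] at hy
        obtain ⟨z, hz, hyz⟩ := hy
        obtain ⟨t, ht, rfl⟩ := hsegt x z hz
        exact hTin x hx t ht hyz
      have hRxc : Convex ℝ Rx := (convex_segment p q).thickening _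
      have hcs : 0 < c * s := by positivity
      have hlcs : l < c * s := by rw [hl]; linarith
      have hpD : p ∈ D' := hbD x hx s hsI (Metric.mem_ball_self hl0)
      have hqD : q ∈ D' := hbD x hx (2*s) h2sI (Metric.mem_ball_self hl0)
      have hcb : ∀ z ∈ segment ℝ p q, Metric.closedBall z l ⊆ Rx := by
        intro z hz y hy
        rw [hRx, Metric.mem_thickening_iff]
        exact ⟨z, hz, lt_of_le_of_lt hy hlcs⟩
      have hpS : p ∈ segment ℝ p q := left_mem_segment _ _ _
      have hqS : q ∈ segment ℝ p q := right_mem_segment _ _ _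
      have hpRx : p ∈ Rx := hcb p hpS (by simp [hl0.le])
      have hqRx : q ∈ Rx := hcb q hqS (by simp [hl0.le])
      have hdiam : ∀ y ∈ Rx, ‖y - p‖ ≤ (c + M) * s := by
        intro y hy
        rw [hRx, Metric.mem_thickening_iff] at hy
        obtain ⟨z, hz, hyz⟩ := hy
        rw [dist_eq_norm] at hyz
        have h1 := norm_sub_le_norm_sub_add_norm_sub y z p
        have h2 := norm_sub_le_of_mem_segment hz
        have h3 := hpq x hx
        linarith
      have hUp : p ∈ U := hRxU hpRx
      have he : ∀ y ∈ Rx, ‖fderiv ℝ u y - P‖ ≤ 2 * M * δ := by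
        intro y hy
        refine (fderiv_lip hUo hu hu2 hRxc hRxU hpRx hy).trans ?_
        calc μ * ‖y - p‖ ≤ μ * ((c + M) * s) := by gcongr; exact hdiam y hy
          _ = (c + M) * (μ * s) := by ring
          _ ≤ (2 * M) * δ := by gcongr; linarith
      have hε1 : ∀ y ∈ Rx, ∀ i j, |pb (fderiv ℝ u y) i j - pb P i j| ≤ (2 + 2 * M) * δ^2 := by
        intro y hy i j
        have h1 := hg y (hRxU hy) i j
        have h2 := hg p hUp i j
        have h3 := hgh y p i j
        have h4 : Θ * ‖y - p‖^β ≤ (2 * M) * δ^2 := osc_le hΘ (norm_nonneg _) (by linarith) hρ.le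
          ((hdiam y hy).trans (mul_le_mul (by linarith) hsρ hs0.le (by linarith))) hβ hβ1 hΘδ
        rw [← hP] at h2
        rw [abs_le] at *
        constructor <;> linarith [h1.1, h1.2, h2.1, h2.2, h3.1, h3.2]
      obtain ⟨Ω, hΩ1, hΩ2⟩ := korn_moll hmd hUb hRxU hRxc P (ε₁ := (2 + 2 * M) * δ^2) (by positivity) hε1 he (p := p) (hcb p hpS) hDm0
        (fun y hy => (hdiam y hy).trans (le_of_eq (by rw [hDm, hl]; field_simp)))
      have eK : (n:ℝ)^2 * ((2 + 2 * M) * δ^2 + (n+1) * (2 * M * δ)^2) = Kε * δ^2 := by rw [hKε]; ring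
      rw [eK] at hΩ1 hΩ2
      have c1 : ‖fderiv ℝ f p - P‖ ≤ 2 * δ := by
        refine (hmd.c1 hpD).trans ?_
        have : μ * l ≤ δ := le_trans (by gcongr) hμs
        linarith
      have c2 : ‖fderiv ℝ f q - P‖ ≤ 4 * M * δ := by
        have h1 := hmd.c1 hqD
        have : μ * l ≤ δ := le_trans (by gcongr) hμs
        have h2 := he q hqRx
        have h3 := norm_sub_le_norm_sub_add_norm_sub (fderiv ℝ f q) (fderiv ℝ u q) P
        linarith [le_mul_of_one_le_left hδ.le hM]
      have hE := ext_point (P := P) (A := fderiv ℝ f p) (C := fderiv ℝ f q) (X := fderiv ℝ v x - P) (N := fderiv ℝ η x) (s := s)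
        (M := M) (δ := δ) (Kε := Kε) (k₁ := k₁) hM hs0.le hs1 hKε0 hk₁0 hδ.le
        (by rw [hfd x]; abel) (G.b1 x (hTR x hx)) c1 c2 Ω hΩ1
        (fun i j => (hΩ2 p hpD (hcb p hpS) i j).trans (le_of_eq (by rw [hk₁]; ring)))
        (fun i j => (hΩ2 q hqD (hcb q hqS) i j).trans (le_of_eq (by rw [hk₁]; ring)))
      refine ⟨hE.1, fun i j => ?_⟩
      have := hE.2 i j
      rwa [add_sub_cancel] at this
    refine ⟨fun x hx i j => ?_, fun x hx => ?_⟩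
    · have h1 := (main x hx).2 i j
      have hpU : x + s • η x ∈ U := hTin x hx s hsI (Metric.mem_ball_self (by positivity))
      have h2 := hg _ hpU i j
      have h3 := hgh (x + s • η x) x i j
      have h4 : Θ * ‖x + s • η x - x‖^β ≤ M * δ^2 := by
        refine osc_le hΘ (norm_nonneg _) hM hρ.le ?_ hβ hβ1 hΘδ
        rw [add_sub_cancel_left, norm_smul, Real.norm_of_nonneg hs0.le, mul_comm]
        exact mul_le_mul (G.b0 x (hTR x hx)) hsρ hs0.le (by linarith)
      have h5 : 0 ≤ (1 + K2 + (14 * M^2 + M)) * δ^2 := by positivity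
      have h6 : (1 + K2 + K3 + (1 + M) + (14 * M^2 + M)) * δ^2 = K3 * δ^2 + δ^2 + M * δ^2 + (1 + K2 + (14 * M^2 + M)) * δ^2 := by ring
      rw [h6]
      have h7 := norm_sub_le_norm_sub_add_norm_sub (pb (fderiv ℝ v x) i j) (pb (fderiv ℝ u (x + s • η x)) i j) (g x i j)
      have h8 := norm_sub_le_norm_sub_add_norm_sub (pb (fderiv ℝ u (x + s • η x)) i j) (g (x + s • η x) i j) (g x i j)
      simp only [Real.norm_eq_abs] at h7 h8
      linarith
    · have hxT : x ∈ T := Metric.self_subset_thickening hl0 _ hx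
      have h1 := (main x hxT).1
      have h2 := fderiv_lip hUo hu hu2 (convex_segment x (x + s • η x)) (G.seg hx hs0.le (by linarith)) (left_mem_segment _ _ _)
        (right_mem_segment _ _ _)
      rw [add_sub_cancel_left, norm_smul, Real.norm_of_nonneg hs0.le] at h2
      have h3 : μ * (s * ‖η x‖) ≤ M * δ := by
        calc μ * (s * ‖η x‖) = (μ * s) * ‖η x‖ := by ring
          _ ≤ δ * M := by gcongr; exact G.b0 x (hTR x hxT)
          _ = _ := by ring
      have h4 := norm_sub_le_norm_sub_add_norm_sub (fderiv ℝ v x) (fderiv ℝ u (x + s • η x)) (fderiv ℝ u x)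
      have h5 : 0 ≤ (1 + K2 + K3 + (1 + M)) * δ := by positivity
      have h6 : (1 + K2 + K3 + (1 + M) + (14 * M^2 + M)) * δ = (1 + K2 + K3 + (1 + M)) * δ + 14 * M^2 * δ + M * δ := by ring
      rw [h6]
      linarith

end ext2
end CI

namespace CI
open scoped ContDiff
section fin1
variable {n : ℕ}

lemma clamp_lip {p q a b d : ℝ} (h : a ≤ b + d) (hd : 0 ≤ d) : max p (min q a) ≤ max p (min q b) + d := by
  rcases le_total p (min q a) with h1 | h1
  · rw [max_eq_right h1]
    have : min q a ≤ min q b + d := by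
      rcases le_total q b with h2 | h2
      · rw [min_eq_left h2]; linarith [min_le_left q a]
      · rw [min_eq_right h2]; linarith [min_le_right q a]
    linarith [le_max_right p (min q b)]
  · rw [max_eq_left h1]
    linarith [le_max_left p (min q b)]

lemma holder_ext {K : Set (Fin n → ℝ)} (hK : K.Nonempty) {f : (Fin n → ℝ) → ℝ} {Θ β m r : ℝ} (hΘ : 0 ≤ Θ) (hβ : 0 < β) (hβ1 : β < 1)
    (hf : ∀ x ∈ K, ∀ y ∈ K, |f x - f y| ≤ Θ * ‖x - y‖^β) (hr : ∀ x ∈ K, |f x - m| ≤ r) :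
    ∃ F : (Fin n → ℝ) → ℝ, (∀ x ∈ K, F x = f x) ∧ (∀ x y, |F x - F y| ≤ Θ * ‖x - y‖^β) ∧ ∀ x, |F x - m| ≤ r := by
  have : Nonempty K := hK.to_subtype
  set F0 : (Fin n → ℝ) → ℝ := fun x => ⨅ y : K, (f y + Θ * ‖x - y‖^β) with hF0
  have hr0 : 0 ≤ r := by obtain ⟨x, hx⟩ := hK; exact (abs_nonneg _).trans (hr x hx)
  have hbd : ∀ x, BddBelow (Set.range fun y : K => f y + Θ * ‖x - (y : Fin n → ℝ)‖^β) := by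
    intro x
    refine ⟨m - r, ?_⟩
    rintro _ ⟨y, rfl⟩
    have := (abs_le.1 (hr y y.2)).1
    have h2 : 0 ≤ Θ * ‖x - y‖^β := by positivity
    simp only
    linarith
  have hlip : ∀ x z, F0 x ≤ F0 z + Θ * ‖x - z‖^β := by
    intro x z
    rw [← sub_le_iff_le_add]
    refine le_ciInf fun y => ?_
    have h1 : F0 x ≤ f y + Θ * ‖x - y‖^β := ciInf_le (hbd x) y
    have h2 : ‖x - (y : Fin n → ℝ)‖^β ≤ ‖x - z‖^β + ‖z - y‖^β := by
      refine (Real.rpow_le_rpow (norm_nonneg _) (norm_sub_le_norm_sub_add_norm_sub x z y) hβ.le).trans ?_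
      exact Real.rpow_add_le_add_rpow (norm_nonneg _) (norm_nonneg _) hβ.le hβ1.le
    have h3 : Θ * ‖x - (y : Fin n → ℝ)‖^β ≤ Θ * (‖x - z‖^β + ‖z - y‖^β) := by gcongr
    linarith
  have heq : ∀ x ∈ K, F0 x = f x := by
    intro x hx
    apply le_antisymm
    · have := ciInf_le (hbd x) ⟨x, hx⟩
      simpa [Real.zero_rpow hβ.ne'] using this
    · refine le_ciInf fun y => ?_
      have := (abs_le.1 (hf x hx y y.2)).2
      linarith
  refine ⟨fun x => max (m - r) (min (m + r) (F0 x)), fun x hx => ?_, fun x y => ?_, fun x => ?_⟩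
  · have := abs_le.1 (hr x hx)
    simp only
    rw [heq x hx, min_eq_right (by linarith), max_eq_right (by linarith)]
  · have h1 := clamp_lip (p := m - r) (q := m + r) (hlip x y) (by positivity)
    have h2 := clamp_lip (p := m - r) (q := m + r) (hlip y x) (by positivity)
    rw [norm_sub_rev y x] at h2
    rw [abs_le]
    constructor <;> linarith
  · rw [abs_le]
    constructor
    · linarith [le_max_left (m - r) (min (m + r) (F0 x))]
    · have : max (m - r) (min (m + r) (F0 x)) ≤ m + r := max_le (by linarith) (min_le_left _ _)
      linarith

lemma holder_ext_mat {K : Set (Fin n → ℝ)} (hK : K.Nonempty) {g : (Fin n → ℝ) → Matrix (Fin n) (Fin n) ℝ} {g₀ : Matrix (Fin n) (Fin n) ℝ}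
    {Θ β r : ℝ} (hΘ : 0 ≤ Θ) (hβ : 0 < β) (hβ1 : β < 1) (hs : ∀ x i j, g x i j = g x j i) (hs0 : ∀ i j, g₀ i j = g₀ j i)
    (hf : ∀ x ∈ K, ∀ y ∈ K, ∀ i j, |g x i j - g y i j| ≤ Θ * ‖x - y‖^β) (hr : ∀ x ∈ K, ∀ i j, |g x i j - g₀ i j| ≤ r) :
    ∃ F : (Fin n → ℝ) → Matrix (Fin n) (Fin n) ℝ, (∀ x ∈ K, F x = g x) ∧ (∀ x i j, F x i j = F x j i) ∧
      (∀ x y i j, |F x i j - F y i j| ≤ Θ * ‖x - y‖^β) ∧ ∀ x i j, |F x i j - g₀ i j| ≤ r := by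
  choose F h1 h2 h3 using fun i j => holder_ext hK (f := fun x => g x i j) (m := g₀ i j) hΘ hβ hβ1
    (fun x hx y hy => hf x hx y hy i j) (fun x hx => hr x hx i j)
  have hmm : ∀ i j : Fin n, (min i j = i ∧ max i j = j) ∨ (min i j = j ∧ max i j = i) := by
    intro i j
    rcases le_total i j with h | h
    · left; simp [h]
    · right; simp [h]
  refine ⟨fun x => Matrix.of fun i j => F (min i j) (max i j) x, fun x hx => ?_, fun x i j => ?_, fun x y i j => ?_, fun x i j => ?_⟩
  · ext i j
    simp only [Matrix.of_apply]
    rw [h1 _ _ x hx]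
    rcases hmm i j with ⟨a, b⟩ | ⟨a, b⟩ <;> simp only [a, b]
    exact hs x j i
  · simp only [Matrix.of_apply, min_comm, max_comm]
  · exact h2 _ _ x y
  · have := h3 (min i j) (max i j) x
    simp only [Matrix.of_apply]
    rcases hmm i j with ⟨a, b⟩ | ⟨a, b⟩
    · rw [a, b] at this ⊢; exact this
    · rw [a, b] at this ⊢; rw [hs0 i j]; exact this

lemma hold_glob {E : Type} [NormedAddCommGroup E] {U : Set (Fin n → ℝ)} {f : (Fin n → ℝ) → E} {K δ μ d α : ℝ} (hK : 0 ≤ K) (hδ : 0 < δ)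
    (hμ : 0 < μ) (hd : 0 < d) (hα : 0 < α) (hα1 : α < 1) (h0 : ∀ x ∈ U, ‖f x‖ ≤ K * δ)
    (h1 : ∀ x ∈ U, ∀ y ∈ U, ‖x - y‖ ≤ d * (δ/μ) → ‖f x - f y‖ ≤ K * μ * ‖x - y‖) :
    ∀ x ∈ U, ∀ y ∈ U, ‖f x - f y‖ ≤ (2 * K + 2 * K / d) * (μ^α * δ^(1-α)) * ‖x - y‖^α := by
  intro x hx y hy
  set C := 2 * K + 2 * K / d with hC
  have hKd : 0 ≤ 2 * K / d := by positivity
  have hC0 : 0 ≤ C := by positivity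
  have a1 : ‖f x - f y‖ ≤ C * δ := by
    refine (norm_sub_le _ _).trans ?_
    have := h0 x hx
    have := h0 y hy
    have : C * δ = 2 * (K * δ) + 2 * K / d * δ := by rw [hC]; ring
    have : 0 ≤ 2 * K / d * δ := by positivity
    linarith
  have a2 : ‖f x - f y‖ ≤ C * μ * ‖x - y‖ := by
    rcases le_or_gt ‖x - y‖ (d * (δ/μ)) with h | h
    · refine (h1 x hx y hy h).trans ?_
      have : K ≤ C := by linarith
      gcongr
    · have b1 : ‖f x - f y‖ ≤ 2 * K * δ := by
        refine (norm_sub_le _ _).trans ?_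
        linarith [h0 x hx, h0 y hy]
      have b2 : 2 * K * δ = 2 * K / d * μ * (d * (δ / μ)) := by field_simp
      rw [b2] at b1
      refine b1.trans ?_
      have : 2 * K / d ≤ C := by linarith
      gcongr
  refine (interp (norm_nonneg _) (by positivity) (by positivity) (norm_nonneg _) a1 a2 hα hα1).trans (le_of_eq ?_)
  rw [Real.mul_rpow hC0 hδ.le, Real.mul_rpow hC0 hμ.le]
  have : C^(1-α) * C^α = C := by
    rcases eq_or_lt_of_le hC0 with h | h
    · rw [← h, Real.zero_rpow hα.ne', mul_zero]
    · rw [← Real.rpow_add h]; simp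
  calc C^(1-α) * δ^(1-α) * (C^α * μ^α) * ‖x - y‖^α = (C^(1-α) * C^α) * (μ^α * δ^(1-α)) * ‖x - y‖^α := by ring
    _ = _ := by rw [this]

lemma grad_bd {L : Hm n} {a : ℝ} (ha : 0 ≤ a) (h : ∀ i, |pb L i i| ≤ a^2) : ‖L‖ ≤ n * a := by
  refine hm_norm_le L a ha fun i k => ?_
  apply abs_le_of_sq_le_sq _ ha
  refine le_trans ?_ ((le_abs_self _).trans (h i))
  have : (L (Pi.single i 1) k)^2 = L (Pi.single i 1) k * L (Pi.single i 1) k := by ring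
  rw [this]
  exact Finset.single_le_sum (f := fun k => L (Pi.single i 1) k * L (Pi.single i 1) k) (fun k _ => mul_self_nonneg _) (Finset.mem_univ k)

lemma pb_smul (s : ℝ) (L : Hm n) (i j : Fin n) : pb (s • L) i j = s^2 * pb L i j := by
  simp only [pb_eq_dot, _root_.smul_apply, dotProduct_smul, smul_dotProduct, smul_eq_mul]
  ring

lemma sqrt_one_sub {t : ℝ} (h0 : 0 ≤ t) (h1 : t ≤ 1) : 0 ≤ 1 - √(1 - t) ∧ 1 - √(1-t) ≤ t := by
  have h2 : √(1-t) ≤ 1 := Real.sqrt_le_one.2 (by linarith)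
  have h3 := Real.sq_sqrt (by linarith : 0 ≤ 1 - t)
  have h4 := Real.sqrt_nonneg (1-t)
  constructor <;> nlinarith

lemma exists_lin {g₀ : Matrix (Fin n) (Fin n) ℝ} (hg : g₀.PosDef) : ∃ L : Hm n, ∀ i j, pb L i j = g₀ i j := by
  obtain ⟨B, hB, -⟩ := posdef_factor hg
  let A : Matrix (Fin (n+1)) (Fin n) ℝ := Matrix.of fun k i => Fin.cons (α := fun _ => ℝ) 0 (fun l => B l i) k
  refine ⟨LinearMap.toContinuousLinearMap (Matrix.mulVecLin A), fun i j => ?_⟩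
  rw [pb_eq_dot, ← hB]
  simp [dotProduct, A, Fin.sum_univ_succ, Matrix.mul_apply]

end fin1
end CI

namespace CI
open scoped ContDiff
section fin2
variable {n : ℕ} {U : Set (Fin n → ℝ)} {η : (Fin n → ℝ) → (Fin n → ℝ)} {M t₀ c R : ℝ}

/-- hypotheses of the core theorem (sup norm version) -/
structure Hyp (U : Set (Fin n → ℝ)) (g₀ : Matrix (Fin n) (Fin n) ℝ) (g : (Fin n → ℝ) → Matrix (Fin n) (Fin n) ℝ)
    (u : (Fin n → ℝ) → (Fin (n+1) → ℝ)) (Θ μ δ β ε r : ℝ) : Prop where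
  hΘ : 0 ≤ Θ
  hδ : 0 < δ
  hδμ : δ ≤ μ
  hε : Θ * (δ/μ)^β ≤ ε * δ^2
  sym : ∀ x i j, g x i j = g x j i
  hol : ∀ x y i j, |g x i j - g y i j| ≤ Θ * ‖x - y‖^β
  near : ∀ x i j, |g x i j - g₀ i j| ≤ r
  hu : ContDiffOn ℝ 2 u U
  bd : ∃ B0, ∀ x ∈ U, ‖u x‖ ≤ B0
  d2 : ∀ x ∈ U, ‖fderiv ℝ (fderiv ℝ u) x‖ ≤ μ
  pbg : ∀ x ∈ U, ∀ i j, |pb (fderiv ℝ u x) i j - g x i j| ≤ δ^2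

/-- conclusion of the core theorem -/
def Concl (U : Set (Fin n → ℝ)) (g : (Fin n → ℝ) → Matrix (Fin n) (Fin n) ℝ)
    (u : (Fin n → ℝ) → (Fin (n+1) → ℝ)) (μ δ α C : ℝ) : Prop :=
  ∃ ub : (Fin n → ℝ) → (Fin (n+1) → ℝ), ∃ ρ > 0, (∀ x ∈ Metric.thickening ρ U, DifferentiableAt ℝ ub x) ∧
    (∀ x ∈ U, ∀ i j, pb (fderiv ℝ ub x) i j = g x i j) ∧ (∀ x ∈ U, ‖fderiv ℝ ub x - fderiv ℝ u x‖ ≤ C * δ) ∧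
    (∀ x ∈ U, ∀ y ∈ U, ‖(fderiv ℝ ub x - fderiv ℝ u x) - (fderiv ℝ ub y - fderiv ℝ u y)‖ ≤ C * (μ^α * δ^(1-α)) * ‖x-y‖^α)

/-- combine two steps -/
lemma Concl.trans {g : (Fin n → ℝ) → Matrix (Fin n) (Fin n) ℝ} {u u₀ : (Fin n → ℝ) → (Fin (n+1) → ℝ)} {μ δ α C C' : ℝ}
    (h : Concl U g u₀ μ δ α C) (h0 : ∀ x ∈ U, ‖fderiv ℝ u₀ x - fderiv ℝ u x‖ ≤ C' * δ)
    (h1 : ∀ x ∈ U, ∀ y ∈ U, ‖(fderiv ℝ u₀ x - fderiv ℝ u x) - (fderiv ℝ u₀ y - fderiv ℝ u y)‖ ≤ C' * (μ^α * δ^(1-α)) * ‖x-y‖^α) :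
    Concl U g u μ δ α (C + C') := by
  obtain ⟨ub, ρ, hρ, a1, a2, a3, a4⟩ := h
  refine ⟨ub, ρ, hρ, a1, a2, fun x hx => ?_, fun x hx y hy => ?_⟩
  · have e : fderiv ℝ ub x - fderiv ℝ u x = (fderiv ℝ ub x - fderiv ℝ u₀ x) + (fderiv ℝ u₀ x - fderiv ℝ u x) := by abel
    rw [e]
    refine (norm_add_le _ _).trans ?_
    linarith [a3 x hx, h0 x hx]
  · have e : (fderiv ℝ ub x - fderiv ℝ u x) - (fderiv ℝ ub y - fderiv ℝ u y) =
      ((fderiv ℝ ub x - fderiv ℝ u₀ x) - (fderiv ℝ ub y - fderiv ℝ u₀ y)) +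
      ((fderiv ℝ u₀ x - fderiv ℝ u x) - (fderiv ℝ u₀ y - fderiv ℝ u y)) := by abel
    rw [e]
    refine (norm_add_le _ _).trans ?_
    linarith [a4 x hx y hy, h1 x hx y hy]

lemma Concl.mono {g : (Fin n → ℝ) → Matrix (Fin n) (Fin n) ℝ} {u : (Fin n → ℝ) → (Fin (n+1) → ℝ)} {μ δ α C C' : ℝ}
    (h : Concl U g u μ δ α C) (hC : C ≤ C') (hδ : 0 < δ) (hμ : 0 < μ) : Concl U g u μ δ α C' := by
  obtain ⟨ub, ρ, hρ, a1, a2, a3, a4⟩ := h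
  refine ⟨ub, ρ, hρ, a1, a2, fun x hx => (a3 x hx).trans (by gcongr), fun x hx y hy => (a4 x hx y hy).trans (by gcongr)⟩

def Gm (g₀ : Matrix (Fin n) (Fin n) ℝ) : ℝ := 2 + ∑ i, |g₀ i i|

lemma Gm_ge (g₀ : Matrix (Fin n) (Fin n) ℝ) : 2 ≤ Gm g₀ := by
  have : 0 ≤ ∑ i, |g₀ i i| := Finset.sum_nonneg fun i _ => abs_nonneg _
  unfold Gm; linarith

lemma Hyp.grad {g₀ : Matrix (Fin n) (Fin n) ℝ} {g : (Fin n → ℝ) → Matrix (Fin n) (Fin n) ℝ}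
    {u : (Fin n → ℝ) → (Fin (n+1) → ℝ)} {Θ μ δ β ε r : ℝ} (h : Hyp U g₀ g u Θ μ δ β ε r) (hr : r ≤ 1) :
    ∀ x ∈ U, ‖fderiv ℝ u x‖ ≤ n * (Gm g₀ + δ) := by
  intro x hx
  have hG := Gm_ge g₀
  have hδ := h.hδ
  refine grad_bd (by positivity) fun i => ?_
  have a1 := h.pbg x hx i i
  have a2 := h.near x i i
  have a3 : |g₀ i i| ≤ ∑ i, |g₀ i i| := Finset.single_le_sum (f := fun i => |g₀ i i|) (fun i _ => abs_nonneg _) (Finset.mem_univ i)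
  have e : pb (fderiv ℝ u x) i i = (pb (fderiv ℝ u x) i i - g x i i) + (g x i i - g₀ i i) + g₀ i i := by ring
  have a4 : |pb (fderiv ℝ u x) i i| ≤ |pb (fderiv ℝ u x) i i - g x i i| + |g x i i - g₀ i i| + |g₀ i i| := by
    conv_lhs => rw [e]
    exact abs_add_three _ _ _
  have a5 : Gm g₀ = 2 + ∑ i, |g₀ i i| := rfl
  nlinarith

set_option synthInstance.maxHeartbeats 400000 in
set_option maxHeartbeats 3200000 in
lemma core_small (G : Geo U η M t₀ c R) (hUo : IsOpen U) (hUb : Bornology.IsBounded U) {g₀ : Matrix (Fin n) (Fin n) ℝ} (hg : g₀.PosDef)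
    (α β : ℝ) (hα : 0 < α) (hβ : 0 < β) (hβ1 : β < 1) (hα1 : α < 1/(1+(n:ℝ)*((n:ℝ)+1))) (hαβ : α < β/2) :
    ∃ δs > 0, ∃ ε > 0, ∃ C > 0, ∃ r > 0, ∀ g u Θ μ δ, Hyp U g₀ g u Θ μ δ β ε r → δ ≤ δs → Concl U g u μ δ α C := by
  obtain ⟨C₁, hC₁, σ, hσ, δ₁, hδ₁, r₁, hr₁, ε₁, hε₁, hδ₁1, hit⟩ := iterate hg α β hα hβ hβ1 hα1 hαβ
  obtain ⟨K, hK, a, ha, hext⟩ := extend G hUo hUb β hβ hβ1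
  have hM := G.hM
  have hc := G.hc0
  have ht0 := G.ht0
  have hαlt : α < 1 := by linarith
  have hGm := Gm_ge g₀
  set A := 2 * K / σ with hA
  have hA0 : 0 < A := by positivity
  set S := √A with hS
  have hS0 : 0 < S := Real.sqrt_pos.2 hA0
  have hS2 : S^2 = A := Real.sq_sqrt hA0.le
  set C₂ := K + 3 * S / a + S with hC₂
  have hC₂0 : 0 < C₂ := by positivity
  set d := min (a/2) (c * t₀ / (3 * M)) with hd
  have hd0 : 0 < d := lt_min (by positivity) (by positivity)
  set K₅ := A * (n * (Gm g₀ + 1) + K) + K with hK₅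
  have hK₅0 : 0 < K₅ := by positivity
  set K₇ := K₅ + (K + (6 * M / c + 2)) with hK₇
  have hK₇0 : 0 < K₇ := by positivity
  set Cg := 2 * K₇ + 2 * K₇ / d with hCg
  have hCg0 : 0 < Cg := by positivity
  set C₃ := C₁ * (C₂^α * S^(1-α)) with hC₃
  have hC₃0 : 0 < C₃ := by positivity
  refine ⟨min 1 (δ₁/S), lt_min one_pos (by positivity), min 1 (ε₁ * A), lt_min one_pos (by positivity), (C₁ * S + C₃) + (K₅ + Cg),
    by positivity, min r₁ (min 1 (σ/4)), lt_min hr₁ (lt_min one_pos (by positivity)), ?_⟩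
  intro g u Θ μ δ H hδs
  have hδ := H.hδ
  have hδ1 : δ ≤ 1 := hδs.trans (min_le_left _ _)
  have hSδ : S * δ ≤ δ₁ := by
    have := hδs.trans (min_le_right _ _)
    rw [le_div_iff₀ hS0] at this
    linarith
  have hμ : 0 < μ := lt_of_lt_of_le hδ H.hδμ
  have hρ : 0 < δ/μ := by positivity
  have hρ1 : δ/μ ≤ 1 := (div_le_one hμ).2 H.hδμ
  have hε1 : Θ * (δ/μ)^β ≤ δ^2 := H.hε.trans (mul_le_of_le_one_left (sq_nonneg δ) (min_le_left 1 (ε₁ * A)))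
  have hε2 : Θ * (δ/μ)^β ≤ ε₁ * (S * δ)^2 := by
    refine H.hε.trans ?_
    rw [mul_pow, hS2, ← mul_assoc]
    gcongr
    exact min_le_right _ _
  have hr1 : min r₁ (min 1 (σ/4)) ≤ 1 := (min_le_right _ _).trans (min_le_left _ _)
  have hr2 : min r₁ (min 1 (σ/4)) ≤ σ/4 := (min_le_right _ _).trans (min_le_right _ _)
  have hgrad := H.grad hr1
  obtain ⟨v, hv, hv2, hvp, hvu⟩ := hext u g _ δ μ Θ hδ H.hδμ H.hΘ hε1 H.hu H.bd hgrad H.d2 H.pbg H.hol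
  have hvd : ∀ x, DifferentiableAt ℝ v x := fun x => (hv.differentiable (by simp)).differentiableAt
  have hvdd : ∀ x, DifferentiableAt ℝ (fderiv ℝ v) x := fun x =>
    ((hv.fderiv_right (m := ∞) (by norm_cast)).differentiable (by simp)).differentiableAt
  set t := A * δ^2 with ht
  have ht0' : 0 ≤ t := by positivity
  have ht1 : t ≤ 1 := by
    have : t = (S * δ)^2 := by rw [mul_pow, hS2]
    rw [this]
    exact pow_le_one₀ (by positivity) (hSδ.trans hδ₁1)
  set s := √(1 - t) with hs
  have hs0 : 0 ≤ s := Real.sqrt_nonneg _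
  have hs2 : s^2 = 1 - t := Real.sq_sqrt (by linarith)
  obtain ⟨hs3, hs4⟩ := sqrt_one_sub ht0' ht1
  rw [← hs] at hs3 hs4
  set u₀ : (Fin n → ℝ) → (Fin (n+1) → ℝ) := fun x => s • v x with hu₀
  have hu₀1 : fderiv ℝ u₀ = fun x => s • fderiv ℝ v x := by
    funext x
    exact fderiv_const_smul (hvd x) s
  have hu₀2 : ∀ x, fderiv ℝ (fderiv ℝ u₀) x = s • fderiv ℝ (fderiv ℝ v) x := by
    intro x
    rw [hu₀1]
    exact fderiv_const_smul (hvdd x) s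
  have hμ₀ : S * δ / (C₂ * μ) = S / C₂ * (δ/μ) := by field_simp
  have hsub : 3 * (S * δ / (C₂ * μ)) ≤ a * (δ/μ) := by
    rw [hμ₀, ← mul_assoc]
    gcongr
    rw [← mul_div_assoc, div_le_iff₀ hC₂0, hC₂]
    have h1 : a * (K + 3 * S / a + S) = 3 * S + a * (K + S) := by field_simp; ring
    have h2 : 0 ≤ a * (K + S) := by positivity
    linarith
  have hsub' := Metric.thickening_mono hsub U
  have hbt := (hUb.thickening (δ := a * (δ/μ)))
  obtain ⟨Rv, hRv⟩ := hbt.subset_closedBall (0 : Fin n → ℝ)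
  have hlow : Concl U g u₀ μ δ α (C₁ * S + C₃) := by
    obtain ⟨ub, b1, b2, b3, b4⟩ := hit U u₀ g Θ (S * δ) (C₂ * μ) H.hΘ (by positivity) hSδ (by positivity) (by
        refine le_trans ?_ hε2
        refine mul_le_mul_of_nonneg_left (Real.rpow_le_rpow (by positivity) ?_ hβ.le) H.hΘ
        rw [hμ₀]
        refine mul_le_of_le_one_left hρ.le ?_
        rw [div_le_one hC₂0, hC₂]
        have : 0 ≤ 3 * S / a := by positivity
        linarith) ((hv.const_smul s).of_le (by norm_cast)).contDiffOn (by
        obtain ⟨B0, hB0⟩ := (isCompact_closedBall (0 : Fin n → ℝ) Rv).exists_bound_of_continuousOn (f := u₀)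
          ((hv.const_smul s).continuous.continuousOn)
        exact ⟨B0, fun x hx => hB0 x (hRv (hsub' hx))⟩) (by
        intro x hx
        rw [hu₀2]
        refine (ContinuousLinearMap.opNorm_smul_le s (fderiv ℝ (fderiv ℝ v) x)).trans ?_
        rw [Real.norm_of_nonneg hs0]
        have h1 := hv2 x (hsub' hx)
        have h2 : s * ‖fderiv ℝ (fderiv ℝ v) x‖ ≤ 1 * (K * μ) := by gcongr; linarith
        refine h2.trans ?_
        rw [one_mul]
        gcongr
        have : 0 ≤ 3 * S / a := by positivity
        linarith) H.sym (fun x i j => (H.near x i j).trans (min_le_left _ _)) H.hol (by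
        intro x hx i j
        have h1 := hvp x (hsub' hx) i j
        have h2 := (H.near x i j).trans hr2
        rw [hu₀1]
        simp only [pb_smul]
        rw [hs2, mul_pow, hS2, ← ht]
        have e : g x i j - t * g₀ i j - (1 - t) * pb (fderiv ℝ v x) i j =
          -((1 - t) * (pb (fderiv ℝ v x) i j - g x i j)) + t * (g x i j - g₀ i j) := by ring
        rw [e]
        refine (abs_add_le _ _).trans ?_
        rw [abs_neg, abs_mul, abs_mul, abs_of_nonneg ht0', abs_of_nonneg (by linarith : 0 ≤ 1 - t)]
        have h3 : (1 - t) * |pb (fderiv ℝ v x) i j - g x i j| ≤ 1 * (K * δ^2) := by gcongr; linarith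
        have h4 : t * |g x i j - g₀ i j| ≤ t * (σ/4) := by gcongr
        have h5 : K * δ^2 = σ * t / 2 := by rw [ht, hA]; field_simp
        have : 0 ≤ σ * t := by positivity
        linarith)
    refine ⟨ub, S * δ / (C₂ * μ), by positivity, b1, b2, fun x hx => (b3 x hx).trans ?_, fun x hx y hy => (b4 x hx y hy).trans ?_⟩
    · have : 0 ≤ C₃ * δ := by positivity
      linarith
    · refine mul_le_mul_of_nonneg_right ?_ (by positivity)
      rw [Real.mul_rpow hC₂0.le hμ.le, Real.mul_rpow hS0.le hδ.le]
      have e : C₁ * (C₂ ^ α * μ ^ α * (S ^ (1 - α) * δ ^ (1 - α))) = C₃ * (μ^α * δ^(1-α)) := by rw [hC₃]; ring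
      rw [e]
      gcongr
      have : 0 ≤ C₁ * S := by positivity
      linarith
  have hf0 : ∀ x ∈ U, ‖fderiv ℝ u₀ x - fderiv ℝ u x‖ ≤ K₅ * δ := by
    intro x hx
    have e : fderiv ℝ u₀ x - fderiv ℝ u x = (fderiv ℝ v x - fderiv ℝ u x) - (1 - s) • fderiv ℝ v x := by
      rw [hu₀1]; module
    have h1 := hvu x hx
    have h2 : ‖fderiv ℝ v x‖ ≤ n * (Gm g₀ + 1) + K := by
      have e2 : fderiv ℝ v x = fderiv ℝ u x + (fderiv ℝ v x - fderiv ℝ u x) := by abel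
      rw [e2]
      refine (norm_add_le _ _).trans (add_le_add ((hgrad x hx).trans (by gcongr)) (h1.trans ?_))
      exact mul_le_of_le_one_right (by positivity) hδ1
    rw [e]
    refine (norm_sub_le _ _).trans ?_
    rw [norm_smul, Real.norm_of_nonneg hs3]
    have h3 : (1 - s) * ‖fderiv ℝ v x‖ ≤ t * (n * (Gm g₀ + 1) + K) := by gcongr
    have h4 : t ≤ A * δ := by rw [ht]; gcongr; exact pow_le_of_le_one hδ.le hδ1 two_ne_zero
    have h5 : t * (n * (Gm g₀ + 1) + K) ≤ (A * δ) * (n * (Gm g₀ + 1) + K) := by gcongr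
    have e3 : K₅ * δ = (A * δ) * (n * (Gm g₀ + 1) + K) + K * δ := by rw [hK₅]; ring
    linarith
  have hfg := hold_glob (U := U) (f := fun x => fderiv ℝ u₀ x - fderiv ℝ u x) (K := K₇) (α := α) hK₇0.le hδ hμ hd0 hα hαlt
    (fun x hx => (hf0 x hx).trans (by gcongr; rw [hK₇]; linarith [show 0 ≤ K + (6 * M / c + 2) by positivity])) (by
    intro x hx y hy hxy
    have h1 := G.quasi hUo H.hu H.d2 hx hy (hxy.trans (by
      have : d ≤ c * t₀ / (3 * M) := min_le_right _ _
      exact (mul_le_of_le_one_right hd0.le hρ1).trans this))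
    have hxy2 : ‖x - y‖ < a * (δ/μ) := by
      have : d ≤ a/2 := min_le_left _ _
      refine hxy.trans_lt (mul_lt_mul_of_pos_right ?_ hρ)
      linarith
    have h2 := fderiv_lip Metric.isOpen_thickening ((hv.of_le (by norm_cast)).contDiffOn (s := Metric.thickening (a * (δ/μ)) U)) hv2
      (convex_ball y (a * (δ/μ))) (Metric.ball_subset_thickening hy _) (Metric.mem_ball_self (by positivity))
      (mem_ball_iff_norm.2 hxy2)
    have e : fderiv ℝ u₀ x - fderiv ℝ u x - (fderiv ℝ u₀ y - fderiv ℝ u y) =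
      s • (fderiv ℝ v x - fderiv ℝ v y) - (fderiv ℝ u x - fderiv ℝ u y) := by
      rw [hu₀1]; module
    rw [e]
    refine (norm_sub_le _ _).trans ?_
    rw [norm_smul, Real.norm_of_nonneg hs0]
    have h3 : s * ‖fderiv ℝ v x - fderiv ℝ v y‖ ≤ 1 * (K * μ * ‖x - y‖) := by gcongr; linarith
    have h4 : 0 ≤ K₅ * μ * ‖x - y‖ := by positivity
    have e2 : K₇ * μ * ‖x - y‖ = K₅ * μ * ‖x - y‖ + (K * μ * ‖x - y‖) + (6 * M / c + 2) * μ * ‖x - y‖ := by rw [hK₇]; ring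
    linarith)
  refine hlow.trans (fun x hx => (hf0 x hx).trans (by gcongr; linarith)) (fun x hx y hy => (hfg x hx y hy).trans ?_)
  refine mul_le_mul_of_nonneg_right (mul_le_mul_of_nonneg_right ?_ (by positivity)) (by positivity)
  rw [← hCg]
  linarith

end fin2
end CI

namespace CI
open scoped ContDiff
section fin3
variable {n : ℕ} {U : Set (Fin n → ℝ)} {η : (Fin n → ℝ) → (Fin n → ℝ)} {M t₀ c R : ℝ}

lemma Hyp.mono {g₀ : Matrix (Fin n) (Fin n) ℝ} {g : (Fin n → ℝ) → Matrix (Fin n) (Fin n) ℝ}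
    {u : (Fin n → ℝ) → (Fin (n+1) → ℝ)} {Θ μ δ β ε r ε' r' : ℝ} (h : Hyp U g₀ g u Θ μ δ β ε r) (hr : r ≤ r') (he : ε ≤ ε') :
    Hyp U g₀ g u Θ μ δ β ε' r' :=
  ⟨h.hΘ, h.hδ, h.hδμ, h.hε.trans (by gcongr), h.sym, h.hol, fun x i j => (h.near x i j).trans hr, h.hu, h.bd, h.d2, h.pbg⟩

lemma large_aux1 {Θ μ δ δ₀ β ε : ℝ} (hμ : 0 < μ) (hδ : 0 < δ) (hδ₀ : 0 < δ₀) (hβ : 0 < β) (h : Θ * (δ/μ)^β ≤ ε * δ^2) :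
    Θ * (δ₀ / (μ * (δ/δ₀)^((2-β)/β)))^β ≤ ε * δ₀^2 := by
  have hq : 0 < δ/δ₀ := by positivity
  set q := δ/δ₀ with hqd
  have e1 : δ₀ / (μ * q^((2-β)/β)) = (δ/μ) * q^(-(2/β)) := by
    have e2 : q^(-(2/β)) = (q^((2-β)/β))⁻¹ * q⁻¹ := by
      rw [← Real.rpow_neg hq.le, ← Real.rpow_neg_one q, ← Real.rpow_add hq]
      congr 1
      field_simp
      ring
    rw [e2]
    have : δ₀ = δ * q⁻¹ := by rw [hqd]; field_simp
    rw [this]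
    have : 0 < q^((2-β)/β) := by positivity
    field_simp
  rw [e1, Real.mul_rpow (by positivity) (by positivity), ← Real.rpow_mul hq.le, ← mul_assoc]
  have e3 : q^(-(2/β) * β) = (q^2)⁻¹ := by
    have : -(2/β) * β = -((2:ℕ):ℝ) := by field_simp; norm_num
    rw [this, Real.rpow_neg hq.le, Real.rpow_natCast]
  rw [e3]
  have e4 : ε * δ₀^2 = ε * δ^2 * (q^2)⁻¹ := by rw [hqd]; field_simp
  rw [e4]
  gcongr

lemma large_aux2 {μ δ δ₀ β α : ℝ} (hμ : 0 < μ) (hδ₀ : 0 < δ₀) (hδ : δ₀ ≤ δ) (hβ : 0 < β) (hαβ : α < β/2) :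
    (μ * (δ/δ₀)^((2-β)/β))^α * δ₀^(1-α) ≤ μ^α * δ^(1-α) := by
  have hδ0 : 0 < δ := by linarith
  have hq : 0 < δ/δ₀ := by positivity
  have hq1 : 1 ≤ δ/δ₀ := (one_le_div hδ₀).2 hδ
  rw [Real.mul_rpow hμ.le (by positivity), ← Real.rpow_mul hq.le, mul_assoc]
  have h1 : (δ/δ₀)^((2-β)/β * α) ≤ (δ/δ₀)^(1-α) := by
    apply Real.rpow_le_rpow_of_exponent_le hq1
    rw [div_mul_eq_mul_div, div_le_iff₀ hβ]
    nlinarith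
  have h2 : δ^(1-α) = (δ/δ₀)^(1-α) * δ₀^(1-α) := by
    rw [← Real.mul_rpow hq.le hδ₀.le]
    congr 1
    field_simp
  rw [h2]
  gcongr

set_option synthInstance.maxHeartbeats 400000 in
set_option maxHeartbeats 3200000 in
lemma core_large (G : Geo U η M t₀ c R) (hUo : IsOpen U) (hUb : Bornology.IsBounded U) {g₀ : Matrix (Fin n) (Fin n) ℝ} (hg : g₀.PosDef)
    (α β : ℝ) (hα : 0 < α) (hβ : 0 < β) (hβ1 : β < 1) (hα1 : α < 1/(1+(n:ℝ)*((n:ℝ)+1))) (hαβ : α < β/2) (δs : ℝ) (hδs0 : 0 < δs) :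
    ∃ ε > 0, ∃ C > 0, ∃ r > 0, ∀ g u Θ μ δ, Hyp U g₀ g u Θ μ δ β ε r → δs ≤ δ → Concl U g u μ δ α C := by
  obtain ⟨C₁, hC₁, σ, hσ, δ₁, hδ₁, r₁, hr₁, ε₁, hε₁, hδ₁1, hit⟩ := iterate hg α β hα hβ hβ1 hα1 hαβ
  obtain ⟨L, hL⟩ := exists_lin hg
  have hM := G.hM
  have hc := G.hc0
  have ht0 := G.ht0
  have hαlt : α < 1 := by linarith
  have hGm := Gm_ge g₀
  set δ₀ := min δ₁ (min (1/2) δs) with hδ₀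
  have hδ₀0 : 0 < δ₀ := lt_min hδ₁ (lt_min (by norm_num) hδs0)
  have hδ₀h : δ₀ ≤ 1/2 := (min_le_right _ _).trans (min_le_left _ _)
  have hδ₀s : δ₀ ≤ δs := (min_le_right _ _).trans (min_le_right _ _)
  set s := √(1 - δ₀^2) with hs
  have hs0 : 0 ≤ s := Real.sqrt_nonneg _
  have hs2 : s^2 = 1 - δ₀^2 := Real.sq_sqrt (by nlinarith)
  have hs1 : s ≤ 1 := Real.sqrt_le_one.2 (by nlinarith)
  set d := c * t₀ / (3 * M) with hd
  have hd0 : 0 < d := by positivity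
  set K₅ := ‖L‖ / δs + n * (Gm g₀ / δs + 1) with hK₅
  have hK₅0 : 0 ≤ K₅ := by positivity
  set K₇ := K₅ + (6 * M / c + 2) with hK₇
  have hK₇0 : 0 < K₇ := by positivity
  set Cg := 2 * K₇ + 2 * K₇ / d with hCg
  have hCg0 : 0 < Cg := by positivity
  refine ⟨ε₁, hε₁, C₁ + (K₅ + Cg), by positivity, min r₁ (min 1 (σ * δ₀^2)), lt_min hr₁ (lt_min one_pos (by positivity)), ?_⟩
  intro g u Θ μ δ H hδs
  have hδ := H.hδ
  have hμ : 0 < μ := lt_of_lt_of_le hδ H.hδμ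
  have hρ1 : δ/μ ≤ 1 := (div_le_one hμ).2 H.hδμ
  have hr1 : min r₁ (min 1 (σ * δ₀^2)) ≤ 1 := (min_le_right _ _).trans (min_le_left _ _)
  have hr2 : min r₁ (min 1 (σ * δ₀^2)) ≤ σ * δ₀^2 := (min_le_right _ _).trans (min_le_right _ _)
  have hgrad := H.grad hr1
  set u₀ : (Fin n → ℝ) → (Fin (n+1) → ℝ) := fun x => (s • L) x with hu₀
  have hu₀1 : fderiv ℝ u₀ = fun x => s • L := by
    funext x
    exact (s • L).fderiv
  have hu₀2 : ∀ x, fderiv ℝ (fderiv ℝ u₀) x = 0 := by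
    intro x
    rw [hu₀1]
    exact fderiv_const_apply _
  have hu₀c : ContDiff ℝ 2 u₀ := (s • L).contDiff
  set μ₀ := μ * (δ/δ₀)^((2-β)/β) with hμ₀
  have hμ₀0 : 0 < μ₀ := by positivity
  have hbt := (hUb.thickening (δ := 3 * (δ₀/μ₀)))
  obtain ⟨Rv, hRv⟩ := hbt.subset_closedBall (0 : Fin n → ℝ)
  have hlow : Concl U g u₀ μ δ α C₁ := by
    obtain ⟨ub, b1, b2, b3, b4⟩ := hit U u₀ g Θ δ₀ μ₀ H.hΘ hδ₀0 (min_le_left _ _) hμ₀0 (large_aux1 hμ hδ hδ₀0 hβ H.hε)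
      hu₀c.contDiffOn (by
        obtain ⟨B0, hB0⟩ := (isCompact_closedBall (0 : Fin n → ℝ) Rv).exists_bound_of_continuousOn (f := u₀)
          (hu₀c.continuous.continuousOn)
        exact ⟨B0, fun x hx => hB0 x (hRv hx)⟩) (by
        intro x hx
        rw [hu₀2]
        exact (ContinuousLinearMap.opNorm_zero).le.trans hμ₀0.le) H.sym (fun x i j => (H.near x i j).trans (min_le_left _ _)) H.hol (by
        intro x hx i j
        rw [hu₀1]
        simp only [pb_smul]
        rw [hs2, hL]
        have e : g x i j - δ₀^2 * g₀ i j - (1 - δ₀^2) * g₀ i j = g x i j - g₀ i j := by ring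
        rw [e]
        exact (H.near x i j).trans hr2)
    refine ⟨ub, δ₀/μ₀, by positivity, b1, b2, fun x hx => (b3 x hx).trans ?_, fun x hx y hy => (b4 x hx y hy).trans ?_⟩
    · have : δ₀ ≤ δ := by linarith
      gcongr
    · refine mul_le_mul_of_nonneg_right (mul_le_mul_of_nonneg_left ?_ hC₁.le) (by positivity)
      exact large_aux2 hμ hδ₀0 (hδ₀s.trans hδs) hβ hαβ
  have hf0 : ∀ x ∈ U, ‖fderiv ℝ u₀ x - fderiv ℝ u x‖ ≤ K₅ * δ := by
    intro x hx
    rw [hu₀1]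
    refine (norm_sub_le _ _).trans ?_
    have h1 : ‖s • L‖ ≤ 1 * ‖L‖ := by
      refine (ContinuousLinearMap.opNorm_smul_le s L).trans ?_
      rw [Real.norm_of_nonneg hs0]
      gcongr
    have h2 := hgrad x hx
    have h3 : 1 ≤ δ / δs := (one_le_div hδs0).2 hδs
    have h4 : ‖L‖ ≤ ‖L‖ * (δ/δs) := le_mul_of_one_le_right (norm_nonneg _) h3
    have h5 : n * Gm g₀ ≤ n * Gm g₀ * (δ/δs) := le_mul_of_one_le_right (by positivity) h3
    have e : K₅ * δ = ‖L‖ * (δ/δs) + n * Gm g₀ * (δ/δs) + n * δ := by rw [hK₅]; ring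
    rw [e]
    simp only at *
    linarith
  have hfg := hold_glob (U := U) (f := fun x => fderiv ℝ u₀ x - fderiv ℝ u x) (K := K₇) (α := α) hK₇0.le hδ hμ hd0 hα hαlt
    (fun x hx => (hf0 x hx).trans (by gcongr; rw [hK₇]; linarith [show 0 ≤ 6 * M / c + 2 by positivity])) (by
    intro x hx y hy hxy
    have h1 := G.quasi hUo H.hu H.d2 hx hy (hxy.trans (by nlinarith))
    have e : fderiv ℝ u₀ x - fderiv ℝ u x - (fderiv ℝ u₀ y - fderiv ℝ u y) = - (fderiv ℝ u x - fderiv ℝ u y) := by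
      rw [hu₀1]; module
    rw [e, norm_neg]
    refine h1.trans ?_
    gcongr
    linarith)
  refine hlow.trans (fun x hx => (hf0 x hx).trans (by gcongr; linarith)) (fun x hx y hy => (hfg x hx y hy).trans ?_)
  refine mul_le_mul_of_nonneg_right (mul_le_mul_of_nonneg_right ?_ (by positivity)) (by positivity)
  rw [← hCg]
  linarith

lemma core (G : Geo U η M t₀ c R) (hUo : IsOpen U) (hUb : Bornology.IsBounded U) {g₀ : Matrix (Fin n) (Fin n) ℝ} (hg : g₀.PosDef)
    (α β : ℝ) (hα : 0 < α) (hβ : 0 < β) (hβ1 : β < 1) (hα1 : α < 1/(1+(n:ℝ)*((n:ℝ)+1))) (hαβ : α < β/2) :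
    ∃ ε > 0, ∃ C > 0, ∃ r > 0, r ≤ 1 ∧ ∀ g u Θ μ δ, Hyp U g₀ g u Θ μ δ β ε r → Concl U g u μ δ α C := by
  obtain ⟨δs, hδs, ε, hε, C, hC, r, hr, h⟩ := core_small G hUo hUb hg α β hα hβ hβ1 hα1 hαβ
  obtain ⟨ε', hε', C', hC', r', hr', h'⟩ := core_large G hUo hUb hg α β hα hβ hβ1 hα1 hαβ δs hδs
  refine ⟨min ε ε', lt_min hε hε', C + C', by positivity, min 1 (min r r'), lt_min one_pos (lt_min hr hr'), min_le_left _ _, ?_⟩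
  intro g u Θ μ δ H
  have hμ : 0 < μ := lt_of_lt_of_le H.hδ H.hδμ
  rcases le_total δ δs with h1 | h1
  · exact (h g u Θ μ δ (H.mono ((min_le_right _ _).trans (min_le_left _ _)) (min_le_left _ _)) h1).mono (by linarith) H.hδ hμ
  · exact (h' g u Θ μ δ (H.mono ((min_le_right _ _).trans (min_le_right _ _)) (min_le_right _ _)) h1).mono (by linarith) H.hδ hμ

lemma norm_le_normE (z : Fin n → ℝ) : ‖z‖ ≤ normE z := by
  refine (pi_norm_le_iff_of_nonneg (Real.sqrt_nonneg _)).2 fun i => ?_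
  refine Real.abs_le_sqrt ?_
  exact Finset.single_le_sum (f := fun i => (z i)^2) (fun i _ => sq_nonneg _) (Finset.mem_univ i)

lemma normE_le (z : Fin n → ℝ) : normE z ≤ (n+1) * ‖z‖ := by
  refine Real.sqrt_le_iff.2 ⟨by positivity, ?_⟩
  have h1 : ∑ i, (z i)^2 ≤ n * ‖z‖^2 := by
    refine (Finset.sum_le_card_nsmul _ _ (‖z‖^2) fun i _ => ?_).trans (by simp)
    have := norm_le_pi_norm z i
    rw [← sq_abs]
    gcongr
    exact this
  have h2 : (0:ℝ) ≤ n := by positivity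
  have h3 : 0 ≤ ‖z‖^2 := by positivity
  nlinarith [mul_nonneg h2 h3, mul_nonneg (mul_nonneg h2 h2) h3]

lemma entry_le_frob (A : Matrix (Fin n) (Fin n) ℝ) (i j : Fin n) : |A i j| ≤ frobN A := by
  refine Real.abs_le_sqrt ?_
  refine le_trans ?_ (Finset.single_le_sum (f := fun i => ∑ j, (A i j)^2) (fun i _ => Finset.sum_nonneg fun _ _ => sq_nonneg _) (Finset.mem_univ i))
  exact Finset.single_le_sum (f := fun j => (A i j)^2) (fun i _ => sq_nonneg _) (Finset.mem_univ j)

lemma eps_conv {δ μ β θ ε N : ℝ} (hδ : 0 < δ) (hμ : 0 < μ) (hN : 0 < N) (h : δ^(β-2) * μ^(-β) * θ^2 ≤ ε / N) :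
    (N * θ^2) * (δ/μ)^β ≤ ε * δ^2 := by
  have e1 : δ^(β-2) = δ^β / δ^2 := by
    rw [Real.rpow_sub hδ]; norm_num
  rw [e1, Real.rpow_neg hμ.le] at h
  rw [Real.div_rpow hδ.le hμ.le]
  rw [le_div_iff₀ hN] at h
  have hμβ : 0 < μ^β := by positivity
  calc N * θ^2 * (δ^β/μ^β) = (δ^β/δ^2 * (μ^β)⁻¹ * θ^2 * N) * δ^2 := by field_simp
    _ ≤ _ := by gcongr

end fin3
end CI

open CI

/-- The detailed version of the `C^{1,α}` approximation theorem of
Conti–De Lellis–Székelyhidi for isometric immersions. -/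
theorem isometric_immersion_C1alpha_detailed
    (n : ℕ) (β : ℝ) (hβ : β ∈ Set.Ioo (0 : ℝ) 1)
    (α : ℝ) (hα0 : 0 < α)
    (hα : α < min (1 / (1 + (n : ℝ) * ((n : ℝ) + 1))) (β / 2))
    (g₀ : Matrix (Fin n) (Fin n) ℝ) (hg₀ : g₀.PosDef)
    (U : Set (Fin n → ℝ)) (hUo : IsOpen U) (hUb : Bornology.IsBounded U)
    (hUc : IsConnected U) (hUsm : HasSmoothBoundary U) :
    ∃ ε₀ > (0:ℝ), ∃ C > (0:ℝ), ∃ r > (0:ℝ),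
      ∀ θ μ δ : ℝ, 0 < θ → 0 < μ → 0 < δ → δ ≤ μ →
        δ ^ (β - 2) * μ ^ (-β) * θ ^ 2 ≤ ε₀ →
        ∀ (g : (Fin n → ℝ) → Matrix (Fin n) (Fin n) ℝ) (u : (Fin n → ℝ) → (Fin (n+1) → ℝ)),
          (∀ x, (g x).IsSymm) →
          (∀ x ∈ closure U, frobN (g x - g₀) ≤ r) →
          (∀ x ∈ closure U, ∀ y ∈ closure U, frobN (g x - g y) ≤ θ ^ 2 * normE (x - y) ^ β) →
          CkCl 2 U u →
          (∀ x ∈ U, frobN (pullback u x - g x) ≤ δ ^ 2) →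
          (∀ x ∈ U, ‖fderiv ℝ (fderiv ℝ u) x‖ ≤ μ) →
          ∃ ubar : (Fin n → ℝ) → (Fin (n+1) → ℝ),
            C1Holder α U ubar ∧
            (∀ x ∈ U, pullback ubar x = g x) ∧
            (∀ x ∈ U, ‖fderiv ℝ ubar x - fderiv ℝ u x‖ ≤ C * δ) ∧
            (∀ x ∈ U, ∀ y ∈ U,
              ‖(fderiv ℝ ubar x - fderiv ℝ u x) - (fderiv ℝ ubar y - fderiv ℝ u y)‖
                ≤ C * μ ^ α * δ ^ (1 - α) * normE (x - y) ^ α) := by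
  obtain ⟨hβ0, hβ1⟩ := hβ
  have hα1 := hα.trans_le (min_le_left _ _)
  have hαβ := hα.trans_le (min_le_right _ _)
  have hαlt : α < 1 := by linarith
  obtain ⟨η, M, t₀, c, R, G⟩ := exists_geo hUo hUb hUsm
  obtain ⟨ε, hε, C, hC, r, hr, hr1, hcore⟩ := core G hUo hUb hg₀ α β hα0 hβ0 hβ1 hα1 hαβ
  have hM := G.hM
  have hc := G.hc0
  have ht0 := G.ht0
  have hN : (0:ℝ) < (n:ℝ) + 1 := by positivity
  refine ⟨ε / ((n:ℝ)+1), by positivity, C, hC, r, hr, ?_⟩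
  intro θ μ δ hθ hμ hδ hδμ hsm g u hsym hnear hhol hu hpb hd2
  have hUcl : U ⊆ closure U := subset_closure
  obtain ⟨V, hV, hUV, huV⟩ := hu
  have hcpt : IsCompact (closure U) := hUb.isCompact_closure
  have hs0 : ∀ i j, g₀ i j = g₀ j i := by
    intro i j
    have := hg₀.isHermitian.apply j i
    simpa using this
  have hn0 : ∀ z : Fin n → ℝ, 0 ≤ normE z := fun z => Real.sqrt_nonneg _
  obtain ⟨F, hF1, hF2, hF3, hF4⟩ := holder_ext_mat (K := closure U) (g := g) (g₀ := g₀) (Θ := ((n:ℝ)+1) * θ^2) (β := β) (r := r)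
    (hUc.nonempty.mono hUcl) (by positivity) hβ0 hβ1 (fun x i j => (hsym x).apply j i) hs0 (by
      intro x hx y hy i j
      have h1 := (entry_le_frob (g x - g y) i j).trans (hhol x hx y hy)
      rw [Matrix.sub_apply] at h1
      refine h1.trans ?_
      have h2 : normE (x - y)^β ≤ ((n:ℝ)+1) * ‖x - y‖^β := by
        refine (Real.rpow_le_rpow (hn0 _) (normE_le _) hβ0.le).trans ?_
        rw [Real.mul_rpow hN.le (norm_nonneg _)]
        have h3 : ((n:ℝ)+1)^β ≤ (n:ℝ)+1 := by
          calc ((n:ℝ)+1)^β ≤ ((n:ℝ)+1)^(1:ℝ) := Real.rpow_le_rpow_of_exponent_le (by linarith [(Nat.cast_nonneg n : (0:ℝ) ≤ n)]) hβ1.le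
            _ = _ := Real.rpow_one _
        gcongr
      calc θ^2 * normE (x - y)^β ≤ θ^2 * (((n:ℝ)+1) * ‖x - y‖^β) := by gcongr
        _ = _ := by ring) (by
      intro x hx i j
      exact (entry_le_frob (g x - g₀) i j).trans (hnear x hx))
  have H : Hyp U g₀ F u (((n:ℝ)+1) * θ^2) μ δ β ε r := by
    refine ⟨by positivity, hδ, hδμ, eps_conv hδ hμ hN hsm, hF2, hF3, hF4, ?_, ?_, hd2, ?_⟩
    · exact huV.mono (hUcl.trans hUV)
    · obtain ⟨B0, hB0⟩ := hcpt.exists_bound_of_continuousOn (huV.continuousOn.mono hUV)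
      exact ⟨B0, fun x hx => hB0 x (hUcl hx)⟩
    · intro x hx i j
      rw [hF1 x (hUcl hx)]
      exact (entry_le_frob (pullback u x - g x) i j).trans (hpb x hx)
  obtain ⟨ub, ρ, hρ, b1, b2, b3, b4⟩ := hcore F u _ μ δ H
  have hUρ : closure U ⊆ Metric.thickening ρ U := Metric.closure_subset_thickening hρ U
  have b4' : ∀ x ∈ U, ∀ y ∈ U,
              ‖(fderiv ℝ ub x - fderiv ℝ u x) - (fderiv ℝ ub y - fderiv ℝ u y)‖
                ≤ C * μ ^ α * δ ^ (1 - α) * normE (x - y) ^ α := by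
    intro x hx y hy
    refine (b4 x hx y hy).trans ?_
    rw [← mul_assoc C]
    gcongr
    exact norm_le_normE _
  refine ⟨ub, ⟨fun x hx => (b1 x (hUρ hx)).continuousAt.continuousWithinAt,
    fun x hx => (b1 x (hUρ (hUcl hx))).differentiableWithinAt, ?_⟩, ?_, b3, b4'⟩
  · have hgrad := H.grad hr1
    have hGm := Gm_ge g₀
    set K := (n:ℝ) * (Gm g₀ + δ) / δ + (6 * M / c + 2) with hK
    have hK0 : 0 ≤ (n:ℝ) * (Gm g₀ + δ) / δ := by positivity
    have hK1 : 0 ≤ 6 * M / c + 2 := by positivity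
    have hh := hold_glob (U := U) (f := fun x => fderiv ℝ u x) (K := K) (α := α) (d := c * t₀ / (3 * M)) (by positivity) hδ hμ
      (by positivity) hα0 hαlt (by
        intro x hx
        refine (hgrad x hx).trans ?_
        have e : (n:ℝ) * (Gm g₀ + δ) = (n:ℝ) * (Gm g₀ + δ) / δ * δ := by field_simp
        rw [e]
        gcongr
        linarith) (by
        intro x hx y hy hxy
        refine (G.quasi hUo H.hu H.d2 hx hy (hxy.trans ?_)).trans ?_
        · exact mul_le_of_le_one_right (by positivity) ((div_le_one hμ).2 hδμ)
        · gcongr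
          linarith)
    refine ⟨C * μ^α * δ^(1-α) + (2 * K + 2 * K / (c * t₀ / (3 * M))) * (μ^α * δ^(1-α)), fun x hx y hy => ?_⟩
    have e : fderiv ℝ ub x - fderiv ℝ ub y = ((fderiv ℝ ub x - fderiv ℝ u x) - (fderiv ℝ ub y - fderiv ℝ u y)) +
      (fderiv ℝ u x - fderiv ℝ u y) := by abel
    rw [e, add_mul]
    refine (norm_add_le _ _).trans (add_le_add (b4' x hx y hy) ((hh x hx y hy).trans ?_))
    refine mul_le_mul_of_nonneg_left (Real.rpow_le_rpow (norm_nonneg _) (norm_le_normE _) hα0.le) ?_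
    positivity
  · intro x hx
    ext i j
    rw [← hF1 x (hUcl hx)]
    exact b2 x hx i j
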